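/- Let F_n be a forest chosen uniformly at random among all labelled forests on the vertex set {1,…,n}. Then the sequence of random variables (β(F_n) − E[β(F_n)]) / sqrt(Var[β(F_n)]) converges in distribution, as n → ∞, to a standard normal random variable. -/

import Mathlib

open scoped Classical BigOperators
open Filter Topology

noncomputable section

namespace MetricDimPaper

/-- `R` is a resolving set of `G`: every pair of distinct vertices is distinguished by its
vector of (extended, possibly infinite) distances to the vertices of `R`. -/
def Resolves {V : Type*} (G : SimpleGraph V) (R : Set V) : Prop :=
  ∀ u v : V, u ≠ v → ∃ w ∈ R, G.edist u w ≠ G.edist v w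

/-- The metric dimension of a graph: the least cardinality of a resolving set, with the
convention that a single isolated vertex has metric dimension 1. -/
def metricDim {V : Type*} (G : SimpleGraph V) : ℕ :=
  if Nat.card V = 1 then 1
  else sInf {m : ℕ | ∃ R : Set V, R.ncard = m ∧ Resolves G R}

/-- A tree: a connected acyclic graph. -/
def IsTree {V : Type*} (G : SimpleGraph V) : Prop := G.Connected ∧ G.IsAcyclic

/-- degree of a vertex (as `Nat.card` of the neighbor set). -/
def ndeg {V : Type*} (G : SimpleGraph V) (v : V) : ℕ := (G.neighborSet v).ncard

/-- metric dimension as a real number -/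
def betaR {n : ℕ} (G : SimpleGraph (Fin n)) : ℝ := (metricDim G : ℝ)

def treeSet (n : ℕ) : Set (SimpleGraph (Fin n)) := {G | IsTree G}

def forestSet (n : ℕ) : Set (SimpleGraph (Fin n)) := {G | G.IsAcyclic}

/-- Expectation of `f` under the uniform distribution on the (finite) set `S` of graphs. -/
def unifExp {n : ℕ} (S : Set (SimpleGraph (Fin n))) (f : SimpleGraph (Fin n) → ℝ) : ℝ :=
  (∑ᶠ G ∈ S, f G) / (Nat.card ↥S)

/-- Variance of `f` under the uniform distribution on `S`. -/
def unifVar {n : ℕ} (S : Set (SimpleGraph (Fin n))) (f : SimpleGraph (Fin n) → ℝ) : ℝ :=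
  unifExp S (fun G => (f G - unifExp S f) ^ 2)

/-- Probability of the event `A` under the uniform distribution on `S`. -/
def unifPr {n : ℕ} (S A : Set (SimpleGraph (Fin n))) : ℝ :=
  (Nat.card ↥(S ∩ A) : ℝ) / (Nat.card ↥S)

/-- The probability weight of an individual graph in the Erdős–Rényi model `G(n,p)`. -/
def erWeight (n : ℕ) (p : ℝ) (G : SimpleGraph (Fin n)) : ℝ :=
  p ^ (Nat.card ↥G.edgeSet) * (1 - p) ^ (n.choose 2 - Nat.card ↥G.edgeSet)

/-- Expectation of `f` in the Erdős–Rényi model `G(n,p)`. -/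
def erExp (n : ℕ) (p : ℝ) (f : SimpleGraph (Fin n) → ℝ) : ℝ :=
  ∑ᶠ G : SimpleGraph (Fin n), erWeight n p G * f G

/-- Variance of `f` in the Erdős–Rényi model `G(n,p)`. -/
def erVar (n : ℕ) (p : ℝ) (f : SimpleGraph (Fin n) → ℝ) : ℝ :=
  erExp n p (fun G => (f G - erExp n p f) ^ 2)

/-- Probability of the event `A` in the Erdős–Rényi model `G(n,p)`. -/
def erPr (n : ℕ) (p : ℝ) (A : Set (SimpleGraph (Fin n))) : ℝ :=
  ∑ᶠ G ∈ A, erWeight n p G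

/-- The cumulative distribution function of the standard normal law. -/
def stdGaussianCDF (x : ℝ) : ℝ :=
  (Real.sqrt (2 * Real.pi))⁻¹ * ∫ t in Set.Iic x, Real.exp (-(t ^ 2) / 2)

/-- The normalized metric dimension `(β - E β)/sqrt (Var β)` for the uniform model on `S`. -/
def normβ {n : ℕ} (S : Set (SimpleGraph (Fin n))) (G : SimpleGraph (Fin n)) : ℝ :=
  (betaR G - unifExp S betaR) / Real.sqrt (unifVar S betaR)

/-- The normalized metric dimension `(β - E β)/sqrt (Var β)` for the `G(n,p)` model. -/
def erNormβ (n : ℕ) (p : ℝ) (G : SimpleGraph (Fin n)) : ℝ :=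
  (betaR G - erExp n p betaR) / Real.sqrt (erVar n p betaR)


section

section FunctionalGraphs

variable {V : Type*}

/-- `x` is a descendant of `c`: iterating `f` from `x` eventually hits `c`. -/
def Desc (f : V → V) (c x : V) : Prop := ∃ k, f^[k] x = c

/-- `c` lies on a cycle of `f`. -/
def Cyc (f : V → V) (c : V) : Prop := ∃ k, f^[k + 1] c = c

/-- `R` meets the descendants of one of any two distinct non-cyclic siblings. -/
def Valid (f : V → V) (R : Finset V) : Prop :=
  ∀ c₁ c₂, c₁ ≠ c₂ → ¬ Cyc f c₁ → ¬ Cyc f c₂ → f c₁ = f c₂ →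
    ∃ x ∈ R, Desc f c₁ x ∨ Desc f c₂ x

/-- The least size of a valid set. -/
def validNum (f : V → V) : ℕ := sInf {m | ∃ R : Finset V, R.card = m ∧ Valid f R}

theorem Desc.refl (f : V → V) (c : V) : Desc f c c := ⟨0, rfl⟩

theorem Desc.trans {f : V → V} {a b c : V} (h₁ : Desc f a b) (h₂ : Desc f b c) :
    Desc f a c := by
  obtain ⟨k, rfl⟩ := h₁
  obtain ⟨l, rfl⟩ := h₂
  exact ⟨k + l, Function.iterate_add_apply f k l c⟩

theorem Desc.apply (f : V → V) (c : V) : Desc f (f c) c := ⟨1, rfl⟩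

theorem Desc.of_apply {f : V → V} {c x : V} (h : Desc f c (f x)) : Desc f c x :=
  h.trans (Desc.apply f x)

theorem Desc.apply_of_ne {f : V → V} {c x : V} (h : Desc f c x) (hx : x ≠ c) :
    Desc f c (f x) := by
  obtain ⟨k, hk⟩ := h
  cases k with
  | zero => exact absurd hk hx
  | succ k => exact ⟨k, hk⟩

theorem cyc_iff_desc {f : V → V} {c : V} : Cyc f c ↔ Desc f c (f c) := Iff.rfl

theorem Cyc.apply {f : V → V} {c : V} (h : Cyc f c) : Cyc f (f c) := by
  obtain ⟨k, hk⟩ := h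
  refine ⟨k, ?_⟩
  rw [Function.Commute.iterate_left (Function.Commute.refl f) (k + 1) c, hk]

theorem Cyc.of_desc {f : V → V} {c x : V} (hx : Cyc f x) (h : Desc f c x) : Cyc f c := by
  obtain ⟨k, rfl⟩ := h
  induction k with
  | zero => exact hx
  | succ k ih => rw [Function.iterate_succ_apply']; exact ih.apply

/-- Two points on a common forward orbit are comparable. -/
theorem Desc.comparable {f : V → V} {a b x : V} (ha : Desc f a x) (hb : Desc f b x) :
    Desc f a b ∨ Desc f b a := by
  obtain ⟨k, rfl⟩ := ha
  obtain ⟨l, rfl⟩ := hb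
  rcases le_total k l with h | h
  · right; exact ⟨l - k, by rw [← Function.iterate_add_apply, Nat.sub_add_cancel h]⟩
  · left; exact ⟨k - l, by rw [← Function.iterate_add_apply, Nat.sub_add_cancel h]⟩

theorem valid_univ [Fintype V] (f : V → V) : Valid f Finset.univ :=
  fun c₁ _ _ _ _ _ => ⟨c₁, Finset.mem_univ _, Or.inl (Desc.refl f c₁)⟩

theorem validNum_le {f : V → V} {R : Finset V} (h : Valid f R) : validNum f ≤ R.card :=
  Nat.sInf_le ⟨R, rfl, h⟩

theorem exists_valid_card_eq [Fintype V] (f : V → V) :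
    ∃ R : Finset V, R.card = validNum f ∧ Valid f R :=
  Nat.sInf_mem (s := {m | ∃ R : Finset V, R.card = m ∧ Valid f R})
    ⟨_, Finset.univ, rfl, valid_univ f⟩

theorem iterate_eq_of_avoid {f f' : V → V} {j : V} (h : ∀ x, x ≠ j → f x = f' x) {x : V}
    {k : ℕ} (hx : ∀ i < k, f^[i] x ≠ j) : f'^[k] x = f^[k] x := by
  induction k with
  | zero => rfl
  | succ k ih =>
    rw [Function.iterate_succ_apply', Function.iterate_succ_apply',
      ih fun i hi => hx i (by omega), h _ (hx k (by omega))]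

theorem Desc.of_eq_off {f f' : V → V} {j : V} (h : ∀ x, x ≠ j → f x = f' x) {c x : V}
    (hj : ¬ Desc f c j) (hx : Desc f c x) : Desc f' c x := by
  obtain ⟨k, rfl⟩ := hx
  refine ⟨k, iterate_eq_of_avoid h fun i hi hij => hj ⟨k - i, ?_⟩⟩
  rw [← hij, ← Function.iterate_add_apply, Nat.sub_add_cancel hi.le]

theorem not_desc_of_eq_off {f f' : V → V} {j : V} (h : ∀ x, x ≠ j → f x = f' x) {c : V}
    (h₁ : ¬ Desc f' c j) (h₂ : ¬ Desc f' c (f j)) : ¬ Desc f c j := by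
  rintro hd
  have hk := Nat.find_spec hd
  have hmin : ∀ i, i < Nat.find hd → f^[i] j ≠ c := fun i hi => Nat.find_min hd hi
  generalize Nat.find hd = k at hk hmin
  cases k with
  | zero => exact h₁ ⟨0, hk⟩
  | succ k =>
    refine h₂ ⟨k, ?_⟩
    rw [iterate_eq_of_avoid h, ← hk, Function.iterate_succ_apply]
    intro i hi hij
    rw [← Function.iterate_succ_apply] at hij
    refine hmin (k - i) (by omega) ?_
    rw [← hk, show k + 1 = k - i + (i + 1) by omega, Function.iterate_add_apply f (k - i), hij]

theorem Valid.of_eq_off {f f' : V → V} {j : V} (h : ∀ x, x ≠ j → f x = f' x)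
    {R : Finset V} (hR : Valid f R) : Valid f' (insert (f j) (insert j R)) := by
  intro c₁ c₂ hne hc₁ hc₂ he
  by_contra! hcon
  have key : ∀ c, (∀ x ∈ insert (f j) (insert j R), ¬ Desc f' c x) →
      ¬ Desc f c j ∧ ¬ Desc f' c j := fun c hc => by
    have h₁ := hc j (by simp)
    exact ⟨not_desc_of_eq_off h h₁ (hc _ (by simp)), h₁⟩
  obtain ⟨d₁, e₁⟩ := key c₁ fun x hx => (hcon x hx).1
  obtain ⟨d₂, e₂⟩ := key c₂ fun x hx => (hcon x hx).2
  have n₁ : c₁ ≠ j := fun hh => d₁ (hh ▸ Desc.refl f c₁)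
  have n₂ : c₂ ≠ j := fun hh => d₂ (hh ▸ Desc.refl f c₂)
  have f₁ := h c₁ n₁
  have f₂ := h c₂ n₂
  obtain ⟨x, hx, hd⟩ := hR c₁ c₂ hne
    (fun hc => hc₁ (by rw [cyc_iff_desc, ← f₁]; exact Desc.of_eq_off h d₁ hc))
    (fun hc => hc₂ (by rw [cyc_iff_desc, ← f₂]; exact Desc.of_eq_off h d₂ hc))
    (by rw [f₁, f₂, he])
  have := hcon x (by simp [hx])
  rcases hd with hd | hd
  · exact this.1 (Desc.of_eq_off h d₁ hd)
  · exact this.2 (Desc.of_eq_off h d₂ hd)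

theorem validNum_le_of_eq_off [Fintype V] {f f' : V → V} {j : V}
    (h : ∀ x, x ≠ j → f x = f' x) : validNum f' ≤ validNum f + 2 := by
  obtain ⟨R, hR, hv⟩ := exists_valid_card_eq f
  refine (validNum_le (hv.of_eq_off h)).trans ?_
  have h₁ := Finset.card_insert_le (f j) (insert j R)
  have h₂ := Finset.card_insert_le j R
  omega

theorem abs_validNum_sub_le [Fintype V] {f f' : V → V} {j : V}
    (h : ∀ x, x ≠ j → f x = f' x) : |(validNum f : ℝ) - validNum f'| ≤ 2 := by
  have h₁ := validNum_le_of_eq_off h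
  have h₂ := validNum_le_of_eq_off fun x hx => (h x hx).symm
  rw [abs_le]
  constructor <;> [skip; skip] <;>
    · have h₁' : (validNum f' : ℝ) ≤ validNum f + 2 := by exact_mod_cast h₁
      have h₂' : (validNum f : ℝ) ≤ validNum f' + 2 := by exact_mod_cast h₂
      linarith

theorem validNum_le_card [Fintype V] (f : V → V) : validNum f ≤ Fintype.card V :=
  validNum_le (valid_univ f)

/-- The descendants of `c` form a chain of `m + 1` vertices. -/
def Thin (f : V → V) : ℕ → V → Prop
  | 0, c => ∀ x, f x ≠ c
  | m + 1, c => ∃ d, (∀ x, f x = c ↔ x = d) ∧ Thin f m d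

theorem Thin.child {f : V → V} {m : ℕ} {c x : V} (h : Thin f m c) (hx : f x = c) :
    ∃ m', m = m' + 1 ∧ Thin f m' x ∧ ∀ y, f y = c → y = x := by
  cases m with
  | zero => exact absurd hx (h x)
  | succ m =>
    obtain ⟨d, hd, ht⟩ := h
    obtain rfl := (hd x).1 hx
    exact ⟨m, rfl, ht, fun y hy => (hd y).1 hy⟩

theorem Thin.not_cyc {f : V → V} {m : ℕ} {c : V} (h : Thin f m c) : ¬ Cyc f c := by
  induction m generalizing c with
  | zero =>
    rintro ⟨k, hk⟩
    rw [Function.iterate_succ_apply'] at hk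
    exact h _ hk
  | succ m ih =>
    rintro hc
    obtain ⟨d, hd, ht⟩ := h
    obtain ⟨k, hk⟩ := hc
    have hk' := hk
    rw [Function.iterate_succ_apply'] at hk
    have := (hd _).1 hk
    refine ih ht ⟨k, ?_⟩
    rw [Function.iterate_succ_apply, (hd d).2 rfl, this]

theorem Thin.desc {f : V → V} {m : ℕ} {c x : V} (h : Thin f m c) (hx : Desc f c x) :
    ∃ m', Thin f m' x := by
  obtain ⟨k, hk⟩ := hx
  induction k generalizing c m with
  | zero =>
    obtain rfl : x = c := hk
    exact ⟨m, h⟩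
  | succ k ih =>
    rw [Function.iterate_succ_apply'] at hk
    obtain ⟨m', -, ht, -⟩ := h.child hk
    exact ih ht rfl

variable [Fintype V]

/-- The children of `w` whose descendants form a chain of at most `h` vertices. -/
def thinChildren (f : V → V) (h : ℕ) (w : V) : Finset V :=
  Finset.univ.filter fun c => f c = w ∧ ∃ m < h, Thin f m c

theorem mem_thinChildren {f : V → V} {h : ℕ} {w c : V} :
    c ∈ thinChildren f h w ↔ f c = w ∧ ∃ m < h, Thin f m c := by
  simp [thinChildren]

theorem Thin.lt_card {f : V → V} {m : ℕ} {c : V} (h : Thin f m c) : m < Fintype.card V := by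
  suffices H : ∀ m c, Thin f m c → ∃ s : Finset V, s.card = m + 1 ∧ ∀ x ∈ s, Desc f c x by
    obtain ⟨s, hs, -⟩ := H m c h
    have := s.card_le_univ
    omega
  intro m
  induction m with
  | zero => exact fun c _ => ⟨{c}, by simp, by simp [Desc.refl]⟩
  | succ m ih =>
    intro c hc
    obtain ⟨d, hd, ht⟩ := id hc
    obtain ⟨s, hs, hsd⟩ := ih d ht
    have hdc : f d = c := (hd d).2 rfl
    refine ⟨insert c s, ?_, ?_⟩
    · rw [Finset.card_insert_of_notMem, hs]
      intro hcs
      refine ht.not_cyc ?_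
      rw [cyc_iff_desc, hdc]
      exact hsd c hcs
    · intro x hx
      rcases Finset.mem_insert.1 hx with rfl | hx
      · exact Desc.refl f _
      · exact Desc.trans (hdc ▸ Desc.apply f d) (hsd x hx)

/-- The truncated form of `validNum`, taking into account thin branches with fewer than
`h + 1` vertices only. -/
def thinExcess (f : V → V) (h : ℕ) : ℕ := ∑ w, ((thinChildren f h w).card - 1)

theorem mem_thinChildren_card {f : V → V} {w c : V} :
    c ∈ thinChildren f (Fintype.card V) w ↔ f c = w ∧ ∃ m, Thin f m c := by
  rw [mem_thinChildren]
  exact and_congr_right fun _ =>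
    ⟨fun ⟨m, _, h⟩ => ⟨m, h⟩, fun ⟨m, h⟩ => ⟨m, h.lt_card, h⟩⟩

theorem thinExcess_le_card_of_valid {f : V → V} {R : Finset V} (hR : Valid f R) :
    thinExcess f (Fintype.card V) ≤ R.card := by
  set T := thinChildren f (Fintype.card V) with hT
  set P : V → Finset V := fun w =>
    if 2 ≤ (T w).card then (T w).filter (fun c => ∃ x ∈ R, Desc f c x) else ∅ with hP
  have hmemP : ∀ w c, c ∈ P w → 2 ≤ (T w).card ∧ c ∈ T w ∧ ∃ x ∈ R, Desc f c x := by
    intro w c hc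
    simp only [hP] at hc
    split_ifs at hc with h
    · exact ⟨h, (Finset.mem_filter.1 hc).1, (Finset.mem_filter.1 hc).2⟩
    · simp at hc
  have hle : ∀ w, (T w).card - 1 ≤ (P w).card := by
    intro w
    by_cases h : 2 ≤ (T w).card
    · simp only [hP, if_pos h]
      have hsplit := Finset.card_filter_add_card_filter_not (s := T w)
        (fun c => ∃ x ∈ R, Desc f c x)
      have : ((T w).filter fun c => ¬ ∃ x ∈ R, Desc f c x).card ≤ 1 := by
        refine Finset.card_le_one.2 fun a ha b hb => ?_
        by_contra hab
        rw [Finset.mem_filter] at ha hb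
        obtain ⟨ha₁, m, ha₂⟩ := mem_thinChildren_card.1 ha.1
        obtain ⟨hb₁, m', hb₂⟩ := mem_thinChildren_card.1 hb.1
        obtain ⟨x, hx, hd⟩ := hR a b hab ha₂.not_cyc hb₂.not_cyc (ha₁.trans hb₁.symm)
        rcases hd with hd | hd
        · exact ha.2 ⟨x, hx, hd⟩
        · exact hb.2 ⟨x, hx, hd⟩
      omega
    · omega
  calc thinExcess f (Fintype.card V) ≤ ∑ w, (P w).card := Finset.sum_le_sum fun w _ => hle w
    _ = (Finset.univ.biUnion P).card := by
        rw [Finset.card_biUnion]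
        intro w _ w' _ hne
        rw [Function.onFun, Finset.disjoint_left]
        intro c hc hc'
        exact hne ((mem_thinChildren.1 (hmemP w c hc).2.1).1.symm.trans
          (mem_thinChildren.1 (hmemP w' c hc').2.1).1)
    _ ≤ R.card := by
        have hc : ∀ c ∈ Finset.univ.biUnion P, ∃ x, x ∈ R ∧ Desc f c x := by
          intro c hc
          obtain ⟨w, -, hw⟩ := Finset.mem_biUnion.1 hc
          exact (hmemP w c hw).2.2
        choose! r hr using hc
        refine Finset.card_le_card_of_injOn r (fun c hc => (hr c hc).1) ?_
        have key : ∀ c ∈ Finset.univ.biUnion P, ∀ c' ∈ Finset.univ.biUnion P,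
            c ≠ c' → ¬ Desc f c' c := by
          intro c hc c' hc' hne hd
          obtain ⟨w, -, hw⟩ := Finset.mem_biUnion.1 hc
          obtain ⟨w', -, hw'⟩ := Finset.mem_biUnion.1 hc'
          obtain ⟨h2, hcT, -⟩ := hmemP w c hw
          obtain ⟨-, hcT', -⟩ := hmemP w' c' hw'
          obtain ⟨rfl, m, hm⟩ := mem_thinChildren.1 hcT
          obtain ⟨rfl, m', -, hm'⟩ := mem_thinChildren.1 hcT'
          obtain ⟨m'', hw⟩ := hm'.desc (hd.apply_of_ne hne)
          obtain ⟨-, -, -, hu⟩ := hw.child rfl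
          have : (T (f c)).card ≤ 1 := Finset.card_le_one.2 fun a ha b hb => by
            rw [hu a (mem_thinChildren.1 ha).1, hu b (mem_thinChildren.1 hb).1]
          omega
        intro c hc c' hc' he
        by_contra hne
        have h₁ := (hr c hc).2
        have h₂ := (hr c' hc').2
        rw [← he] at h₂
        rcases h₁.comparable h₂ with h | h
        · exact key c' hc' c hc (Ne.symm hne) h
        · exact key c hc c' hc' hne h

theorem exists_valid_card_le_thinExcess (f : V → V) :
    ∃ R, Valid f R ∧ R.card ≤ thinExcess f (Fintype.card V) := by
  set T := thinChildren f (Fintype.card V) with hT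
  have hrep : ∀ w, ∃ r : V, (T w).Nonempty → r ∈ T w := fun w => by
    by_cases h : (T w).Nonempty
    · exact ⟨h.choose, fun _ => h.choose_spec⟩
    · exact ⟨w, fun h' => absurd h' h⟩
  choose rep hrep using hrep
  set R : Finset V := Finset.univ.biUnion fun w => (T w).erase (rep w) with hRdef
  have hmem : ∀ c, (∃ m, Thin f m c) → c ∉ R → c = rep (f c) := by
    intro c hc hcR
    by_contra hne
    refine hcR (Finset.mem_biUnion.2 ⟨f c, Finset.mem_univ _, Finset.mem_erase.2 ⟨hne, ?_⟩⟩)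
    exact mem_thinChildren_card.2 ⟨rfl, hc⟩
  have hthin : ∀ N c, (Finset.univ.filter (Desc f c)).card ≤ N → ¬ Cyc f c →
      (∀ x ∈ R, ¬ Desc f c x) → ∃ m, Thin f m c := by
    intro N
    induction N with
    | zero =>
      intro c hN
      have : c ∈ Finset.univ.filter (Desc f c) := by simp [Desc.refl]
      have := Finset.card_pos.2 ⟨c, this⟩
      omega
    | succ N ih =>
      intro c hN hc hR
      have hch : ∀ d, f d = c → (∃ m, Thin f m d) ∧ d = rep c := by
        rintro d rfl
        have hd : ¬ Cyc f d := fun h => hc h.apply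
        have hdR : ∀ x ∈ R, ¬ Desc f d x := fun x hx h =>
          hR x hx (Desc.trans (Desc.apply f d) h)
        have hcard : (Finset.univ.filter (Desc f d)).card ≤ N := by
          refine Nat.lt_succ_iff.1 (lt_of_lt_of_le (Finset.card_lt_card ?_) hN)
          refine ⟨fun x hx => ?_, fun hss => ?_⟩
          · simp only [Finset.mem_filter, Finset.mem_univ, true_and] at hx ⊢
            exact Desc.trans (Desc.apply f d) hx
          · have := hss (show f d ∈ Finset.univ.filter (Desc f (f d)) by simp [Desc.refl])
            simp only [Finset.mem_filter, Finset.mem_univ, true_and] at this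
            exact hd this
        have ht := ih d hcard hd hdR
        exact ⟨ht, hmem d ht fun h => hdR d h (Desc.refl f d)⟩
      by_cases hex : ∃ d, f d = c
      · obtain ⟨d, hd⟩ := hex
        obtain ⟨⟨m, hm⟩, hdr⟩ := hch d hd
        refine ⟨m + 1, d, fun x => ⟨fun hx => ?_, fun hx => hx ▸ hd⟩, hm⟩
        rw [(hch x hx).2, hdr]
      · push Not at hex
        exact ⟨0, hex⟩
  refine ⟨R, ?_, ?_⟩
  · intro c₁ c₂ hne h₁ h₂ he
    by_contra! hcon
    have a₁ := hthin _ c₁ le_rfl h₁ fun x hx => (hcon x hx).1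
    have a₂ := hthin _ c₂ le_rfl h₂ fun x hx => (hcon x hx).2
    have b₁ := hmem c₁ a₁ fun h => (hcon _ h).1 (Desc.refl f _)
    have b₂ := hmem c₂ a₂ fun h => (hcon _ h).2 (Desc.refl f _)
    exact hne (by rw [b₁, b₂, he])
  · refine Finset.card_biUnion_le.trans (Finset.sum_le_sum fun w _ => ?_)
    by_cases h : (T w).Nonempty
    · rw [Finset.card_erase_of_mem (hrep w h)]
    · rw [Finset.not_nonempty_iff_eq_empty] at h
      simp [h]

theorem validNum_eq_thinExcess (f : V → V) :
    validNum f = thinExcess f (Fintype.card V) := by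
  obtain ⟨R, hR, hv⟩ := exists_valid_card_eq f
  obtain ⟨R', hv', hR'⟩ := exists_valid_card_le_thinExcess f
  exact le_antisymm ((validNum_le hv').trans hR') (hR ▸ thinExcess_le_card_of_valid hv)

end FunctionalGraphs

end

section

section ProductSpace

variable {n : ℕ} {α : Type*}

/-- The configuration which agrees with `x'` on coordinates below `k` and with `x` elsewhere. -/
def hyb (k : ℕ) (x x' : Fin n → α) : Fin n → α := fun i => if i.val < k then x' i else x i

theorem hyb_zero (x x' : Fin n → α) : hyb 0 x x' = x := by
  ext i; simp [hyb]

theorem hyb_self (x x' : Fin n → α) : hyb n x x' = x' := by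
  ext i; simp [hyb]

theorem hyb_succ (j : Fin n) (x x' : Fin n → α) :
    hyb (j + 1) x x' = Function.update (hyb j x x') j (x' j) := by
  ext i
  by_cases h : i = j
  · subst h; simp [hyb]
  · rw [Function.update_of_ne h]
    have : (i : ℕ) ≠ j := fun h' => h (Fin.ext h')
    simp only [hyb]
    congr 1
    apply propext
    omega

/-- Exchange of one coordinate between two configurations. -/
def swapAt (j : Fin n) (p : (Fin n → α) × (Fin n → α)) : (Fin n → α) × (Fin n → α) :=
  (Function.update p.1 j (p.2 j), Function.update p.2 j (p.1 j))

theorem swapAt_involutive (j : Fin n) : Function.Involutive (swapAt (α := α) j) := by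
  rintro ⟨x, x'⟩
  simp [swapAt]

theorem hyb_swapAt (j : Fin n) (x x' : Fin n → α) :
    hyb j (swapAt j (x, x')).1 (swapAt j (x, x')).2 = hyb (j + 1) x x' := by
  ext i
  by_cases h : i = j
  · subst h; simp [hyb, swapAt]
  · have : (i : ℕ) ≠ j := fun h' => h (Fin.ext h')
    simp only [hyb, swapAt, Function.update_of_ne h]
    congr 1
    apply propext
    omega

theorem hyb_succ_swapAt (j : Fin n) (x x' : Fin n → α) :
    hyb (j + 1) (swapAt j (x, x')).1 (swapAt j (x, x')).2 = hyb j x x' := by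
  ext i
  by_cases h : i = j
  · subst h; simp [hyb, swapAt]
  · have : (i : ℕ) ≠ j := fun h' => h (Fin.ext h')
    simp only [hyb, swapAt, Function.update_of_ne h]
    congr 1
    apply propext
    omega

/-- The involution replacing a pair of configurations by two complementary hybrids. -/
def hybPair (k : ℕ) (p : (Fin n → α) × (Fin n → α)) : (Fin n → α) × (Fin n → α) :=
  (hyb k p.1 p.2, hyb k p.2 p.1)

theorem hybPair_involutive (k : ℕ) : Function.Involutive (hybPair (n := n) (α := α) k) := by
  rintro ⟨x, x'⟩
  ext i <;> simp only [hybPair, hyb] <;> split_ifs <;> rfl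

variable [Fintype α] [Nonempty α]

theorem expect_prod_fst {X Y : Type*} [Fintype X] [Fintype Y] [Nonempty Y]
    {𝕜 : Type*} [RCLike 𝕜] (F : X → 𝕜) : 𝔼 p : X × Y, F p.1 = 𝔼 x, F x := by
  have := Finset.expect_product (Finset.univ : Finset X) (Finset.univ : Finset Y)
    (fun p => F p.1)
  rw [Finset.univ_product_univ] at this
  rw [this]
  exact Finset.expect_congr rfl fun x _ => Fintype.expect_const (F x)

theorem expect_prod_snd {X Y : Type*} [Fintype X] [Fintype Y] [Nonempty X]
    {𝕜 : Type*} [RCLike 𝕜] (F : Y → 𝕜) : 𝔼 p : X × Y, F p.2 = 𝔼 y, F y := by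
  have := Finset.expect_product (Finset.univ : Finset X) (Finset.univ : Finset Y)
    (fun p => F p.2)
  rw [Finset.univ_product_univ] at this
  rw [this]
  exact Fintype.expect_const (𝔼 y, F y)

theorem expect_prod {X Y : Type*} [Fintype X] [Fintype Y]
    {𝕜 : Type*} [RCLike 𝕜] (F : X × Y → 𝕜) : 𝔼 p, F p = 𝔼 x, 𝔼 y, F (x, y) := by
  rw [← Finset.univ_product_univ, Finset.expect_product]

theorem cov_identity {𝕜 : Type*} [RCLike 𝕜] (H F : (Fin n → α) → 𝕜) :
    𝔼 x, H x * (F x - 𝔼 y, F y) =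
      𝔼 p : (Fin n → α) × (Fin n → α), (∑ j : Fin n,
        (H p.1 - H (Function.update p.1 j (p.2 j))) *
          (F (hyb j p.1 p.2) - F (hyb (j + 1) p.1 p.2))) / 2 := by
  have h₁ : 𝔼 x, H x * (F x - 𝔼 y, F y) =
      𝔼 p : (Fin n → α) × (Fin n → α), H p.1 * (F p.1 - F p.2) := by
    rw [expect_prod]
    refine Finset.expect_congr rfl fun x _ => ?_
    dsimp only
    rw [← Finset.mul_expect, Finset.expect_sub_distrib, Fintype.expect_const]
  have h₂ : ∀ p : (Fin n → α) × (Fin n → α), H p.1 * (F p.1 - F p.2) =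
      ∑ j : Fin n, H p.1 * (F (hyb j p.1 p.2) - F (hyb (j + 1) p.1 p.2)) := by
    intro p
    rw [← Finset.mul_sum]
    congr 1
    have := Finset.sum_range_sub' (fun k => F (hyb k p.1 p.2)) n
    rw [hyb_zero, hyb_self] at this
    rw [← this, Finset.sum_range]
  have h₃ : ∀ j : Fin n, 𝔼 p : (Fin n → α) × (Fin n → α),
      H (Function.update p.1 j (p.2 j)) * (F (hyb j p.1 p.2) - F (hyb (j + 1) p.1 p.2)) =
      - 𝔼 p : (Fin n → α) × (Fin n → α),
        H p.1 * (F (hyb j p.1 p.2) - F (hyb (j + 1) p.1 p.2)) := by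
    intro j
    rw [← Finset.expect_neg_distrib]
    refine Fintype.expect_bijective (swapAt j) (swapAt_involutive j).bijective _ _ ?_
    rintro ⟨x, x'⟩
    rw [hyb_swapAt, hyb_succ_swapAt]
    simp only [swapAt]
    ring
  rw [h₁, Finset.expect_congr rfl fun p _ => h₂ p, Finset.expect_sum_comm,
    ← Finset.expect_div, Finset.expect_sum_comm, Finset.sum_div]
  refine Finset.sum_congr rfl fun j _ => ?_
  rw [Finset.expect_congr rfl fun p _ => sub_mul _ _ _, Finset.expect_sub_distrib, h₃]
  ring

/-- The symmetrized squared-increment functional whose mean is the variance of `F`. -/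
def incr (F : (Fin n → α) → ℝ) (p : (Fin n → α) × (Fin n → α)) : ℝ :=
  (∑ j : Fin n, (F p.1 - F (Function.update p.1 j (p.2 j))) *
    (F (hyb j p.1 p.2) - F (hyb (j + 1) p.1 p.2))) / 2

/-- The variance of `F` under the uniform distribution. -/
def pvar {X : Type*} [Fintype X] (F : X → ℝ) : ℝ := 𝔼 x, (F x - 𝔼 y, F y) ^ 2

theorem pvar_nonneg {X : Type*} [Fintype X] (F : X → ℝ) : 0 ≤ pvar F :=
  Finset.expect_nonneg fun _ _ => sq_nonneg _

theorem expect_sub_expect {X : Type*} [Fintype X] [Nonempty X] {𝕜 : Type*} [RCLike 𝕜]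
    (F : X → 𝕜) : 𝔼 x, (F x - 𝔼 y, F y) = 0 := by
  rw [Finset.expect_sub_distrib, Fintype.expect_const, sub_self]

theorem pvar_eq_expect_incr (F : (Fin n → α) → ℝ) : pvar F = 𝔼 p, incr F p := by
  have h := cov_identity F F
  rw [pvar]
  simp only [incr]
  rw [← h]
  have : ∀ x, (F x - 𝔼 y, F y) ^ 2 =
      F x * (F x - 𝔼 y, F y) - (𝔼 y, F y) * (F x - 𝔼 y, F y) := fun x => by ring
  rw [Finset.expect_congr rfl fun x _ => this x, Finset.expect_sub_distrib,
    ← Finset.mul_expect (a := 𝔼 y, F y), expect_sub_expect, mul_zero, sub_zero]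

theorem expect_hyb_sub_sq (F : (Fin n → α) → ℝ) (j : Fin n) (φ : ℝ → ℝ) :
    𝔼 p : (Fin n → α) × (Fin n → α), φ (F (hyb j p.1 p.2) - F (hyb (j + 1) p.1 p.2)) =
    𝔼 p : (Fin n → α) × (Fin n → α), φ (F p.1 - F (Function.update p.1 j (p.2 j))) := by
  refine Fintype.expect_bijective (hybPair j) (hybPair_involutive j).bijective _ _ ?_
  rintro ⟨x, x'⟩
  simp only [hybPair]
  rw [hyb_succ]
  simp [hyb]

/-- The Efron–Stein inequality. -/
theorem pvar_le_sum (F : (Fin n → α) → ℝ) :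
    pvar F ≤ (∑ j : Fin n, 𝔼 p : (Fin n → α) × (Fin n → α),
      (F p.1 - F (Function.update p.1 j (p.2 j))) ^ 2) / 2 := by
  rw [pvar_eq_expect_incr]
  simp only [incr]
  rw [← Finset.expect_div, Finset.expect_sum_comm]
  refine div_le_div_of_nonneg_right (Finset.sum_le_sum fun j _ => ?_) zero_le_two
  have h := expect_hyb_sub_sq F j (fun t => t ^ 2)
  calc _ ≤ 𝔼 p : (Fin n → α) × (Fin n → α),
      (((F p.1 - F (Function.update p.1 j (p.2 j))) ^ 2) / 2 +
        ((F (hyb j p.1 p.2) - F (hyb (j + 1) p.1 p.2)) ^ 2) / 2) := by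
        refine Finset.expect_le_expect fun p _ => ?_
        nlinarith [sq_nonneg ((F p.1 - F (Function.update p.1 j (p.2 j))) -
          (F (hyb j p.1 p.2) - F (hyb (j + 1) p.1 p.2)))]
    _ = _ := by
        rw [Finset.expect_add_distrib, ← Finset.expect_div, ← Finset.expect_div, h]
        ring

theorem abs_hyb_sub_le {F : (Fin n → α) → ℝ} {c : ℝ}
    (hF : ∀ x j b, |F x - F (Function.update x j b)| ≤ c) (j : Fin n) (x x' : Fin n → α) :
    |F (hyb j x x') - F (hyb (j + 1) x x')| ≤ c := by
  rw [hyb_succ]; exact hF _ _ _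

theorem norm_expect_le {X : Type*} [Fintype X] (F : X → ℂ) :
    ‖𝔼 x, F x‖ ≤ 𝔼 x, ‖F x‖ := by
  rw [Fintype.expect_eq_sum_div_card, Fintype.expect_eq_sum_div_card, norm_div,
    Complex.norm_natCast]
  gcongr
  exact norm_sum_le _ _

theorem ofReal_expect {X : Type*} [Fintype X] (F : X → ℝ) :
    ((𝔼 x, F x : ℝ) : ℂ) = 𝔼 x, (F x : ℂ) := by
  rw [Fintype.expect_eq_sum_div_card, Fintype.expect_eq_sum_div_card]
  push_cast
  rfl

/-- The characteristic function of `F` under the uniform distribution, centred. -/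
def cchar {X : Type*} [Fintype X] (F : X → ℝ) (u : ℝ) : ℂ :=
  𝔼 x, Complex.exp (Complex.I * (u * (F x - 𝔼 y, F y) : ℝ))

theorem norm_exp_I_mul (t : ℝ) : ‖Complex.exp (Complex.I * (t : ℂ))‖ = 1 := by
  rw [mul_comm]; exact Complex.norm_exp_ofReal_mul_I t

theorem hasDerivAt_exp_I_mul (a t : ℝ) :
    HasDerivAt (fun u : ℝ => Complex.exp (Complex.I * (u * a : ℝ)))
      (Complex.I * a * Complex.exp (Complex.I * (t * a : ℝ))) t := by
  have h : HasDerivAt (fun u : ℝ => Complex.I * ((u * a : ℝ) : ℂ)) (Complex.I * (a : ℂ)) t := by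
    refine HasDerivAt.const_mul _ ?_
    have := ((hasDerivAt_id t).mul_const a).ofReal_comp
    simpa using this
  have := h.cexp
  rwa [mul_comm] at this

theorem norm_exp_sub_exp_le (s t : ℝ) :
    ‖Complex.exp (Complex.I * s) - Complex.exp (Complex.I * t)‖ ≤ |s - t| := by
  have h := Real.norm_exp_I_mul_ofReal_sub_one_le (x := s - t)
  have e : Complex.exp (Complex.I * s) - Complex.exp (Complex.I * t) =
      Complex.exp (Complex.I * t) * (Complex.exp (Complex.I * ((s - t : ℝ) : ℂ)) - 1) := by
    rw [mul_sub, ← Complex.exp_add]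
    push_cast
    ring_nf
  rw [e, norm_mul, norm_exp_I_mul, one_mul]
  exact h

theorem norm_one_sub_exp_le (t : ℝ) :
    ‖1 - Complex.exp (Complex.I * (t * (-1) : ℝ)) - Complex.I * t‖ ≤ t ^ 2 := by
  set g : ℝ → ℂ := fun t => 1 - Complex.exp (Complex.I * (t * (-1) : ℝ)) - Complex.I * t with hg
  have hd : ∀ x, HasDerivAt g (-(Complex.I * ((-1 : ℝ) : ℂ) *
      Complex.exp (Complex.I * (x * (-1) : ℝ))) - Complex.I * 1) x := by
    intro x
    have h₁ := (hasDerivAt_exp_I_mul (-1) x).const_sub (1 : ℂ)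
    exact h₁.sub (HasDerivAt.const_mul _ (hasDerivAt_id x).ofReal_comp)
  have h := Convex.norm_image_sub_le_of_norm_hasDerivWithin_le (f := g) (C := |t|)
    (s := Set.Icc (-|t|) |t|) (x := 0) (y := t) (fun x _ => (hd x).hasDerivWithinAt) ?_
    (convex_Icc _ _) (by simp) (by simp [neg_abs_le, le_abs_self])
  · have h0 : g 0 = 0 := by simp [hg]
    rw [h0, sub_zero, sub_zero, Real.norm_eq_abs, ← sq, sq_abs] at h
    exact h
  · intro x hx
    have e : (-(Complex.I * ((-1 : ℝ) : ℂ) * Complex.exp (Complex.I * (x * (-1) : ℝ)))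
        - Complex.I * 1) = Complex.I * (Complex.exp (Complex.I * (x * (-1) : ℝ)) -
          Complex.exp (Complex.I * (0 : ℝ))) := by
      simp; ring
    rw [e, norm_mul, Complex.norm_I, one_mul]
    refine (norm_exp_sub_exp_le _ _).trans ?_
    simpa [abs_le] using hx

theorem norm_cchar_deriv_add_le {F : (Fin n → α) → ℝ} {c : ℝ}
    (hF : ∀ x j b, |F x - F (Function.update x j b)| ≤ c) (u : ℝ) :
    ∃ d, HasDerivAt (cchar F) d u ∧
      ‖d + u * pvar F * cchar F u‖ ≤
        |u| * (𝔼 p, |incr F p - pvar F|) + u ^ 2 * n * c ^ 3 / 2 := by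
  set a := 𝔼 y, F y with ha
  set e : (Fin n → α) → ℂ := fun x => Complex.exp (Complex.I * (u * (F x - a) : ℝ)) with he
  have hc : ∀ x j b, 0 ≤ c := fun x j b => (abs_nonneg _).trans (hF x j b)
  refine ⟨𝔼 x, Complex.I * ((F x - a : ℝ) : ℂ) * e x, ?_, ?_⟩
  · have hfun : cchar F = fun u : ℝ => (∑ x, Complex.exp (Complex.I * (u * (F x - a) : ℝ))) /
        (Fintype.card (Fin n → α) : ℂ) := by
      ext u
      rw [cchar, Fintype.expect_eq_sum_div_card]
    rw [hfun, Fintype.expect_eq_sum_div_card]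
    have := HasDerivAt.fun_sum (u := Finset.univ) (x := u)
      fun (x : Fin n → α) _ => hasDerivAt_exp_I_mul (F x - a) u
    exact this.div_const _
  have h₁ : 𝔼 x, Complex.I * ((F x - a : ℝ) : ℂ) * e x =
      Complex.I * 𝔼 p : (Fin n → α) × (Fin n → α), (∑ j : Fin n,
        (e p.1 - e (Function.update p.1 j (p.2 j))) *
          ((F (hyb j p.1 p.2) : ℂ) - F (hyb (j + 1) p.1 p.2))) / 2 := by
    rw [← cov_identity e (fun x => (F x : ℂ)), Finset.mul_expect]
    refine Finset.expect_congr rfl fun x _ => ?_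
    rw [ha, Complex.ofReal_sub, ofReal_expect]
    ring
  have h₂ : (u : ℂ) * pvar F * cchar F u =
      Complex.I * 𝔼 p : (Fin n → α) × (Fin n → α),
        (-(Complex.I * u * incr F p * e p.1) + Complex.I * u * ((incr F p - pvar F : ℝ) : ℂ) * e p.1) := by
    rw [cchar, ← expect_prod_fst (Y := Fin n → α), Finset.mul_expect, Finset.mul_expect]
    refine Finset.expect_congr rfl fun p _ => ?_
    have : Complex.I * (-(Complex.I * u * incr F p * e p.1) +
        Complex.I * u * ((incr F p - pvar F : ℝ) : ℂ) * e p.1) =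
        (Complex.I * Complex.I) * (u * (-incr F p + ((incr F p - pvar F : ℝ) : ℂ)) * e p.1) := by
      ring
    rw [this, Complex.I_mul_I, Complex.ofReal_sub]
    ring
  rw [h₁, h₂, ← mul_add, norm_mul, Complex.norm_I, one_mul, ← Finset.expect_add_distrib]
  refine (norm_expect_le _).trans ?_
  have hrhs : |u| * (𝔼 p, |incr F p - pvar F|) + u ^ 2 * n * c ^ 3 / 2 =
      𝔼 p : (Fin n → α) × (Fin n → α), (|u| * |incr F p - pvar F| + u ^ 2 * n * c ^ 3 / 2) := by
    rw [Finset.expect_add_distrib, Fintype.expect_const, Finset.mul_expect]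
  rw [hrhs]
  refine Finset.expect_le_expect fun p _ => ?_
  set D : Fin n → ℝ := fun j => F p.1 - F (Function.update p.1 j (p.2 j)) with hD
  set D' : Fin n → ℝ := fun j => F (hyb j p.1 p.2) - F (hyb (j + 1) p.1 p.2) with hD'
  have hsplit : (∑ j : Fin n, (e p.1 - e (Function.update p.1 j (p.2 j))) *
          ((F (hyb j p.1 p.2) : ℂ) - F (hyb (j + 1) p.1 p.2))) / 2 +
        (-(Complex.I * u * incr F p * e p.1) +
          Complex.I * u * ((incr F p - pvar F : ℝ) : ℂ) * e p.1) =
      (∑ j : Fin n, e p.1 * (1 - Complex.exp (Complex.I * ((u * D j) * (-1) : ℝ)) -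
        Complex.I * ((u * D j : ℝ) : ℂ)) * (D' j : ℂ)) / 2 +
        Complex.I * u * ((incr F p - pvar F : ℝ) : ℂ) * e p.1 := by
    rw [← add_assoc]
    congr 1
    have hi : Complex.I * u * incr F p * e p.1 =
        (∑ j : Fin n, e p.1 * (Complex.I * ((u * D j : ℝ) : ℂ)) * (D' j : ℂ)) / 2 := by
      simp only [incr]
      push_cast
      rw [mul_div_assoc', div_mul_eq_mul_div, Finset.mul_sum, Finset.sum_mul]
      congr 1
      refine Finset.sum_congr rfl fun j _ => ?_
      simp only [hD, hD']
      push_cast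
      ring
    rw [hi, ← sub_eq_add_neg, ← sub_div, ← Finset.sum_sub_distrib]
    congr 1
    refine Finset.sum_congr rfl fun j _ => ?_
    have hej : e (Function.update p.1 j (p.2 j)) =
        e p.1 * Complex.exp (Complex.I * ((u * D j) * (-1) : ℝ)) := by
      simp only [he, hD]
      rw [← Complex.exp_add]
      congr 1
      push_cast
      ring
    rw [hej]
    simp only [hD']
    push_cast
    ring
  rw [hsplit]
  have hen : ∀ x, ‖e x‖ = 1 := fun x => norm_exp_I_mul _
  refine (norm_add_le _ _).trans ?_
  rw [add_comm]
  refine add_le_add ?_ ?_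
  · rw [norm_mul, hen, mul_one, norm_mul, norm_mul, Complex.norm_I, one_mul,
      Complex.norm_real, Complex.norm_real, Real.norm_eq_abs, Real.norm_eq_abs]
  · rw [norm_div, Complex.norm_ofNat]
    gcongr
    refine (norm_sum_le _ _).trans ?_
    calc _ ≤ ∑ j : Fin n, u ^ 2 * c ^ 3 := by
          refine Finset.sum_le_sum fun j _ => ?_
          have hc' : 0 ≤ c := hc p.1 j (p.2 j)
          have b₁ : |D j| ≤ c := hF _ _ _
          have b₂ : |D' j| ≤ c := abs_hyb_sub_le hF _ _ _
          rw [norm_mul, norm_mul, hen, one_mul, Complex.norm_real, Real.norm_eq_abs]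
          calc _ ≤ (u * D j) ^ 2 * c := by
                gcongr
                exact norm_one_sub_exp_le _
            _ ≤ u ^ 2 * c ^ 2 * c := by
                rw [mul_pow]
                have : D j ^ 2 ≤ c ^ 2 := sq_le_sq.2 (by rwa [abs_of_nonneg hc'])
                gcongr
            _ = u ^ 2 * c ^ 3 := by ring
      _ = u ^ 2 * n * c ^ 3 := by simp; ring

/-- A quantitative central limit theorem for functions with bounded differences. -/
theorem norm_cchar_sub_le {F : (Fin n → α) → ℝ} {c : ℝ} (hc : 0 ≤ c)
    (hF : ∀ x j b, |F x - F (Function.update x j b)| ≤ c) (u : ℝ) :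
    ‖cchar F u - Real.exp (-(u ^ 2 * pvar F / 2))‖ ≤
      u ^ 2 * (𝔼 p, |incr F p - pvar F|) + |u| ^ 3 * n * c ^ 3 / 2 := by
  set E : ℝ := 𝔼 p, |incr F p - pvar F| with hE
  have hE0 : 0 ≤ E := Finset.expect_nonneg fun _ _ => abs_nonneg _
  choose d hd hdb using norm_cchar_deriv_add_le hF
  set g : ℝ → ℂ := fun t => (Real.exp (t ^ 2 * pvar F / 2) : ℂ) * cchar F t with hg
  have hexp : ∀ t : ℝ, HasDerivAt (fun t : ℝ => ((Real.exp (t ^ 2 * pvar F / 2) : ℝ) : ℂ))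
      ((Real.exp (t ^ 2 * pvar F / 2) * (t * pvar F) : ℝ) : ℂ) t := by
    intro t
    refine HasDerivAt.ofReal_comp (f := fun t => Real.exp (t ^ 2 * pvar F / 2)) (HasDerivAt.exp ?_)
    have := ((hasDerivAt_pow 2 t).mul_const (pvar F)).div_const 2
    refine this.congr_deriv ?_
    simp
    ring
  have hgd : ∀ t, HasDerivAt g ((Real.exp (t ^ 2 * pvar F / 2) : ℂ) *
      (d t + t * pvar F * cchar F t)) t := by
    intro t
    have h := (hexp t).mul (hd t)
    refine h.congr_deriv ?_
    rw [Complex.ofReal_mul, Complex.ofReal_mul]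
    ring
  have hv := pvar_nonneg F
  have h := Convex.norm_image_sub_le_of_norm_hasDerivWithin_le (f := g)
    (C := Real.exp (u ^ 2 * pvar F / 2) * (|u| * E + u ^ 2 * n * c ^ 3 / 2))
    (s := Set.Icc (-|u|) |u|) (x := 0) (y := u) (fun x _ => (hgd x).hasDerivWithinAt) ?_
    (convex_Icc _ _) (by simp) (by simp [neg_abs_le, le_abs_self])
  · have g0 : g 0 = 1 := by simp [hg, cchar]
    have hfac : cchar F u - Real.exp (-(u ^ 2 * pvar F / 2)) =
        (Real.exp (-(u ^ 2 * pvar F / 2)) : ℂ) * (g u - g 0) := by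
      rw [g0, hg, mul_sub, mul_one, ← mul_assoc, ← Complex.ofReal_mul, ← Real.exp_add]
      simp
    rw [hfac, norm_mul, Complex.norm_real, Real.norm_eq_abs, Real.abs_exp]
    calc _ ≤ Real.exp (-(u ^ 2 * pvar F / 2)) * (Real.exp (u ^ 2 * pvar F / 2) *
          (|u| * E + u ^ 2 * n * c ^ 3 / 2) * ‖u - 0‖) := by gcongr
      _ = (|u| * E + u ^ 2 * n * c ^ 3 / 2) * |u| := by
          rw [sub_zero, Real.norm_eq_abs, ← mul_assoc, ← mul_assoc, ← Real.exp_add,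
            neg_add_cancel, Real.exp_zero, one_mul]
      _ = _ := by
          rw [show u ^ 2 = |u| ^ 2 from (sq_abs u).symm]; ring
  · intro t ht
    have hta : |t| ≤ |u| := abs_le.2 ht
    rw [norm_mul, Complex.norm_real, Real.norm_eq_abs, Real.abs_exp]
    refine mul_le_mul ?_ ((hdb t).trans ?_) (norm_nonneg _) (Real.exp_pos _).le
    · have : t ^ 2 ≤ u ^ 2 := sq_le_sq.2 hta
      gcongr
    · have : t ^ 2 ≤ u ^ 2 := sq_le_sq.2 hta
      gcongr

/-- Sub-Gaussian bound for the moment generating function of a function with bounded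
differences. -/
theorem expect_exp_le {n : ℕ} {F : (Fin n → α) → ℝ} {c : ℝ}
    (hF : ∀ x j b, |F x - F (Function.update x j b)| ≤ c) (l : ℝ) :
    𝔼 x, Real.exp (l * (F x - 𝔼 y, F y)) ≤ Real.exp (n * (l ^ 2 * c ^ 2 / 2)) := by
  induction n with
  | zero =>
    have : ∀ x, F x = 𝔼 y, F y := fun x => by
      rw [Finset.expect_congr rfl fun y _ => congrArg F (Subsingleton.elim y x),
        Fintype.expect_const]
    rw [Finset.expect_congr rfl fun x _ => by rw [this x, sub_self, mul_zero, Real.exp_zero]]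
    simp
  | succ n ih =>
    set a := 𝔼 y, F y with ha
    set G : α → ℝ := fun b => 𝔼 y, F (Fin.cons b y) with hG
    have hcons : ∀ Φ : (Fin (n + 1) → α) → ℝ, 𝔼 x, Φ x = 𝔼 b, 𝔼 y, Φ (Fin.cons b y) := by
      intro Φ
      rw [← expect_prod (fun p : α × (Fin n → α) => Φ (Fin.cons p.1 p.2))]
      exact (Fintype.expect_equiv (Fin.consEquiv fun _ => α) _ _ fun _ => rfl).symm
    have haG : a = 𝔼 b, G b := hcons F
    have hb : ∀ b, |G b - a| ≤ c := by
      intro b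
      rw [haG, ← Fintype.expect_const (ι := α) (G b), ← Finset.expect_sub_distrib]
      refine (Finset.abs_expect_le _ _).trans (Finset.expect_le Finset.univ_nonempty fun b' _ => ?_)
      rw [hG, ← Finset.expect_sub_distrib]
      refine (Finset.abs_expect_le _ _).trans (Finset.expect_le Finset.univ_nonempty fun y _ => ?_)
      have := hF (Fin.cons b y) 0 b'
      rwa [Fin.update_cons_zero] at this
    have hin : ∀ b, 𝔼 y, Real.exp (l * (F (Fin.cons b y) - a)) ≤
        Real.exp (n * (l ^ 2 * c ^ 2 / 2)) * Real.exp (l * (G b - a)) := by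
      intro b
      have h := ih (F := fun y => F (Fin.cons b y)) fun x j b' => by
        rw [Fin.cons_update]
        exact hF _ _ _
      calc _ = (𝔼 y, Real.exp (l * (F (Fin.cons b y) - G b))) * Real.exp (l * (G b - a)) := by
            rw [Finset.expect_mul]
            refine Finset.expect_congr rfl fun y _ => ?_
            rw [← Real.exp_add]
            ring_nf
        _ ≤ _ := by gcongr
    have hc : 0 ≤ c := (abs_nonneg _).trans (hb (Classical.arbitrary α))
    have hout : 𝔼 b, Real.exp (l * (G b - a)) ≤ Real.exp (l ^ 2 * c ^ 2 / 2) := by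
      have hz : 𝔼 b, (G b - a) = 0 := by rw [haG, expect_sub_expect]
      refine le_trans ?_ ((Real.cosh_le_exp_half_sq (l * c)).trans_eq (by ring_nf))
      rcases hc.eq_or_lt with hc0 | hc0
      · have : ∀ b, G b - a = 0 := fun b => abs_nonpos_iff.1 (hc0 ▸ hb b)
        simp [this, ← hc0]
      calc _ ≤ 𝔼 b, (Real.cosh (l * c) + (G b - a) * (Real.sinh (l * c) / c)) := by
            refine Finset.expect_le_expect fun b _ => ?_
            obtain ⟨h₁, h₂⟩ := abs_le.1 (hb b)
            have p₁ : 0 ≤ (1 + (G b - a) / c) / 2 := by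
              have : -1 ≤ (G b - a) / c := by rw [le_div_iff₀ hc0]; linarith
              linarith
            have p₂ : 0 ≤ (1 - (G b - a) / c) / 2 := by
              have : (G b - a) / c ≤ 1 := by rw [div_le_iff₀ hc0]; linarith
              linarith
            have hconv := convexOn_exp.2 (Set.mem_univ (l * c)) (Set.mem_univ (-(l * c)))
              p₁ p₂ (by ring)
            simp only [smul_eq_mul] at hconv
            have e₁ : (1 + (G b - a) / c) / 2 * (l * c) + (1 - (G b - a) / c) / 2 * -(l * c) =
                l * (G b - a) := by field_simp; ring
            rw [e₁] at hconv
            refine hconv.trans_eq ?_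
            rw [Real.cosh_eq, Real.sinh_eq]
            field_simp
            ring
        _ = Real.cosh (l * c) := by
            rw [Finset.expect_add_distrib, Fintype.expect_const, ← Finset.expect_mul, hz, zero_mul,
              add_zero]
    rw [hcons]
    calc _ ≤ 𝔼 b, Real.exp (n * (l ^ 2 * c ^ 2 / 2)) * Real.exp (l * (G b - a)) :=
          Finset.expect_le_expect fun b _ => hin b
      _ ≤ Real.exp (n * (l ^ 2 * c ^ 2 / 2)) * Real.exp (l ^ 2 * c ^ 2 / 2) := by
          rw [← Finset.mul_expect]
          gcongr
      _ = _ := by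
          rw [← Real.exp_add]
          push_cast
          ring_nf

/-- The uniform probability of an event. -/
def upr {X : Type*} [Fintype X] (P : X → Prop) : ℝ := 𝔼 x, if P x then (1 : ℝ) else 0

theorem upr_lt_abs_le {F : (Fin n → α) → ℝ} {c : ℝ} (hc : 0 < c) (hn : 0 < n)
    (hF : ∀ x j b, |F x - F (Function.update x j b)| ≤ c) {t : ℝ} (ht : 0 ≤ t) :
    upr (fun x => t ≤ |F x - 𝔼 y, F y|) ≤ 2 * Real.exp (-(t ^ 2 / (2 * n * c ^ 2))) := by
  set a := 𝔼 y, F y with ha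
  set l : ℝ := t / (n * c ^ 2) with hl
  have hn' : (0 : ℝ) < n := by exact_mod_cast hn
  have hl0 : 0 ≤ l := by positivity
  have h₁ := expect_exp_le hF l
  have h₂ := expect_exp_le hF (-l)
  calc upr (fun x => t ≤ |F x - a|)
      ≤ 𝔼 x, (Real.exp (-(l * t)) * Real.exp (l * (F x - a)) +
          Real.exp (-(l * t)) * Real.exp (-l * (F x - a))) := by
        refine Finset.expect_le_expect fun x _ => ?_
        rw [← Real.exp_add, ← Real.exp_add]
        split_ifs with h
        · rcases le_abs.1 h with h | h
          · have : (1 : ℝ) ≤ Real.exp (-(l * t) + l * (F x - a)) :=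
              Real.one_le_exp (by nlinarith)
            have := Real.exp_pos (-(l * t) + -l * (F x - a))
            linarith
          · have : (1 : ℝ) ≤ Real.exp (-(l * t) + -l * (F x - a)) :=
              Real.one_le_exp (by nlinarith)
            have := Real.exp_pos (-(l * t) + l * (F x - a))
            linarith
        · positivity
    _ ≤ Real.exp (-(l * t)) * Real.exp (n * (l ^ 2 * c ^ 2 / 2)) +
          Real.exp (-(l * t)) * Real.exp (n * ((-l) ^ 2 * c ^ 2 / 2)) := by
        rw [Finset.expect_add_distrib, ← Finset.mul_expect, ← Finset.mul_expect]
        gcongr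
    _ = _ := by
        rw [neg_sq, ← Real.exp_add, ← two_mul]
        congr 2
        rw [hl]
        field_simp
        ring

end ProductSpace

end

section

section Locality

variable {V : Type*}

/-- `x` reaches `w` in at most `r` steps. -/
def Back (f : V → V) (r : ℕ) (w x : V) : Prop := ∃ k ≤ r, f^[k] x = w

/-- The value of `ψ` at `w` only depends on the part of `f` leading to `w` in at most `r` steps. -/
def IsLocal (r : ℕ) (ψ : (V → V) → V → ℝ) : Prop :=
  ∀ f f' j w, (∀ x, x ≠ j → f x = f' x) → ¬ Back f r w j → ¬ Back f' r w j → ψ f w = ψ f' w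

theorem Back.mono {f : V → V} {r s : ℕ} {w x : V} (h : Back f r w x) (hrs : r ≤ s) :
    Back f s w x := by
  obtain ⟨k, hk, e⟩ := h
  exact ⟨k, hk.trans hrs, e⟩

theorem Back.apply {f : V → V} {r : ℕ} {w x : V} (h : Back f r w x) :
    Back f (r + 1) (f w) x := by
  obtain ⟨k, hk, rfl⟩ := h
  exact ⟨k + 1, by omega, Function.iterate_succ_apply' f k x⟩

theorem card_filter_back_le [Fintype V] (f : V → V) (r : ℕ) (x : V) :
    (Finset.univ.filter fun w => Back f r w x).card ≤ r + 1 := by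
  have : (Finset.univ.filter fun w => Back f r w x) ⊆
      (Finset.range (r + 1)).image fun k => f^[k] x := by
    intro w hw
    obtain ⟨k, hk, e⟩ := (Finset.mem_filter.1 hw).2
    exact Finset.mem_image.2 ⟨k, Finset.mem_range.2 (by omega), e⟩
  exact (Finset.card_le_card this).trans (Finset.card_image_le.trans (by simp))

theorem Thin.of_eq_off {f f' : V → V} {j : V} (h : ∀ x, x ≠ j → f x = f' x) {m : ℕ} {c : V}
    (hj : ¬ Back f (m + 1) c j) (hj' : ¬ Back f' (m + 1) c j) (ht : Thin f m c) :
    Thin f' m c := by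
  induction m generalizing c with
  | zero =>
    intro x hx
    by_cases hxj : x = j
    · subst hxj; exact hj' ⟨1, by omega, hx⟩
    · exact ht x ((h x hxj).trans hx)
  | succ m ih =>
    have hpre : ∀ x, f x = c ↔ f' x = c := by
      intro x
      by_cases hxj : x = j
      · subst hxj
        exact ⟨fun hx => absurd ⟨1, by omega, hx⟩ hj, fun hx => absurd ⟨1, by omega, hx⟩ hj'⟩
      · rw [h x hxj]
    obtain ⟨d, hd, ht⟩ := ht
    refine ⟨d, fun x => (hpre x).symm.trans (hd x), ih (fun hb => ?_) (fun hb => ?_) ht⟩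
    · have := hb.apply
      rw [(hd d).2 rfl] at this
      exact hj this
    · have := hb.apply
      rw [(hpre d).1 ((hd d).2 rfl)] at this
      exact hj' this

theorem thinChildren_eq_of_eq_off [Fintype V] {f f' : V → V} {j w : V}
    (h : ∀ x, x ≠ j → f x = f' x) {H : ℕ} (hj : ¬ Back f (H + 1) w j)
    (hj' : ¬ Back f' (H + 1) w j) : thinChildren f H w = thinChildren f' H w := by
  suffices key : ∀ f f' : V → V, (∀ x, x ≠ j → f x = f' x) → ¬ Back f (H + 1) w j →
      ¬ Back f' (H + 1) w j → thinChildren f H w ⊆ thinChildren f' H w from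
    (key f f' h hj hj').antisymm (key f' f (fun x hx => (h x hx).symm) hj' hj)
  clear h hj hj' f f'
  intro f f' h hj hj' c hc
  obtain ⟨rfl, m, hm, ht⟩ := mem_thinChildren.1 hc
  have hcj : c ≠ j := by
    rintro rfl
    exact hj ⟨1, by omega, rfl⟩
  refine mem_thinChildren.2 ⟨(h c hcj).symm, m, hm, ht.of_eq_off h (fun hb => ?_) fun hb => ?_⟩
  · exact hj (hb.apply.mono (by omega))
  · have := hb.apply
    rw [← h c hcj] at this
    exact hj' (this.mono (by omega))

/-- `a` and `b` are joined by a chain of at most `k` arcs of the functions `g t`, traversed in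
either direction. -/
def Close {ι : Type*} (g : ι → V → V) : ℕ → V → V → Prop
  | 0, a, b => a = b
  | k + 1, a, b => Close g k a b ∨ ∃ u, Close g k a u ∧ ∃ t, g t u = b ∨ g t b = u

/-- The number of points joined to `u` by an arc of one of the functions `g t`. -/
def arcDegree [Fintype V] {ι : Type*} (g : ι → V → V) (u : V) : ℕ :=
  (Finset.univ.filter fun b => ∃ t, g t u = b ∨ g t b = u).card

namespace Close

variable {ι : Type*} {g : ι → V → V}

theorem refl (k : ℕ) (a : V) : Close g k a a := by
  induction k with
  | zero => rfl
  | succ k ih => exact Or.inl ih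

theorem trans {k l : ℕ} {a b c : V} (h₁ : Close g k a b) (h₂ : Close g l b c) :
    Close g (k + l) a c := by
  induction l generalizing c with
  | zero => obtain rfl : b = c := h₂; exact h₁
  | succ l ih =>
    rcases h₂ with h | ⟨u, hu, ht⟩
    · exact Or.inl (ih h)
    · exact Or.inr ⟨u, ih hu, ht⟩

theorem symm {k : ℕ} {a b : V} (h : Close g k a b) : Close g k b a := by
  induction k generalizing b with
  | zero => exact Eq.symm h
  | succ k ih =>
    rcases h with h | ⟨u, hu, t, ht⟩
    · exact Or.inl (ih h)
    · have h₁ : Close g 1 b u := Or.inr ⟨b, rfl, t, ht.symm⟩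
      have := h₁.trans (ih hu)
      rwa [add_comm] at this

theorem of_back {f : V → V} (hf : ∀ x, ∃ t, f x = g t x) {r : ℕ} {w x : V} (h : Back f r w x) :
    Close g r x w := by
  obtain ⟨k, hk, rfl⟩ := h
  induction r generalizing k with
  | zero => obtain rfl : k = 0 := by omega
            rfl
  | succ r ih =>
    cases k with
    | zero => exact refl _ _
    | succ k =>
      refine Or.inr ⟨f^[k] x, ih k (by omega), ?_⟩
      obtain ⟨t, ht⟩ := hf (f^[k] x)
      exact ⟨t, Or.inl (by rw [Function.iterate_succ_apply', ht])⟩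

theorem card_le [Fintype V] {D : ℕ}
    (hD : ∀ u, arcDegree g u ≤ D) (k : ℕ) (a : V) :
    (Finset.univ.filter fun b => Close g k a b).card ≤ (1 + D) ^ k := by
  induction k with
  | zero =>
    rw [pow_zero]
    refine Finset.card_le_one.2 fun x hx y hy => ?_
    exact ((Finset.mem_filter.1 hx).2).symm.trans (Finset.mem_filter.1 hy).2
  | succ k ih =>
    have hsub : (Finset.univ.filter fun b => Close g (k + 1) a b) ⊆
        (Finset.univ.filter fun b => Close g k a b) ∪
          (Finset.univ.filter fun b => Close g k a b).biUnion fun u =>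
            Finset.univ.filter fun b => ∃ t, g t u = b ∨ g t b = u := by
      intro b hb
      simp only [Finset.mem_filter, Finset.mem_univ, true_and, Finset.mem_union,
        Finset.mem_biUnion] at hb ⊢
      exact hb
    refine (Finset.card_le_card hsub).trans ((Finset.card_union_le _ _).trans ?_)
    have h₂ := Finset.card_biUnion_le_card_mul (Finset.univ.filter fun b => Close g k a b)
      (fun u => Finset.univ.filter fun b => ∃ t, g t u = b ∨ g t b = u) D fun u _ => hD u
    calc _ ≤ (1 + D) ^ k + (1 + D) ^ k * D := add_le_add ih (h₂.trans (Nat.mul_le_mul_right _ ih))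
      _ = (1 + D) ^ (k + 1) := by ring

end Close

/-- Mixed second differences of a sum of local terms vanish at distant coordinates. -/
theorem IsLocal.second_diff_eq_zero [Fintype V] {r : ℕ} {ψ : (V → V) → V → ℝ}
    (hψ : IsLocal r ψ) {ι : Type*} {g : ι → V → V} {f fi fj fij : V → V} {i j : V}
    (hf : ∀ x, ∃ t, f x = g t x) (hfi : ∀ x, ∃ t, fi x = g t x) (hfj : ∀ x, ∃ t, fj x = g t x)
    (hfij : ∀ x, ∃ t, fij x = g t x)
    (h₁ : ∀ x, x ≠ j → f x = fj x) (h₂ : ∀ x, x ≠ j → fi x = fij x)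
    (h₃ : ∀ x, x ≠ i → f x = fi x) (h₄ : ∀ x, x ≠ i → fj x = fij x)
    (hij : ¬ Close g (2 * r) i j) :
    ∑ w, ψ f w - ∑ w, ψ fj w = ∑ w, ψ fi w - ∑ w, ψ fij w := by
  rw [← Finset.sum_sub_distrib, ← Finset.sum_sub_distrib]
  refine Finset.sum_congr rfl fun w _ => ?_
  by_cases hj : Close g r j w
  · have hi : ¬ Close g r i w := fun hi => hij (by
      have := hi.trans hj.symm
      rwa [← two_mul] at this)
    rw [hψ f fi i w h₃ (fun hb => hi (Close.of_back hf hb)) (fun hb => hi (Close.of_back hfi hb)),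
      hψ fj fij i w h₄ (fun hb => hi (Close.of_back hfj hb))
        (fun hb => hi (Close.of_back hfij hb))]
  · rw [hψ f fj j w h₁ (fun hb => hj (Close.of_back hf hb)) (fun hb => hj (Close.of_back hfj hb)),
      hψ fi fij j w h₂ (fun hb => hj (Close.of_back hfi hb))
        (fun hb => hj (Close.of_back hfij hb)), sub_self, sub_self]

end Locality

section Moments

/-- The number of preimages. -/
def indeg {V : Type*} [Fintype V] (f : V → V) (u : V) : ℕ := (Finset.univ.filter fun x => f x = u).card

theorem exists_pow_le_mul_two_pow (R : ℕ) : ∃ C : ℝ, 0 ≤ C ∧ ∀ k : ℕ, ((k : ℝ) + 5) ^ R ≤ C * 2 ^ k := by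
  have h : Tendsto (fun k : ℕ => (k : ℝ) ^ R / 2 ^ k) atTop (𝓝 0) :=
    tendsto_pow_const_div_const_pow_of_one_lt R one_lt_two
  obtain ⟨B, hB⟩ := h.bddAbove_range
  have hB' : ∀ k : ℕ, (k : ℝ) ^ R ≤ B * 2 ^ k := fun k => by
    have := hB ⟨k, rfl⟩
    dsimp only at this
    rwa [div_le_iff₀ (by positivity)] at this
  refine ⟨B * 2 ^ 5, ?_, fun k => ?_⟩
  · have := hB' 1
    norm_num at this
    linarith
  · have := hB' (k + 5)
    push_cast at this
    rw [pow_add] at this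
    linarith

theorem expect_prod_apply {n : ℕ} {V : Type*} [Fintype V] (h : V → ℝ) :
    𝔼 f : Fin n → V, ∏ x, h (f x) = (𝔼 b, h b) ^ n := by
  rw [Fintype.expect_eq_sum_div_card, Fintype.expect_eq_sum_div_card, div_pow]
  congr 1
  · have := Finset.prod_univ_sum (fun _ : Fin n => (Finset.univ : Finset V)) fun _ b => h b
    rw [Fintype.piFinset_univ] at this
    rw [← this]
    simp
  · simp

theorem exists_expect_indeg_pow_le (R : ℕ) : ∃ C : ℝ, 0 ≤ C ∧ ∀ (n : ℕ) [NeZero n] (u : Fin n),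
    𝔼 f : Fin n → Fin n, ((indeg f u : ℝ) + 5) ^ R ≤ C := by
  obtain ⟨C, hC, h⟩ := exists_pow_le_mul_two_pow R
  refine ⟨C * Real.exp 1, by positivity, fun n _ u => ?_⟩
  have hn : (0 : ℝ) < n := by exact_mod_cast NeZero.pos n
  calc _ ≤ 𝔼 f : Fin n → Fin n, C * ∏ x, (if f x = u then (2 : ℝ) else 1) := by
        refine Finset.expect_le_expect fun f _ => (h _).trans_eq ?_
        rw [Finset.prod_ite, Finset.prod_const, Finset.prod_const_one, mul_one, indeg]
        congr!
    _ = C * (1 + 1 / n) ^ n := by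
        rw [← Finset.mul_expect, expect_prod_apply fun b : Fin n => if b = u then (2 : ℝ) else 1]
        congr 2
        have : ∀ b : Fin n, (if b = u then (2 : ℝ) else 1) = 1 + if b = u then 1 else 0 := by
          intro b; split_ifs <;> norm_num
        rw [Finset.expect_congr rfl fun b _ => this b, Finset.expect_add_distrib,
          Fintype.expect_const, Fintype.expect_eq_sum_div_card]
        simp
    _ ≤ _ := by
        gcongr
        have := Real.add_one_le_exp (1 / (n : ℝ))
        calc (1 + 1 / (n : ℝ)) ^ n ≤ (Real.exp (1 / n)) ^ n := by gcongr; linarith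
          _ = Real.exp 1 := by
            rw [← Real.exp_nat_mul]
            congr 1
            field_simp

end Moments

section ClippedIncrement

/-- Truncation to the interval `[-2, 2]`. -/
def clip (t : ℝ) : ℝ := max (-2) (min 2 t)

theorem abs_clip_le (t : ℝ) : |clip t| ≤ 2 := by
  rw [abs_le, clip]
  exact ⟨le_max_left _ _, max_le (by norm_num) (min_le_left _ _)⟩

theorem clip_eq_self {t : ℝ} (h : |t| ≤ 2) : clip t = t := by
  rw [abs_le] at h
  rw [clip, min_eq_right h.2, max_eq_right h.1]

theorem abs_clip_sub_le (s t : ℝ) : |clip s - clip t| ≤ |s - t| := by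
  have h₁ := abs_max_sub_max_le_abs (min 2 s) (min 2 t) (-2)
  have h₂ := abs_min_sub_min_le_max 2 s 2 t
  rw [clip, clip, max_comm (-2), max_comm (-2)]
  refine h₁.trans (h₂.trans ?_)
  simp

variable {n : ℕ} {α : Type*}

/-- The increment functional `incr` with all differences truncated. -/
def clipIncr (F : (Fin n → α) → ℝ) (p : (Fin n → α) × (Fin n → α)) : ℝ :=
  (∑ j : Fin n, clip (F p.1 - F (Function.update p.1 j (p.2 j))) *
    clip (F (hyb j p.1 p.2) - F (hyb (j + 1) p.1 p.2))) / 2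

/-- The four functions underlying a pair of pairs of functions. -/
def quad {V : Type*} (p : (Fin n → V × V) × (Fin n → V × V)) (t : Bool × Bool) (x : Fin n) : V :=
  match t with
  | (false, false) => (p.1 x).1
  | (false, true) => (p.1 x).2
  | (true, false) => (p.2 x).1
  | (true, true) => (p.2 x).2

/-- `clipIncr` as a function of a sequence of pairs. -/
def clipIncrPairs (F : (Fin n → α) → ℝ) (q : Fin n → α × α) : ℝ :=
  clipIncr F (fun x => (q x).1, fun x => (q x).2)

theorem abs_clipIncrPairs_sub_le {r : ℕ} {ψ : (Fin n → Fin n) → Fin n → ℝ} (hψ : IsLocal r ψ)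
    (p : (Fin n → Fin n × Fin n) × (Fin n → Fin n × Fin n)) (i : Fin n) :
    |clipIncrPairs (fun f => ∑ w, ψ f w) p.1 -
      clipIncrPairs (fun f => ∑ w, ψ f w) (Function.update p.1 i (p.2 i))| ≤
      4 * ((Finset.univ.filter fun j => Close (quad p) (2 * r) i j).card : ℝ) := by
  set G : (Fin n → Fin n) → ℝ := fun f => ∑ w, ψ f w with hG
  have hval : ∀ q : Fin n → Fin n × Fin n, (∀ x, q x = p.1 x ∨ q x = p.2 x) →
      ∀ f : Fin n → Fin n, (∀ x, f x = (q x).1 ∨ f x = (q x).2) → ∀ x, ∃ t, f x = quad p t x := by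
    intro q hq f hf x
    rcases hq x with h | h <;> rcases hf x with h' | h' <;> rw [h', h]
    exacts [⟨(false, false), rfl⟩, ⟨(false, true), rfl⟩, ⟨(true, false), rfl⟩, ⟨(true, true), rfl⟩]
  have hq₁ : ∀ x, p.1 x = p.1 x ∨ p.1 x = p.2 x := fun x => Or.inl rfl
  have hq₂ : ∀ x, Function.update p.1 i (p.2 i) x = p.1 x ∨
      Function.update p.1 i (p.2 i) x = p.2 x := fun x => by
    by_cases h : x = i
    · subst h; simp
    · simp [h]
  have hupd : ∀ (q : Fin n → Fin n × Fin n) (j x : Fin n),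
      Function.update (fun x => (q x).1) j ((q j).2) x = (q x).1 ∨
        Function.update (fun x => (q x).1) j ((q j).2) x = (q x).2 := fun q j x => by
    by_cases h : x = j
    · subst h; simp
    · simp [h]
  have hhyb : ∀ (q : Fin n → Fin n × Fin n) (k : ℕ) (x : Fin n),
      hyb k (fun x => (q x).1) (fun x => (q x).2) x = (q x).1 ∨
        hyb k (fun x => (q x).1) (fun x => (q x).2) x = (q x).2 := fun q k x => by
    simp only [hyb]
    split_ifs <;> simp
  set A : (Fin n → Fin n × Fin n) → Fin n → ℝ := fun q j =>
    clip (G (fun x => (q x).1) - G (Function.update (fun x => (q x).1) j ((q j).2))) with hA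
  set B : (Fin n → Fin n × Fin n) → Fin n → ℝ := fun q j =>
    clip (G (hyb j (fun x => (q x).1) fun x => (q x).2) -
      G (hyb (j + 1) (fun x => (q x).1) fun x => (q x).2)) with hB
  have hT : ∀ q, clipIncrPairs G q = (∑ j, A q j * B q j) / 2 := fun q => rfl
  have hm : ∀ q j, |A q j * B q j| ≤ 4 := fun q j => by
    have h₁ : |A q j| ≤ 2 := abs_clip_le _
    have h₂ : |B q j| ≤ 2 := abs_clip_le _
    rw [abs_mul]
    nlinarith [abs_nonneg (A q j)]
  have hterm : ∀ j, |A p.1 j * B p.1 j - A (Function.update p.1 i (p.2 i)) j *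
      B (Function.update p.1 i (p.2 i)) j| ≤
      8 * (if Close (quad p) (2 * r) i j then 1 else 0 : ℝ) := by
    intro j
    split_ifs with hij
    · refine (abs_sub _ _).trans ?_
      linarith [hm p.1 j, hm (Function.update p.1 i (p.2 i)) j]
    · have hji : j ≠ i := by rintro rfl; exact hij (Close.refl _ _)
      have hA' : A p.1 j = A (Function.update p.1 i (p.2 i)) j := by
        refine congrArg clip (hψ.second_diff_eq_zero (hval _ hq₁ _ fun x => Or.inl rfl)
          (hval _ hq₂ _ fun x => Or.inl rfl) (hval _ hq₁ _ (hupd _ _))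
          (hval _ hq₂ _ (hupd _ _)) ?_ ?_ ?_ ?_ hij)
        · intro x hx; simp [hx]
        · intro x hx; simp [hx]
        · intro x hx; simp [hx]
        · intro x hx
          by_cases hxj : x = j
          · subst hxj; simp [hx]
          · simp [hx, hxj]
      have hB' : B p.1 j = B (Function.update p.1 i (p.2 i)) j := by
        refine congrArg clip (hψ.second_diff_eq_zero (hval _ hq₁ _ (hhyb _ _))
          (hval _ hq₂ _ (hhyb _ _)) (hval _ hq₁ _ (hhyb _ _))
          (hval _ hq₂ _ (hhyb _ _)) ?_ ?_ ?_ ?_ hij)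
        · intro x hx
          rw [hyb_succ, Function.update_of_ne hx]
        · intro x hx
          rw [hyb_succ, Function.update_of_ne hx]
        · intro x hx; simp [hyb, hx]
        · intro x hx; simp [hyb, hx]
      rw [hA', hB', sub_self, abs_zero, mul_zero]
  rw [hT, hT, ← sub_div, ← Finset.sum_sub_distrib, abs_div, div_le_iff₀ (by norm_num), abs_two,
    Finset.card_filter]
  push_cast
  refine (Finset.abs_sum_le_sum_abs _ _).trans ((Finset.sum_le_sum fun j _ => hterm j).trans ?_)
  rw [← Finset.mul_sum]
  linarith

theorem card_neighbours_quad_le (p : (Fin n → Fin n × Fin n) × (Fin n → Fin n × Fin n))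
    (u : Fin n) :
    arcDegree (quad p) u ≤ ∑ t, (indeg (quad p t) u + 1) := by
  refine le_trans (Finset.card_le_card (t :=
      (Finset.univ : Finset (Bool × Bool)).biUnion fun t =>
        insert (quad p t u) (Finset.univ.filter fun x => quad p t x = u)) ?_) ?_
  · intro b hb
    simp only [Finset.mem_filter] at hb
    obtain ⟨t, ht⟩ := hb.2
    refine Finset.mem_biUnion.2 ⟨t, Finset.mem_univ _, ?_⟩
    rcases ht with rfl | ht
    · exact Finset.mem_insert_self _ _
    · exact Finset.mem_insert_of_mem (by simpa using ht)
  refine Finset.card_biUnion_le.trans ?_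
  refine Finset.sum_le_sum fun t _ => (Finset.card_insert_le _ _).trans_eq ?_
  rw [indeg]
  congr!

theorem sum_pow_le_card_pow_mul {ι : Type*} (s : Finset ι) (hs : s.Nonempty) {f : ι → ℝ}
    (hf : ∀ i ∈ s, 0 ≤ f i) (R : ℕ) :
    (∑ i ∈ s, f i) ^ R ≤ (s.card : ℝ) ^ R * ∑ i ∈ s, f i ^ R := by
  obtain ⟨a, ha, hmax⟩ := Finset.exists_max_image s f hs
  have h := Finset.sum_le_card_nsmul s f (f a) hmax
  rw [nsmul_eq_mul] at h
  calc (∑ i ∈ s, f i) ^ R ≤ (s.card * f a) ^ R := pow_le_pow_left₀ (Finset.sum_nonneg hf) h R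
    _ = (s.card : ℝ) ^ R * f a ^ R := mul_pow _ _ _
    _ ≤ _ := by
      gcongr
      exact Finset.single_le_sum (f := fun i => f i ^ R) (fun i hi => pow_nonneg (hf i hi) R) ha

theorem card_close_quad_pow_le [NeZero n] (k : ℕ)
    (p : (Fin n → Fin n × Fin n) × (Fin n → Fin n × Fin n)) (i : Fin n) :
    ((Finset.univ.filter fun j => Close (quad p) k i j).card : ℝ) ^ 2 ≤
      (√n + 4 ^ (4 * k) * (∑ t, ∑ u, ((indeg (quad p t) u : ℝ) + 5) ^ (4 * k)) / √n) / 2 := by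
  set deg : Fin n → ℕ := arcDegree (quad p) with hdeg
  obtain ⟨u, -, hu⟩ := Finset.exists_max_image Finset.univ deg Finset.univ_nonempty
  have hN := Close.card_le (g := quad p) (D := deg u) (fun v => hu v (Finset.mem_univ v)) k i
  have hn : (0 : ℝ) < n := by exact_mod_cast NeZero.pos n
  have hsq : (0 : ℝ) < √n := Real.sqrt_pos.2 hn
  set X : ℝ := (1 + deg u : ℝ) ^ (2 * k) with hX
  have h₁ : ((Finset.univ.filter fun j => Close (quad p) k i j).card : ℝ) ^ 2 ≤ X := by
    rw [hX, mul_comm, pow_mul]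
    gcongr
    exact_mod_cast hN
  have h₂ : X ≤ (√n + X ^ 2 / √n) / 2 := by
    rw [le_div_iff₀ two_pos, ← sub_nonneg]
    have : √n + X ^ 2 / √n - X * 2 = (√n - X) ^ 2 / √n := by
      field_simp
      ring
    rw [this]
    positivity
  have h₃ : X ^ 2 ≤ 4 ^ (4 * k) * (∑ t, ∑ u, ((indeg (quad p t) u : ℝ) + 5) ^ (4 * k)) := by
    have hle : (1 + deg u : ℝ) ≤ ∑ t, ((indeg (quad p t) u : ℝ) + 5) := by
      have h := card_neighbours_quad_le p u
      have h' : (deg u : ℝ) ≤ ∑ t, ((indeg (quad p t) u : ℝ) + 1) := by exact_mod_cast h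
      have h'' : ∑ t, ((indeg (quad p t) u : ℝ) + 5) =
          ∑ t, ((indeg (quad p t) u : ℝ) + 1) + 16 := by
        have : ∑ t : Bool × Bool, (4 : ℝ) = 16 := by simp; norm_num
        rw [← this, ← Finset.sum_add_distrib]
        exact Finset.sum_congr rfl fun t _ => by ring
      linarith
    have hc : ((Finset.univ : Finset (Bool × Bool)).card : ℝ) = 4 := by simp
    calc X ^ 2 = (1 + deg u : ℝ) ^ (4 * k) := by rw [hX, ← pow_mul]; congr 1; ring
      _ ≤ (∑ t, ((indeg (quad p t) u : ℝ) + 5)) ^ (4 * k) := by gcongr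
      _ ≤ 4 ^ (4 * k) * ∑ t, ((indeg (quad p t) u : ℝ) + 5) ^ (4 * k) := by
        rw [← hc]
        exact sum_pow_le_card_pow_mul _ Finset.univ_nonempty (fun _ _ => by positivity) _
      _ ≤ _ := by
        gcongr with t
        exact Finset.single_le_sum (f := fun u => ((indeg (quad p t) u : ℝ) + 5) ^ (4 * k))
          (fun _ _ => by positivity) (Finset.mem_univ u)
  refine h₁.trans (h₂.trans ?_)
  gcongr

theorem expect_quad {V : Type*} [Fintype V] [Nonempty V] (h : (Fin n → V) → ℝ)
    (t : Bool × Bool) :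
    𝔼 p : (Fin n → V × V) × (Fin n → V × V), h (quad p t) = 𝔼 f, h f := by
  have e₁ : 𝔼 q : Fin n → V × V, h (fun x => (q x).1) = 𝔼 f, h f := by
    rw [← expect_prod_fst (Y := Fin n → V) h]
    exact Fintype.expect_equiv (Equiv.arrowProdEquivProdArrow (Fin n) (fun _ => V) fun _ => V) _ _
      fun q => rfl
  have e₂ : 𝔼 q : Fin n → V × V, h (fun x => (q x).2) = 𝔼 f, h f := by
    rw [← expect_prod_snd (X := Fin n → V) h]
    exact Fintype.expect_equiv (Equiv.arrowProdEquivProdArrow (Fin n) (fun _ => V) fun _ => V) _ _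
      fun q => rfl
  obtain ⟨_ | _, _ | _⟩ := t
  · exact (expect_prod_fst (fun q : Fin n → V × V => h fun x => (q x).1)).trans e₁
  · exact (expect_prod_fst (fun q : Fin n → V × V => h fun x => (q x).2)).trans e₂
  · exact (expect_prod_snd (fun q : Fin n → V × V => h fun x => (q x).1)).trans e₁
  · exact (expect_prod_snd (fun q : Fin n → V × V => h fun x => (q x).2)).trans e₂

theorem pvar_comp_equiv {X Y : Type*} [Fintype X] [Fintype Y] (e : X ≃ Y) (F : Y → ℝ) :
    pvar (fun x => F (e x)) = pvar F := by
  rw [pvar, pvar, Fintype.expect_equiv e (fun x => F (e x)) F fun _ => rfl]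
  exact Fintype.expect_equiv e _ _ fun _ => rfl

theorem exists_pvar_clipIncr_le (r : ℕ) : ∃ C : ℝ, 0 ≤ C ∧ ∀ (n : ℕ) [NeZero n]
    (ψ : (Fin n → Fin n) → Fin n → ℝ), IsLocal r ψ →
      pvar (clipIncr fun f => ∑ w, ψ f w) ≤ C * (n * √n) := by
  obtain ⟨C, hC, hind⟩ := exists_expect_indeg_pow_le (4 * (2 * r))
  refine ⟨4 * (1 + 4 ^ (4 * (2 * r)) * (4 * C)), by positivity, fun n _ ψ hψ => ?_⟩
  set G : (Fin n → Fin n) → ℝ := fun f => ∑ w, ψ f w with hG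
  have hn : (0 : ℝ) < n := by exact_mod_cast NeZero.pos n
  have hsq : (0 : ℝ) < √n := Real.sqrt_pos.2 hn
  have hE : pvar (clipIncr G) = pvar (clipIncrPairs G) :=
    (pvar_comp_equiv (Equiv.arrowProdEquivProdArrow (Fin n) (fun _ => Fin n) fun _ => Fin n)
      (clipIncr G)).symm
  rw [hE]
  refine (pvar_le_sum _).trans ?_
  have hi : ∀ i : Fin n, 𝔼 p : (Fin n → Fin n × Fin n) × (Fin n → Fin n × Fin n),
      (clipIncrPairs G p.1 - clipIncrPairs G (Function.update p.1 i (p.2 i))) ^ 2 ≤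
        8 * (1 + 4 ^ (4 * (2 * r)) * (4 * C)) * √n := by
    intro i
    calc _ ≤ 𝔼 p : (Fin n → Fin n × Fin n) × (Fin n → Fin n × Fin n),
        8 * (√n + 4 ^ (4 * (2 * r)) *
          (∑ t, ∑ u, ((indeg (quad p t) u : ℝ) + 5) ^ (4 * (2 * r))) / √n) := by
          refine Finset.expect_le_expect fun p _ => ?_
          have h₁ := abs_clipIncrPairs_sub_le hψ p i
          have h₂ := card_close_quad_pow_le (2 * r) p i
          rw [← sq_abs]
          have h₃ := pow_le_pow_left₀ (abs_nonneg _) h₁ 2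
          refine h₃.trans ?_
          rw [mul_pow]
          linarith
      _ = 8 * (√n + 4 ^ (4 * (2 * r)) * (∑ t : Bool × Bool, ∑ u,
            𝔼 f : Fin n → Fin n, ((indeg f u : ℝ) + 5) ^ (4 * (2 * r))) / √n) := by
          rw [← Finset.mul_expect, Finset.expect_add_distrib, Fintype.expect_const,
            ← Finset.expect_div, ← Finset.mul_expect, Finset.expect_sum_comm]
          have : ∀ t : Bool × Bool, 𝔼 p : (Fin n → Fin n × Fin n) × (Fin n → Fin n × Fin n),
              ∑ u, ((indeg (quad p t) u : ℝ) + 5) ^ (4 * (2 * r)) =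
              ∑ u, 𝔼 f : Fin n → Fin n, ((indeg f u : ℝ) + 5) ^ (4 * (2 * r)) := fun t => by
            rw [Finset.expect_sum_comm]
            exact Finset.sum_congr rfl fun u _ =>
              expect_quad (fun f => ((indeg f u : ℝ) + 5) ^ (4 * (2 * r))) t
          rw [Finset.sum_congr rfl fun t _ => this t]
      _ ≤ 8 * (√n + 4 ^ (4 * (2 * r)) * (∑ t : Bool × Bool, ∑ u : Fin n, C) / √n) := by
          gcongr
          exact hind _ _
      _ = _ := by
          have : (n : ℝ) = √n * √n := (Real.mul_self_sqrt hn.le).symm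
          simp only [Finset.sum_const, Finset.card_univ, Fintype.card_prod, Fintype.card_bool,
            Fintype.card_fin, nsmul_eq_mul]
          field_simp
          push_cast
          rw [Real.sq_sqrt hn.le]
          ring
  refine (div_le_div_of_nonneg_right (Finset.sum_le_sum fun i _ => hi i) two_pos.le).trans_eq ?_
  rw [Finset.sum_const, Finset.card_univ, Fintype.card_fin, nsmul_eq_mul]
  ring

end ClippedIncrement

end

section LocalDifferences

theorem expect_prod_pi {n : ℕ} {α : Type*} [Fintype α] (h : Fin n → α → ℝ) :
    𝔼 f : Fin n → α, ∏ x, h x (f x) = ∏ x, 𝔼 b, h x b := by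
  simp_rw [Fintype.expect_eq_sum_div_card]
  rw [Finset.prod_div_distrib]
  congr 1
  · have := Finset.prod_univ_sum (fun _ : Fin n => (Finset.univ : Finset α)) h
    rw [Fintype.piFinset_univ] at this
    rw [← this]
  · simp

theorem expect_marginal {n : ℕ} {α : Type*} [Fintype α] [Nonempty α] (j : Fin n) (φ : α → ℝ) :
    𝔼 f : Fin n → α, φ (f j) = 𝔼 b, φ b := by
  have h := expect_prod_pi fun (x : Fin n) (b : α) => if x = j then φ b else 1
  have h₁ : ∀ f : Fin n → α, ∏ x, (if x = j then φ (f x) else 1) = φ (f j) := fun f => by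
    rw [Finset.prod_ite_eq' Finset.univ j fun x => φ (f x)]
    simp
  have h₂ : ∏ x, 𝔼 b, (if x = j then φ b else 1) = 𝔼 b, φ b := by
    rw [← Finset.prod_erase_mul _ _ (Finset.mem_univ j), Finset.prod_eq_one, one_mul]
    · simp
    · intro x hx
      simp [Finset.ne_of_mem_erase hx]
  rw [← h₂, ← h]
  exact Finset.expect_congr rfl fun f _ => (h₁ f).symm

theorem Back.of_update {V : Type*} {f f' : V → V} {j : V} (h : ∀ x, x ≠ j → f x = f' x) {r : ℕ}
    {w : V} (hb : Back f' r w j) : Back f r w j ∨ Back f r w (f' j) := by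
  obtain ⟨k, hk, e⟩ := hb
  induction k using Nat.strong_induction_on with
  | _ k ih =>
    cases k with
    | zero => exact Or.inl ⟨0, by omega, e⟩
    | succ k =>
      by_cases hx : ∀ i < k, f'^[i] (f' j) ≠ j
      · right
        refine ⟨k, by omega, ?_⟩
        rw [iterate_eq_of_avoid (fun x hx => (h x hx).symm) hx]
        exact e
      · push Not at hx
        obtain ⟨i, hi, hij⟩ := hx
        refine ih (k - i) (by omega) (by omega) ?_
        rw [← e, Function.iterate_succ_apply]
        conv_rhs => rw [show k = (k - i) + i by omega, Function.iterate_add_apply, hij]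

/-- The number of points reaching `w` in at most `r` steps. -/
def backCard {V : Type*} [Fintype V] (f : V → V) (r : ℕ) (w : V) : ℕ :=
  (Finset.univ.filter fun x => Back f r w x).card

theorem sum_expect_abs_local_sub_le {n : ℕ} [NeZero n] {r : ℕ}
    {ψ : (Fin n → Fin n) → Fin n → ℝ} (hψ : IsLocal r ψ) (hnn : ∀ f w, 0 ≤ ψ f w) :
    ∑ j : Fin n, 𝔼 p : (Fin n → Fin n) × (Fin n → Fin n),
      |∑ w, ψ p.1 w - ∑ w, ψ (Function.update p.1 j (p.2 j)) w| ≤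
    6 * 𝔼 f : Fin n → Fin n, ∑ w, ψ f w * backCard f r w := by
  set I : Prop → ℝ := fun P => if P then 1 else 0 with hI
  have hI0 : ∀ P, 0 ≤ I P := fun P => by simp only [hI]; split_ifs <;> norm_num
  have hI1 : ∀ P, P → I P = 1 := fun P h => if_pos h
  set K : (Fin n → Fin n) → (Fin n → Fin n) → Fin n → ℝ := fun f f' j =>
    ∑ w, ψ f w * (I (Back f r w j) + I (Back f' r w j)) with hK
  have hpt : ∀ f f' j, (∀ x, x ≠ j → f x = f' x) →
      |∑ w, ψ f w - ∑ w, ψ f' w| ≤ K f f' j + K f' f j := by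
    intro f f' j h
    rw [← Finset.sum_sub_distrib, hK, ← Finset.sum_add_distrib]
    refine (Finset.abs_sum_le_sum_abs _ _).trans (Finset.sum_le_sum fun w _ => ?_)
    have hle : |ψ f w - ψ f' w| ≤ ψ f w + ψ f' w := by
      rw [abs_le]; constructor <;> linarith [hnn f w, hnn f' w]
    have h₀ := hI0 (Back f r w j)
    have h₀' := hI0 (Back f' r w j)
    have hf := hnn f w
    have hf' := hnn f' w
    by_cases hb : Back f r w j
    · rw [hI1 _ hb]
      nlinarith [mul_nonneg hf h₀', mul_nonneg hf' h₀']
    · by_cases hb' : Back f' r w j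
      · rw [hI1 _ hb']
        nlinarith [mul_nonneg hf h₀, mul_nonneg hf' h₀]
      · rw [hψ f f' j w h hb hb', sub_self, abs_zero]
        positivity
  have hcount : ∀ (f : Fin n → Fin n) w, ∑ j, I (Back f r w j) = backCard f r w := fun f w => by
    simp only [hI, Finset.sum_boole, backCard]
  have hstep : ∀ j, 𝔼 p : (Fin n → Fin n) × (Fin n → Fin n),
      |∑ w, ψ p.1 w - ∑ w, ψ (Function.update p.1 j (p.2 j)) w| ≤
      2 * 𝔼 f : Fin n → Fin n, ∑ w, ψ f w *
        (2 * I (Back f r w j) + (backCard f r w : ℝ) / n) := by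
    intro j
    have hswap : 𝔼 p : (Fin n → Fin n) × (Fin n → Fin n), K (Function.update p.1 j (p.2 j)) p.1 j =
        𝔼 p : (Fin n → Fin n) × (Fin n → Fin n), K p.1 (Function.update p.1 j (p.2 j)) j := by
      refine Fintype.expect_bijective (swapAt j) (swapAt_involutive j).bijective _ _ ?_
      rintro ⟨x, x'⟩
      simp [swapAt]
    calc _ ≤ 𝔼 p : (Fin n → Fin n) × (Fin n → Fin n),
          (K p.1 (Function.update p.1 j (p.2 j)) j + K (Function.update p.1 j (p.2 j)) p.1 j) :=
          Finset.expect_le_expect fun p _ => hpt _ _ j fun x hx => by simp [hx]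
      _ = 2 * 𝔼 p : (Fin n → Fin n) × (Fin n → Fin n), K p.1 (Function.update p.1 j (p.2 j)) j := by
          rw [Finset.expect_add_distrib, hswap, two_mul]
      _ ≤ 2 * 𝔼 p : (Fin n → Fin n) × (Fin n → Fin n), ∑ w, ψ p.1 w *
            (2 * I (Back p.1 r w j) + I (Back p.1 r w (p.2 j))) := by
          refine mul_le_mul_of_nonneg_left (Finset.expect_le_expect fun p _ => ?_) two_pos.le
          refine Finset.sum_le_sum fun w _ => mul_le_mul_of_nonneg_left ?_ (hnn _ _)
          have h₀ := hI0 (Back p.1 r w j)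
          have h₁ := hI0 (Back p.1 r w (p.2 j))
          by_cases hb : Back (Function.update p.1 j (p.2 j)) r w j
          · rw [hI1 _ hb]
            rcases Back.of_update (f := p.1) (fun x hx => by simp [hx]) hb with h | h
            · rw [hI1 _ h]; linarith
            · rw [Function.update_self] at h
              rw [hI1 _ h]; linarith
          · have : I (Back (Function.update p.1 j (p.2 j)) r w j) = 0 := if_neg hb
            rw [this]; linarith
      _ = _ := by
          congr 1
          rw [expect_prod]
          refine Finset.expect_congr rfl fun f _ => ?_
          dsimp only
          rw [Finset.expect_sum_comm]
          refine Finset.sum_congr rfl fun w _ => ?_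
          rw [← Finset.mul_expect, Finset.expect_add_distrib, Fintype.expect_const,
            expect_marginal j fun b => I (Back f r w b), Fintype.expect_eq_sum_div_card, hcount,
            Fintype.card_fin]
  refine (Finset.sum_le_sum fun j _ => hstep j).trans_eq ?_
  rw [← Finset.mul_sum, ← Finset.expect_sum_comm, show (6 : ℝ) = 2 * 3 by norm_num, mul_assoc]
  congr 1
  rw [Finset.mul_expect]
  refine Finset.expect_congr rfl fun f _ => ?_
  rw [Finset.sum_comm, Finset.mul_sum]
  refine Finset.sum_congr rfl fun w _ => ?_
  have hn : (n : ℝ) ≠ 0 := by exact_mod_cast NeZero.ne n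
  rw [← Finset.mul_sum, Finset.sum_add_distrib, ← Finset.mul_sum, hcount, Finset.sum_const,
    Finset.card_univ, Fintype.card_fin, nsmul_eq_mul]
  field_simp
  ring

end LocalDifferences

section

section Chains

variable {V : Type*}

/-- `z` lists the descendants of `z 0`, which form a chain ending in a leaf. -/
structure Chain (f : V → V) {m : ℕ} (z : Fin (m + 1) → V) : Prop where
  apply_succ : ∀ i : Fin m, f (z i.succ) = z i.castSucc
  mem : ∀ x i, f x = z i → ∃ i' : Fin m, x = z i'.succ

theorem Thin.exists_chain {f : V → V} {m : ℕ} {c : V} (h : Thin f m c) :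
    ∃ z : Fin (m + 1) → V, Function.Injective z ∧ z 0 = c ∧ Chain f z ∧ ∀ i, Desc f c (z i) := by
  induction m generalizing c with
  | zero =>
    refine ⟨fun _ => c, fun i j _ => by omega, rfl,
      ⟨fun i => i.elim0, fun x i hx => absurd hx (h x)⟩, fun _ => Desc.refl f c⟩
  | succ m ih =>
    have hcyc := h.not_cyc
    obtain ⟨d, hd, ht⟩ := h
    obtain ⟨z, hz, hz0, hch, hdesc⟩ := ih ht
    have hdc : f d = c := (hd d).2 rfl
    refine ⟨Fin.cons c z, ?_, rfl, ⟨?_, ?_⟩, ?_⟩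
    · rw [Fin.cons_injective_iff]
      refine ⟨?_, hz⟩
      rintro ⟨i, hi⟩
      have := hdesc i
      rw [hi] at this
      obtain ⟨k, hk⟩ := this
      exact hcyc ⟨k, by rw [Function.iterate_succ_apply', hk, hdc]⟩
    · intro i
      refine Fin.cases ?_ (fun i => ?_) i
      · simpa [hz0] using hdc
      · simpa using hch.apply_succ i
    · intro x i
      refine Fin.cases ?_ (fun i => ?_) i
      · intro hx
        exact ⟨0, by simpa [hz0] using (hd x).1 hx⟩
      · intro hx
        obtain ⟨i', hi'⟩ := hch.mem x i hx
        exact ⟨i'.succ, by simpa using hi'⟩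
    · intro i
      refine Fin.cases (Desc.refl f c) (fun i => ?_) i
      have := (Desc.apply f d)
      rw [hdc] at this
      exact this.trans (hdesc i)

namespace Chain

variable {f : V → V} {m : ℕ} {z : Fin (m + 1) → V}

theorem apply_notMem (h : Chain f z) {x : V} (hx : x ∉ Set.range z) : f x ∉ Set.range z := by
  rintro ⟨i, hi⟩
  obtain ⟨i', rfl⟩ := h.mem x i hi.symm
  exact hx ⟨_, rfl⟩

theorem apply_zero_notMem (h : Chain f z) (hz : Function.Injective z) :
    f (z 0) ∉ Set.range z := by
  rintro ⟨i, hi⟩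
  obtain ⟨i', hi'⟩ := h.mem (z 0) i hi.symm
  exact Fin.succ_ne_zero i' (hz hi').symm

/-- The function induced on the complement of a chain, and the image of the top of the chain. -/
def restrict (h : Chain f z) (hz : Function.Injective z) :
    ({x // x ∉ Set.range z} → {x // x ∉ Set.range z}) × {x // x ∉ Set.range z} :=
  (fun x => ⟨f x, h.apply_notMem x.2⟩, ⟨f (z 0), h.apply_zero_notMem hz⟩)

theorem eq_of_restrict_eq {f' : V → V} (h : Chain f z) (h' : Chain f' z)
    (hz : Function.Injective z) (e : h.restrict hz = h'.restrict hz) : f = f' := by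
  funext x
  by_cases hx : x ∈ Set.range z
  · obtain ⟨i, rfl⟩ := hx
    induction i using Fin.cases with
    | zero => exact congrArg Subtype.val (congrArg Prod.snd e)
    | succ i => rw [h.apply_succ, h'.apply_succ]
  · exact congrArg Subtype.val (congrFun (congrArg Prod.fst e) ⟨x, hx⟩)

theorem iterate_restrict (h : Chain f z) (hz : Function.Injective z) (k : ℕ)
    (x : {x // x ∉ Set.range z}) : (((h.restrict hz).1^[k] x : {x // x ∉ Set.range z}) : V) =
      f^[k] x := by
  induction k with
  | zero => rfl
  | succ k ih =>
    rw [Function.iterate_succ_apply', Function.iterate_succ_apply', ← ih]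
    rfl

theorem backCard_le [Fintype V] (h : Chain f z) (hz : Function.Injective z) (r : ℕ) :
    backCard f r (f (z 0)) ≤ (m + 1) + backCard (h.restrict hz).1 r (h.restrict hz).2 := by
  have hsub : (Finset.univ.filter fun x => Back f r (f (z 0)) x) ⊆
      Finset.univ.image z ∪ (Finset.univ.filter fun x =>
        Back (h.restrict hz).1 r (h.restrict hz).2 x).map (Function.Embedding.subtype _) := by
    intro x hx
    by_cases hxz : x ∈ Set.range z
    · obtain ⟨i, rfl⟩ := hxz
      exact Finset.mem_union_left _ (Finset.mem_image_of_mem _ (Finset.mem_univ _))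
    · refine Finset.mem_union_right _ (Finset.mem_map.2 ⟨⟨x, hxz⟩, ?_, rfl⟩)
      obtain ⟨k, hk, e⟩ := (Finset.mem_filter.1 hx).2
      refine Finset.mem_filter.2 ⟨Finset.mem_univ _, k, hk, Subtype.ext ?_⟩
      rw [h.iterate_restrict hz]
      exact e
  refine (Finset.card_le_card hsub).trans ((Finset.card_union_le _ _).trans ?_)
  refine add_le_add (Finset.card_image_le.trans (by simp)) ?_
  rw [Finset.card_map, backCard]

end Chain

theorem sum_backCard_le [Fintype V] (f : V → V) (r : ℕ) :
    ∑ w, backCard f r w ≤ Fintype.card V * (r + 1) := by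
  simp only [backCard, Finset.card_filter]
  rw [Finset.sum_comm]
  calc _ ≤ ∑ x : V, (r + 1) := Finset.sum_le_sum fun x _ => by
        have := card_filter_back_le f r x
        rwa [Finset.card_filter] at this
    _ = _ := by simp

theorem sum_le_sum_of_injective {X Y : Type*} [Fintype X] [Fintype Y] {e : X → Y}
    (he : Function.Injective e) {Φ : Y → ℕ} : ∑ x, Φ (e x) ≤ ∑ y, Φ y := by
  rw [← Finset.sum_image (f := Φ) fun x _ y _ h => he h]
  exact Finset.sum_le_sum_of_subset (Finset.subset_univ _)

theorem sum_chain_backCard_le [Fintype V] {m : ℕ} {z : Fin (m + 1) → V}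
    (hz : Function.Injective z) (r : ℕ) :
    ∑ f ∈ Finset.univ.filter (fun f : V → V => Chain f z), backCard f r (f (z 0)) ≤
      (Fintype.card V - (m + 1)) ^ (Fintype.card V - (m + 1) + 1) * (m + r + 2) := by
  have hcard : Fintype.card {x // x ∉ Set.range z} = Fintype.card V - (m + 1) := by
    have h := Nat.card_range_of_injective hz
    rw [Nat.card_eq_fintype_card, Nat.card_eq_fintype_card, Fintype.card_fin] at h
    rw [Fintype.card_subtype_compl]
    congr 1
  set N := Fintype.card V - (m + 1) with hN
  have e₁ : ∑ f ∈ Finset.univ.filter (fun f : V → V => Chain f z), backCard f r (f (z 0)) =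
      ∑ f : {f : V → V // Chain f z}, backCard f.1 r (f.1 (z 0)) :=
    Finset.sum_subtype (Finset.univ.filter fun f : V → V => Chain f z)
      (by simp) fun f => backCard f r (f (z 0))
  rw [e₁]
  calc _ ≤ ∑ f : {f : V → V // Chain f z},
        ((m + 1) + backCard (f.2.restrict hz).1 r (f.2.restrict hz).2) :=
        Finset.sum_le_sum fun f _ => f.2.backCard_le hz r
    _ ≤ ∑ q : ({x // x ∉ Set.range z} → {x // x ∉ Set.range z}) × {x // x ∉ Set.range z},
        ((m + 1) + backCard q.1 r q.2) :=
        sum_le_sum_of_injective (e := fun f : {f : V → V // Chain f z} => f.2.restrict hz)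
          (Φ := fun q => (m + 1) + backCard q.1 r q.2)
          fun f f' h => Subtype.ext (f.2.eq_of_restrict_eq f'.2 hz h)
    _ ≤ ∑ g : {x // x ∉ Set.range z} → {x // x ∉ Set.range z}, (N * (m + 1) + N * (r + 1)) := by
        rw [Fintype.sum_prod_type]
        refine Finset.sum_le_sum fun g _ => ?_
        dsimp only
        rw [Finset.sum_add_distrib, Finset.sum_const, Finset.card_univ, hcard, smul_eq_mul]
        have := sum_backCard_le g r
        rw [hcard] at this
        omega
    _ = _ := by
        rw [Finset.sum_const, Finset.card_univ, Fintype.card_fun, hcard, smul_eq_mul]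
        ring

theorem sum_thin_backCard_le [Fintype V] (m r : ℕ) :
    ∑ f : V → V, ∑ w, (Finset.univ.filter fun c => f c = w ∧ Thin f m c).card * backCard f r w ≤
      (Fintype.card V).descFactorial (m + 1) *
        ((Fintype.card V - (m + 1)) ^ (Fintype.card V - (m + 1) + 1) * (m + r + 2)) := by
  have hf : ∀ f : V → V, ∑ w, (Finset.univ.filter fun c => f c = w ∧ Thin f m c).card *
      backCard f r w ≤
      ∑ z : Fin (m + 1) ↪ V, if Chain f z then backCard f r (f (z 0)) else 0 := by
    intro f
    calc _ = ∑ w, ∑ c ∈ Finset.univ.filter fun c => Thin f m c,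
          (if f c = w then backCard f r (f c) else 0) := by
          refine Finset.sum_congr rfl fun w _ => ?_
          rw [Finset.card_eq_sum_ones, Finset.sum_mul, ← Finset.sum_filter, Finset.filter_filter]
          refine Finset.sum_congr (Finset.filter_congr fun c _ => and_comm) fun c hc => ?_
          rw [(Finset.mem_filter.1 hc).2.2, one_mul]
      _ = ∑ c ∈ Finset.univ.filter fun c => Thin f m c, backCard f r (f c) := by
          rw [Finset.sum_comm]
          simp
      _ ≤ _ := by
          rw [← Finset.sum_filter]
          have hch : ∀ c ∈ Finset.univ.filter fun c => Thin f m c, ∃ z : Fin (m + 1) ↪ V,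
              z 0 = c ∧ Chain f z := fun c hc => by
            obtain ⟨z, hz, hz0, h, -⟩ := (Finset.mem_filter.1 hc).2.exists_chain
            exact ⟨⟨z, hz⟩, hz0, h⟩
          rcases isEmpty_or_nonempty (Fin (m + 1) ↪ V) with hemp | hne
          · rw [Finset.sum_eq_zero fun c hc => (hemp.false (hch c hc).choose).elim]
            exact Nat.zero_le _
          choose! Z hZ using hch
          have hinj : Set.InjOn Z ↑(Finset.univ.filter fun c => Thin f m c) := by
            intro c hc c' hc' h
            rw [← (hZ c hc).1, h, (hZ c' hc').1]
          calc _ = ∑ z ∈ (Finset.univ.filter fun c => Thin f m c).image Z,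
                backCard f r (f (z 0)) := by
                rw [Finset.sum_image hinj]
                exact Finset.sum_congr rfl fun c hc => by rw [(hZ c hc).1]
            _ ≤ _ := by
                refine Finset.sum_le_sum_of_subset fun z hz => ?_
                obtain ⟨c, hc, rfl⟩ := Finset.mem_image.1 hz
                exact Finset.mem_filter.2 ⟨Finset.mem_univ _, (hZ c hc).2⟩
  refine (Finset.sum_le_sum fun f _ => hf f).trans ?_
  rw [Finset.sum_comm]
  calc _ ≤ ∑ z : Fin (m + 1) ↪ V,
        (Fintype.card V - (m + 1)) ^ (Fintype.card V - (m + 1) + 1) * (m + r + 2) := by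
        refine Finset.sum_le_sum fun z _ => ?_
        rw [← Finset.sum_filter]
        exact sum_chain_backCard_le z.injective r
    _ = _ := by
        rw [Finset.sum_const, Finset.card_univ, Fintype.card_embedding_eq, Fintype.card_fin,
          smul_eq_mul]

end Chains

section Estimate

theorem descFactorial_le_mul_exp (n M : ℕ) (hn : 0 < n) (hM : M ≤ n) :
    (n.descFactorial M : ℝ) ≤ n ^ M * Real.exp (-(M * (M - 1) / (2 * n))) := by
  have hn' : (0 : ℝ) < n := by exact_mod_cast hn
  induction M with
  | zero => simp
  | succ M ih =>
    rw [Nat.descFactorial_succ]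
    push_cast [Nat.cast_sub (show M ≤ n by omega)]
    have h : (n : ℝ) - M ≤ n * Real.exp (-(M / n)) := by
      have := Real.add_one_le_exp (-(M / n : ℝ))
      calc (n : ℝ) - M = n * (-(M / n) + 1) := by field_simp; ring
        _ ≤ _ := by gcongr
    calc ((n : ℝ) - M) * n.descFactorial M
        ≤ (n * Real.exp (-(M / n))) * (n ^ M * Real.exp (-(M * (M - 1) / (2 * n)))) :=
          mul_le_mul h (ih (by omega)) (by positivity) (by positivity)
      _ = n ^ (M + 1) * (Real.exp (-(M / n)) * Real.exp (-(M * (M - 1) / (2 * n)))) := by ring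
      _ = _ := by
          rw [← Real.exp_add]
          congr 2
          field_simp
          ring

theorem descFactorial_mul_pow_le (n M : ℕ) (hn : 2 ≤ n) (hM : M ≤ n) :
    (n.descFactorial M : ℝ) * ((n - M : ℕ) : ℝ) ^ (n - M + 1) ≤
      (n : ℝ) ^ n * n * Real.exp (-(M / 4)) := by
  have hn' : (0 : ℝ) < n := by exact_mod_cast (show 0 < n by omega)
  have hn2 : (2 : ℝ) ≤ n := by exact_mod_cast hn
  have hM' : (M : ℝ) ≤ n := by exact_mod_cast hM
  set N := n - M with hN
  have hNn : (N : ℝ) = n - M := by rw [hN, Nat.cast_sub hM]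
  have h₁ := descFactorial_le_mul_exp n M (by omega) hM
  have h₂ : (N : ℝ) ≤ n * Real.exp (-(M / n)) := by
    have := Real.add_one_le_exp (-(M / n : ℝ))
    calc (N : ℝ) = n * (-(M / n) + 1) := by rw [hNn]; field_simp; ring
      _ ≤ _ := by gcongr
  have h₃ : (N : ℝ) ^ N ≤ n ^ N * Real.exp (-(M * N / n)) := by
    calc (N : ℝ) ^ N ≤ (n * Real.exp (-(M / n))) ^ N := by gcongr
      _ = _ := by
        rw [mul_pow, ← Real.exp_nat_mul]
        congr 2
        ring
  have h₄ : Real.exp (-(M * (M - 1) / (2 * n))) * Real.exp (-(M * N / n)) ≤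
      Real.exp (-(M / 4 : ℝ)) := by
    rw [← Real.exp_add, Real.exp_le_exp, hNn]
    have : -((M : ℝ) * (M - 1) / (2 * n)) + -(M * (n - M) / n) - -(M / 4 : ℝ) =
        -(M * (3 * n - 2 * M - 2)) / (4 * n) := by
      field_simp
      ring
    have h0 : -((M : ℝ) * (3 * n - 2 * M - 2)) / (4 * n) ≤ 0 := by
      refine div_nonpos_of_nonpos_of_nonneg ?_ (by positivity)
      have : 0 ≤ (M : ℝ) * (3 * n - 2 * M - 2) := mul_nonneg (by positivity) (by linarith)
      linarith
    linarith
  calc (n.descFactorial M : ℝ) * (N : ℝ) ^ (N + 1)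
      = n.descFactorial M * (N ^ N) * N := by ring
    _ ≤ (n ^ M * Real.exp (-(M * (M - 1) / (2 * n)))) * (n ^ N * Real.exp (-(M * N / n))) * n := by
        gcongr
        exact Nat.sub_le n M
    _ = (n ^ M * n ^ N) * n *
        (Real.exp (-(M * (M - 1) / (2 * n))) * Real.exp (-(M * N / n))) := by ring
    _ ≤ (n ^ M * n ^ N) * n * Real.exp (-(M / 4)) := by gcongr
    _ = _ := by rw [← pow_add, show M + N = n by omega]

end Estimate

section Tail

/-- The increase of the excess at `w` when chains of length `m + 1` are counted as well. -/
def thinGain {V : Type*} [Fintype V] (m : ℕ) (f : V → V) (w : V) : ℝ :=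
  ((thinChildren f (m + 1) w).card - 1 : ℕ) - ((thinChildren f m w).card - 1 : ℕ)

variable {V : Type*} [Fintype V]

theorem thinChildren_subset_succ (f : V → V) (m : ℕ) (w : V) :
    thinChildren f m w ⊆ thinChildren f (m + 1) w := by
  intro c hc
  obtain ⟨h, k, hk, ht⟩ := mem_thinChildren.1 hc
  exact mem_thinChildren.2 ⟨h, k, by omega, ht⟩

theorem thinGain_nonneg (m : ℕ) (f : V → V) (w : V) : 0 ≤ thinGain m f w := by
  rw [thinGain, sub_nonneg, Nat.cast_le]
  exact Nat.sub_le_sub_right (Finset.card_le_card (thinChildren_subset_succ f m w)) 1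

theorem thinGain_le (m : ℕ) (f : V → V) (w : V) :
    thinGain m f w ≤ (Finset.univ.filter fun c => f c = w ∧ Thin f m c).card := by
  have h : thinChildren f (m + 1) w ⊆
      thinChildren f m w ∪ Finset.univ.filter fun c => f c = w ∧ Thin f m c := by
    intro c hc
    obtain ⟨h, k, hk, ht⟩ := mem_thinChildren.1 hc
    rcases Nat.lt_succ_iff_lt_or_eq.1 hk with hk | rfl
    · exact Finset.mem_union_left _ (mem_thinChildren.2 ⟨h, k, hk, ht⟩)
    · exact Finset.mem_union_right _ (by simp [h, ht])
  have h' := (Finset.card_le_card h).trans (Finset.card_union_le _ _)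
  rw [thinGain, sub_le_iff_le_add, ← Nat.cast_add, Nat.cast_le]
  omega

theorem thinGain_isLocal (m : ℕ) : IsLocal (m + 2) (thinGain (V := V) m) := by
  intro f f' j w h hj hj'
  rw [thinGain, thinGain, thinChildren_eq_of_eq_off h hj hj',
    thinChildren_eq_of_eq_off h (fun hb => hj (hb.mono (by omega)))
      fun hb => hj' (hb.mono (by omega))]

/-- The contribution of `w` to the excess of chains of length at most `h`. -/
def thinTerm (h : ℕ) (f : V → V) (w : V) : ℝ := ((thinChildren f h w).card - 1 : ℕ)

theorem thinTerm_isLocal (h : ℕ) : IsLocal (h + 1) (thinTerm (V := V) h) := by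
  intro f f' j w hf hj hj'
  rw [thinTerm, thinTerm, thinChildren_eq_of_eq_off hf hj hj']

theorem thinTerm_eq_add_sum (f : V → V) (w : V) {h k : ℕ} (hhk : h ≤ k) :
    thinTerm k f w = thinTerm h f w + ∑ m ∈ Finset.Ico h k, thinGain m f w := by
  have := Finset.sum_Ico_sub (fun m => thinTerm m f w) hhk
  simp only [thinGain]
  rw [← sub_eq_iff_eq_add', ← this]
  rfl

theorem validNum_eq_sum_thinTerm (f : V → V) :
    (validNum f : ℝ) = ∑ w, thinTerm (Fintype.card V) f w := by
  rw [validNum_eq_thinExcess, thinExcess]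
  push_cast
  rfl

theorem expect_thinGain_mul_backCard_le {n : ℕ} (hn : 2 ≤ n) {m : ℕ} (hm : m < n) (r : ℕ) :
    𝔼 f : Fin n → Fin n, ∑ w, thinGain m f w * backCard f r w ≤
      n * ((m + r + 2) * Real.exp (-((m + 1) / 4))) := by
  have h : ∑ f : Fin n → Fin n, ∑ w, (Finset.univ.filter fun c => f c = w ∧ Thin f m c).card *
      backCard f r w ≤ n.descFactorial (m + 1) *
        ((n - (m + 1)) ^ (n - (m + 1) + 1) * (m + r + 2)) := by
    convert sum_thin_backCard_le (V := Fin n) m r <;> simp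
  have h' := descFactorial_mul_pow_le n (m + 1) hn hm
  have hn' : (0 : ℝ) < n := by exact_mod_cast (show 0 < n by omega)
  rw [Fintype.expect_eq_sum_div_card, Fintype.card_fun, Fintype.card_fin, div_le_iff₀ (by positivity)]
  calc ∑ f : Fin n → Fin n, ∑ w, thinGain m f w * backCard f r w
      ≤ ∑ f : Fin n → Fin n, ∑ w,
        ((Finset.univ.filter fun c => f c = w ∧ Thin f m c).card : ℝ) * backCard f r w := by
        refine Finset.sum_le_sum fun f _ => Finset.sum_le_sum fun w _ => ?_
        gcongr
        refine (thinGain_le m f w).trans_eq ?_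
        congr!
    _ ≤ n.descFactorial (m + 1) * (((n - (m + 1) : ℕ) : ℝ) ^ (n - (m + 1) + 1) * (m + r + 2)) := by
        exact_mod_cast h
    _ ≤ ((n : ℝ) ^ n * n * Real.exp (-((m + 1 : ℕ) / 4))) * (m + r + 2) := by
        rw [← mul_assoc]
        gcongr
    _ = _ := by push_cast; ring

/-- The tail of the series controlling the influence of long chains. -/
def chainTail (h : ℕ) : ℝ := ∑' k : ℕ, 6 * ((2 * (k + h : ℕ) + 4) * Real.exp (-(((k + h : ℕ) + 1) / 4)))

theorem summable_chainTail :
    Summable fun m : ℕ => 6 * ((2 * (m : ℝ) + 4) * Real.exp (-((m + 1) / 4))) := by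
  have h₁ := Real.summable_pow_mul_exp_neg_nat_mul 1 (r := 1 / 4) (by norm_num)
  have h₀ := Real.summable_pow_mul_exp_neg_nat_mul 0 (r := 1 / 4) (by norm_num)
  refine ((((h₁.mul_left 2).add (h₀.mul_left 4)).mul_right (Real.exp (-(1 / 4)))).mul_left 6).congr
    fun m => ?_
  rw [show -(((m : ℝ) + 1) / 4) = -(1 / 4) * m + -(1 / 4) by ring, Real.exp_add]
  ring

theorem tendsto_chainTail : Tendsto chainTail atTop (𝓝 0) :=
  tendsto_sum_nat_add fun m : ℕ => 6 * ((2 * (m : ℝ) + 4) * Real.exp (-((m + 1) / 4)))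

theorem sum_expect_abs_tail_le {n : ℕ} [NeZero n] (hn : 2 ≤ n) {h : ℕ} (hh : h ≤ n) :
    ∑ j : Fin n, 𝔼 p : (Fin n → Fin n) × (Fin n → Fin n),
      |((validNum p.1 : ℝ) - validNum (Function.update p.1 j (p.2 j))) -
        (∑ w, thinTerm h p.1 w - ∑ w, thinTerm h (Function.update p.1 j (p.2 j)) w)| ≤
      n * chainTail h := by
  have hval : ∀ f : Fin n → Fin n, (validNum f : ℝ) =
      ∑ w, thinTerm h f w + ∑ m ∈ Finset.Ico h n, ∑ w, thinGain m f w := fun f => by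
    rw [validNum_eq_sum_thinTerm, Fintype.card_fin, Finset.sum_comm, ← Finset.sum_add_distrib]
    exact Finset.sum_congr rfl fun w _ => thinTerm_eq_add_sum f w hh
  calc _ ≤ ∑ j : Fin n, 𝔼 p : (Fin n → Fin n) × (Fin n → Fin n), ∑ m ∈ Finset.Ico h n,
        |∑ w, thinGain m p.1 w - ∑ w, thinGain m (Function.update p.1 j (p.2 j)) w| := by
        refine Finset.sum_le_sum fun j _ => Finset.expect_le_expect fun p _ => ?_
        refine le_trans (le_of_eq ?_) (Finset.abs_sum_le_sum_abs _ _)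
        rw [hval p.1, hval (Function.update p.1 j (p.2 j)), Finset.sum_sub_distrib]
        congr 1
        ring
    _ = ∑ m ∈ Finset.Ico h n, ∑ j : Fin n, 𝔼 p : (Fin n → Fin n) × (Fin n → Fin n),
        |∑ w, thinGain m p.1 w - ∑ w, thinGain m (Function.update p.1 j (p.2 j)) w| := by
        rw [Finset.sum_comm]
        exact Finset.sum_congr rfl fun j _ => Finset.expect_sum_comm _ _ _
    _ ≤ ∑ m ∈ Finset.Ico h n, n * (6 * ((2 * (m : ℝ) + 4) * Real.exp (-((m + 1) / 4)))) := by
        refine Finset.sum_le_sum fun m hm => ?_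
        refine (sum_expect_abs_local_sub_le (thinGain_isLocal m) (thinGain_nonneg m)).trans ?_
        have := expect_thinGain_mul_backCard_le hn (Finset.mem_Ico.1 hm).2 (m + 2)
        refine (mul_le_mul_of_nonneg_left this (by norm_num)).trans_eq ?_
        push_cast
        ring
    _ ≤ n * chainTail h := by
        rw [← Finset.mul_sum]
        refine mul_le_mul_of_nonneg_left ?_ (by positivity)
        rw [Finset.sum_Ico_eq_sum_range]
        have := Summable.sum_le_tsum (Finset.range (n - h)) (fun k _ => by positivity)
          ((summable_nat_add_iff h).2 summable_chainTail)
        refine le_trans (le_of_eq ?_) this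
        exact Finset.sum_congr rfl fun k _ => by rw [add_comm h k]

theorem expect_abs_incr_sub_clipIncr_le {n : ℕ} [NeZero n] (hn : 2 ≤ n) {h : ℕ} (hh : h ≤ n) :
    𝔼 p : (Fin n → Fin n) × (Fin n → Fin n), |incr (fun f => (validNum f : ℝ)) p -
      clipIncr (fun f => ∑ w, thinTerm h f w) p| ≤ 2 * (n * chainTail h) := by
  set B : (Fin n → Fin n) → ℝ := fun f => (validNum f : ℝ) with hB
  set G : (Fin n → Fin n) → ℝ := fun f => ∑ w, thinTerm h f w with hG
  have hlip : ∀ x j b, |B x - B (Function.update x j b)| ≤ 2 := fun x j b =>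
    abs_validNum_sub_le (j := j) fun y hy => by simp [hy]
  set H : (Fin n → Fin n) → ℝ := fun f => B f - G f with hH
  have hpt : ∀ p : (Fin n → Fin n) × (Fin n → Fin n), |incr B p - clipIncr G p| ≤
      ∑ j : Fin n, (|H p.1 - H (Function.update p.1 j (p.2 j))| +
        |H (hyb j p.1 p.2) - H (hyb (j + 1) p.1 p.2)|) := by
    intro p
    rw [incr, clipIncr, ← sub_div, ← Finset.sum_sub_distrib, abs_div, abs_two,
      div_le_iff₀ two_pos, Finset.sum_mul]
    refine (Finset.abs_sum_le_sum_abs _ _).trans (Finset.sum_le_sum fun j _ => ?_)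
    have h₁ := hlip p.1 j (p.2 j)
    have h₂ := abs_hyb_sub_le hlip j p.1 p.2
    have h₃ := abs_clip_sub_le (B p.1 - B (Function.update p.1 j (p.2 j)))
      (G p.1 - G (Function.update p.1 j (p.2 j)))
    have h₄ := abs_clip_sub_le (B (hyb j p.1 p.2) - B (hyb (j + 1) p.1 p.2))
      (G (hyb j p.1 p.2) - G (hyb (j + 1) p.1 p.2))
    rw [clip_eq_self h₁] at h₃
    rw [clip_eq_self h₂] at h₄
    have h₅ := abs_clip_le (G p.1 - G (Function.update p.1 j (p.2 j)))
    rw [show (B p.1 - B (Function.update p.1 j (p.2 j)) -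
      (G p.1 - G (Function.update p.1 j (p.2 j)))) = H p.1 - H (Function.update p.1 j (p.2 j)) by
        simp only [hH]; ring] at h₃
    rw [show (B (hyb j p.1 p.2) - B (hyb (j + 1) p.1 p.2) -
      (G (hyb j p.1 p.2) - G (hyb (j + 1) p.1 p.2))) =
        H (hyb j p.1 p.2) - H (hyb (j + 1) p.1 p.2) by simp only [hH]; ring] at h₄
    generalize B p.1 - B (Function.update p.1 j (p.2 j)) = a at *
    generalize clip (G p.1 - G (Function.update p.1 j (p.2 j))) = a' at *
    generalize B (hyb j p.1 p.2) - B (hyb (j + 1) p.1 p.2) = b at *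
    generalize clip (G (hyb j p.1 p.2) - G (hyb (j + 1) p.1 p.2)) = b' at *
    calc |a * b - a' * b'| = |(a - a') * b + a' * (b - b')| := by ring_nf
      _ ≤ |a - a'| * |b| + |a'| * |b - b'| := by
        rw [← abs_mul, ← abs_mul]; exact abs_add_le _ _
      _ ≤ _ := by nlinarith [abs_nonneg (a - a'), abs_nonneg (b - b')]
  refine (Finset.expect_le_expect fun p _ => hpt p).trans ?_
  rw [Finset.expect_sum_comm]
  have hj : ∀ j : Fin n, 𝔼 p : (Fin n → Fin n) × (Fin n → Fin n),
      (|H p.1 - H (Function.update p.1 j (p.2 j))| +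
        |H (hyb j p.1 p.2) - H (hyb (j + 1) p.1 p.2)|) =
      2 * 𝔼 p : (Fin n → Fin n) × (Fin n → Fin n),
        |H p.1 - H (Function.update p.1 j (p.2 j))| := fun j => by
    rw [Finset.expect_add_distrib, expect_hyb_sub_sq H j fun t => |t|, two_mul]
  rw [Finset.sum_congr rfl fun j _ => hj j, ← Finset.mul_sum]
  refine mul_le_mul_of_nonneg_left (le_trans (le_of_eq ?_) (sum_expect_abs_tail_le hn hh)) two_pos.le
  refine Finset.sum_congr rfl fun j _ => Finset.expect_congr rfl fun p _ => ?_
  congr 1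
  simp only [hH, hB, hG]
  ring

theorem expect_abs_sub_expect_le_sqrt {X : Type*} [Fintype X] [Nonempty X] (F : X → ℝ) :
    𝔼 x, |F x - 𝔼 y, F y| ≤ √(pvar F) := by
  refine Real.le_sqrt_of_sq_le ?_
  have h := Finset.expect_mul_sq_le_sq_mul_sq Finset.univ (fun x => |F x - 𝔼 y, F y|) fun _ => 1
  simpa [pvar] using h

theorem eventually_expect_abs_incr_sub_pvar_le {ε : ℝ} (hε : 0 < ε) : ∀ᶠ n : ℕ in atTop,
    ∀ [NeZero n], 𝔼 p : (Fin n → Fin n) × (Fin n → Fin n),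
      |incr (fun f => (validNum f : ℝ)) p - pvar fun f : Fin n → Fin n => (validNum f : ℝ)| ≤
        ε * n := by
  obtain ⟨h, hh⟩ : ∃ h, chainTail h < ε / 8 :=
    (tendsto_chainTail.eventually (gt_mem_nhds (by positivity))).exists
  obtain ⟨C, hC, hvar⟩ := exists_pvar_clipIncr_le (h + 1)
  have hlarge : ∀ᶠ n : ℕ in atTop, C / (ε / 2) ^ 2 ≤ √n :=
    (Real.tendsto_sqrt_atTop.comp tendsto_natCast_atTop_atTop).eventually_ge_atTop _
  filter_upwards [hlarge, eventually_ge_atTop 2, eventually_ge_atTop h] with n h₁ h₂ h₃ _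
  set B : (Fin n → Fin n) → ℝ := fun f => (validNum f : ℝ) with hB
  set G : (Fin n → Fin n) → ℝ := fun f => ∑ w, thinTerm h f w with hG
  have hn : (0 : ℝ) < n := by exact_mod_cast NeZero.pos n
  have hd := expect_abs_incr_sub_clipIncr_le h₂ h₃
  have hv : pvar (clipIncr G) ≤ (ε / 2 * n) ^ 2 := by
    refine (hvar n _ (thinTerm_isLocal h)).trans ?_
    rw [div_le_iff₀ (by positivity)] at h₁
    calc C * (n * √n) ≤ (√n * (ε / 2) ^ 2) * (n * √n) := by gcongr
      _ = (ε / 2) ^ 2 * n * (√n * √n) := by ring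
      _ = _ := by rw [Real.mul_self_sqrt hn.le]; ring
  have hs : 𝔼 p, |clipIncr G p - 𝔼 q, clipIncr G q| ≤ ε / 2 * n :=
    (expect_abs_sub_expect_le_sqrt _).trans (Real.sqrt_le_iff.2 ⟨by positivity, hv⟩)
  have hm : |(𝔼 q, clipIncr G q) - pvar B| ≤ 2 * (n * chainTail h) := by
    rw [pvar_eq_expect_incr, ← Finset.expect_sub_distrib]
    refine (Finset.abs_expect_le _ _).trans ((Finset.expect_le_expect fun p _ => ?_).trans hd)
    rw [abs_sub_comm]
  calc _ ≤ 𝔼 p, (|incr B p - clipIncr G p| + |clipIncr G p - 𝔼 q, clipIncr G q| +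
        |(𝔼 q, clipIncr G q) - pvar B|) := by
        refine Finset.expect_le_expect fun p _ => ?_
        have := abs_add_three (incr B p - clipIncr G p) (clipIncr G p - 𝔼 q, clipIncr G q)
          ((𝔼 q, clipIncr G q) - pvar B)
        refine le_trans (le_of_eq ?_) this
        congr 1
        ring
    _ ≤ 2 * (n * chainTail h) + ε / 2 * n + 2 * (n * chainTail h) := by
        rw [Finset.expect_add_distrib, Finset.expect_add_distrib, Fintype.expect_const]
        linarith
    _ ≤ ε * n := by nlinarith

end Tail

end

section

section Gadget

variable {V : Type*}

/-- The vertices leading to `w` are `x`, `u`, `v`, where `x`, `u` are mapped to `w` and `v` is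
mapped to `t`. -/
structure Gadget (f : V → V) (w x u v t : V) : Prop where
  nodup : [w, x, u, v].Nodup
  hx : f x = w
  hu : f u = w
  hv : f v = t
  other : ∀ y, y ≠ x → y ≠ u → y ≠ v → f y ≠ w ∧ f y ≠ x ∧ f y ≠ u ∧ f y ≠ v

namespace Gadget

variable {f f' : V → V} {w x u v t : V}

theorem update (h : Gadget f w x u v t) (s : V) : Gadget (Function.update f v s) w x u v s := by
  have hn := h.nodup
  simp only [List.nodup_cons, List.mem_cons, not_or, List.not_mem_nil, not_false_eq_true] at hn
  refine ⟨h.nodup, ?_, ?_, by simp, fun y h₁ h₂ h₃ => ?_⟩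
  · rw [Function.update_of_ne hn.2.1.2.1, h.hx]
  · rw [Function.update_of_ne hn.2.2.1.1, h.hu]
  · rw [Function.update_of_ne h₃]
    exact h.other y h₁ h₂ h₃

theorem of_eq_off (h : Gadget f w x u v t) (ht : t = w ∨ t = u) {j : V}
    (hff' : ∀ y, y ≠ j → f y = f' y) (hj : ¬ Back f 3 w j) (hj' : ¬ Back f' 3 w j) :
    Gadget f' w x u v t := by
  have hxj : x ≠ j := by rintro rfl; exact hj ⟨1, by omega, h.hx⟩
  have huj : u ≠ j := by rintro rfl; exact hj ⟨1, by omega, h.hu⟩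
  have hvj : v ≠ j := by
    rintro rfl
    rcases ht with rfl | rfl
    · exact hj ⟨1, by omega, h.hv⟩
    · exact hj ⟨2, by omega, by
        simp only [Function.iterate_succ, Function.comp, Function.iterate_zero, id, h.hv, h.hu]⟩
  have hx := (hff' x hxj).symm.trans h.hx
  have hu := (hff' u huj).symm.trans h.hu
  have hv := (hff' v hvj).symm.trans h.hv
  refine ⟨h.nodup, hx, hu, hv, fun y h₁ h₂ h₃ => ?_⟩
  by_cases hy : y = j
  · subst hy
    have h2 : f' (f' y) ≠ w := fun e => hj' ⟨2, by omega, e⟩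
    have h1 : f' y ≠ w := fun e => hj' ⟨1, by omega, e⟩
    have h3 : f' (f' (f' y)) ≠ w := fun e => hj' ⟨3, le_rfl, e⟩
    refine ⟨h1, fun e => h2 (e ▸ hx), fun e => h2 (e ▸ hu), fun e => ?_⟩
    rcases ht with rfl | rfl
    · exact h2 (e ▸ hv)
    · exact h3 (by rw [e, hv, hu])
  · rw [← hff' y hy]
    exact h.other y h₁ h₂ h₃

theorem mem (h : Gadget f w x u v t) {y : V} (hy : f y = w ∨ f y = x ∨ f y = u ∨ f y = v) :
    y = x ∨ y = u ∨ y = v := by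
  by_contra hc
  push Not at hc
  have := h.other y hc.1 hc.2.1 hc.2.2
  tauto

theorem ne (h : Gadget f w x u v t) : w ≠ x ∧ w ≠ u ∧ w ≠ v ∧ x ≠ u ∧ x ≠ v ∧ u ≠ v := by
  have hn := h.nodup
  simp only [List.nodup_cons, List.mem_cons, not_or, List.not_mem_nil, not_false_eq_true] at hn
  tauto

theorem card_le [Fintype V] (f : V → V) (w : V) (t : V × V × V → V)
    (ht : ∀ p, t p = w ∨ t p = p.2.1) :
    (Finset.univ.filter fun p : V × V × V => Gadget f w p.1 p.2.1 p.2.2 (t p)).card ≤ 27 := by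
  rcases (Finset.univ.filter fun p : V × V × V =>
    Gadget f w p.1 p.2.1 p.2.2 (t p)).eq_empty_or_nonempty with h | ⟨p₀, hp₀⟩
  · simp [h]
  have h₀ := (Finset.mem_filter.1 hp₀).2
  set s : Finset V := {p₀.1, p₀.2.1, p₀.2.2} with hs
  have hs3 : s.card ≤ 3 := Finset.card_le_three
  have hsub : (Finset.univ.filter fun p : V × V × V => Gadget f w p.1 p.2.1 p.2.2 (t p)) ⊆
      s ×ˢ s ×ˢ s := by
    intro p hp
    have h := (Finset.mem_filter.1 hp).2
    have h1 := h₀.mem (Or.inl h.hx)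
    have h2 := h₀.mem (Or.inl h.hu)
    have h3 : p.2.2 = p₀.1 ∨ p.2.2 = p₀.2.1 ∨ p.2.2 = p₀.2.2 := by
      apply h₀.mem
      rw [h.hv]
      rcases ht p with e | e
      · exact Or.inl e
      · rw [e]; exact Or.inr h2
    simp only [hs, Finset.mem_product, Finset.mem_insert, Finset.mem_singleton]
    exact ⟨h1, h2, h3⟩
  refine (Finset.card_le_card hsub).trans ?_
  rw [Finset.card_product, Finset.card_product]
  calc s.card * (s.card * s.card) ≤ 3 * (3 * 3) := by gcongr
    _ = 27 := by norm_num

theorem thin_of_update (h : Gadget f w x u v w) {m : ℕ} {c : V}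
    (hc : Thin (Function.update f v u) m c) (h1 : c ≠ x) (h2 : c ≠ u) (h3 : c ≠ v) :
    Thin f m c := by
  obtain ⟨n1, n2, n3, n4, n5, n6⟩ := h.ne
  have hg := h.update u
  induction m generalizing c with
  | zero =>
    intro y hy
    by_cases hyv : y = v
    · subst hyv
      exact hc x (by rw [hg.hx, ← hy, h.hv])
    · exact hc y (by rw [Function.update_of_ne hyv, hy])
  | succ m ih =>
    obtain ⟨d, hd, hdt⟩ := hc
    have hcw : c ≠ w := by
      rintro rfl
      exact n4 (((hd x).1 hg.hx).trans ((hd u).1 hg.hu).symm)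
    have hdx : d ≠ x := by rintro rfl; exact hcw ((hd d).2 rfl ▸ hg.hx)
    have hdu : d ≠ u := by rintro rfl; exact hcw ((hd d).2 rfl ▸ hg.hu)
    have hdv : d ≠ v := by rintro rfl; exact h2 ((hd d).2 rfl ▸ hg.hv)
    refine ⟨d, fun y => ?_, ih hdt hdx hdu hdv⟩
    by_cases hyv : y = v
    · subst hyv
      simp only [h.hv, hcw.symm, hdv.symm]
    · rw [← hd y, Function.update_of_ne hyv]

theorem validNum_update_lt [Fintype V] (h : Gadget f w x u v w) :
    validNum (Function.update f v u) + 1 ≤ validNum f := by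
  obtain ⟨n1, n2, n3, n4, n5, n6⟩ := h.ne
  have hg := h.update u
  rw [validNum_eq_thinExcess, validNum_eq_thinExcess, thinExcess, thinExcess,
    ← Finset.add_sum_erase _ _ (Finset.mem_univ w), ← Finset.add_sum_erase _ _ (Finset.mem_univ w)]
  have leaf : ∀ c, c = x ∨ c = u ∨ c = v → Thin f 0 c := by
    intro c hc y hy
    by_cases hyx : y = x
    · subst hyx
      rw [h.hx] at hy; subst hy; tauto
    by_cases hyu : y = u
    · subst hyu
      rw [h.hu] at hy; subst hy; tauto
    by_cases hyv : y = v
    · subst hyv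
      rw [h.hv] at hy; subst hy; tauto
    have := h.other y hyx hyu hyv
    rcases hc with rfl | rfl | rfl <;> tauto
  have hw : 3 ≤ (thinChildren f (Fintype.card V) w).card := by
    have h3 : ({x, u, v} : Finset V).card = 3 := Finset.card_eq_three.2 ⟨x, u, v, n4, n5, n6, rfl⟩
    rw [← h3]
    apply Finset.card_le_card
    intro c hc
    simp only [Finset.mem_insert, Finset.mem_singleton] at hc
    refine mem_thinChildren_card.2 ⟨?_, 0, leaf c hc⟩
    rcases hc with rfl | rfl | rfl
    exacts [h.hx, h.hu, h.hv]
  have hw' : (thinChildren (Function.update f v u) (Fintype.card V) w).card ≤ 2 := by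
    rw [← Finset.card_pair n4]
    apply Finset.card_le_card
    intro c hc
    have hcw := (mem_thinChildren_card.1 hc).1
    rcases hg.mem (Or.inl hcw) with rfl | rfl | rfl
    · simp
    · simp
    · rw [hg.hv] at hcw; exact absurd hcw.symm n2
  have hrest : ∑ y ∈ Finset.univ.erase w,
      ((thinChildren (Function.update f v u) (Fintype.card V) y).card - 1) ≤
      ∑ y ∈ Finset.univ.erase w, ((thinChildren f (Fintype.card V) y).card - 1) := by
    refine Finset.sum_le_sum fun y hy => ?_
    have hyw : y ≠ w := Finset.ne_of_mem_erase hy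
    by_cases hyu : y = u
    · subst hyu
      have : (thinChildren (Function.update f v y) (Fintype.card V) y).card ≤ 1 := by
        rw [← Finset.card_singleton v]
        apply Finset.card_le_card
        intro c hc
        have hcw := (mem_thinChildren_card.1 hc).1
        rcases hg.mem (Or.inr (Or.inr (Or.inl hcw))) with rfl | rfl | rfl
        · rw [hg.hx] at hcw; exact absurd hcw n2
        · rw [hg.hu] at hcw; exact absurd hcw n2
        · simp
      omega
    · refine Nat.sub_le_sub_right (Finset.card_le_card fun c hc => ?_) 1
      obtain ⟨hcy, m, hm⟩ := mem_thinChildren_card.1 hc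
      have hcx : c ≠ x := by rintro rfl; exact hyw (hcy.symm.trans hg.hx)
      have hcu : c ≠ u := by rintro rfl; exact hyw (hcy.symm.trans hg.hu)
      have hcv : c ≠ v := by rintro rfl; exact hyu (hcy.symm.trans hg.hv)
      refine mem_thinChildren_card.2 ⟨?_, m, h.thin_of_update hm hcx hcu hcv⟩
      rw [← hcy, Function.update_of_ne hcv]
  omega

/-- The transformation exchanging the two kinds of gadgets. -/
def toggle (w u v : V) (f : V → V) : V → V := Function.update f v (Equiv.swap w u (f v))

theorem toggle_toggle (w u v : V) (f : V → V) : toggle w u v (toggle w u v f) = f := by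
  simp [toggle]

theorem toggle_eq (h : Gadget f w x u v w) : toggle w u v f = Function.update f v u := by
  rw [toggle, h.hv, Equiv.swap_apply_left]

theorem toggle_iff (f : V → V) (w x u v : V) :
    Gadget (toggle w u v f) w x u v u ↔ Gadget f w x u v w := by
  constructor
  · intro h
    have hv := h.hv
    have := h.update w
    rw [toggle, Function.update_self, Equiv.swap_apply_eq_iff, Equiv.swap_apply_right] at hv
    have e : Function.update (toggle w u v f) v w = f := by
      rw [toggle, Function.update_idem, ← hv, Function.update_eq_self]
    rwa [e] at this
  · intro h
    rw [h.toggle_eq]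
    exact h.update u

end Gadget

end Gadget

end

section

theorem IsLocal.abs_sum_sub_le {V : Type*} [Fintype V] {r : ℕ} {ψ : (V → V) → V → ℝ}
    (hψ : IsLocal r ψ) {K : ℝ} (hK : ∀ f w, |ψ f w| ≤ K) {f f' : V → V} {j : V}
    (h : ∀ y, y ≠ j → f y = f' y) :
    |∑ w, ψ f w - ∑ w, ψ f' w| ≤ 4 * K * (r + 1) := by
  have hK0 : 0 ≤ K := (abs_nonneg _).trans (hK f j)
  rw [← Finset.sum_sub_distrib]
  set s : Finset V := (Finset.univ.filter fun w => Back f r w j) ∪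
    (Finset.univ.filter fun w => Back f' r w j) with hs
  have hcard : (s.card : ℝ) ≤ 2 * (r + 1) := by
    have := (Finset.card_union_le (Finset.univ.filter fun w => Back f r w j)
      (Finset.univ.filter fun w => Back f' r w j)).trans
      (Nat.add_le_add (card_filter_back_le f r j) (card_filter_back_le f' r j))
    have h2 : (s.card : ℝ) ≤ ((r + 1 + (r + 1) : ℕ) : ℝ) := by exact_mod_cast this
    push_cast at h2
    linarith
  rw [← Finset.sum_subset (Finset.subset_univ s)]
  · refine (Finset.abs_sum_le_sum_abs _ _).trans ((Finset.sum_le_card_nsmul _ _ (2 * K) ?_).trans ?_)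
    · intro w _
      have := abs_sub (ψ f w) (ψ f' w)
      linarith [hK f w, hK f' w]
    · rw [nsmul_eq_mul]
      nlinarith
  · intro w _ hw
    simp only [hs, Finset.mem_union, Finset.mem_filter, Finset.mem_univ, true_and, not_or] at hw
    rw [hψ f f' j w h hw.1 hw.2, sub_self]

theorem pvar_le_of_abs_sub_le {n : ℕ} {α : Type*} [Fintype α] [Nonempty α]
    {F : (Fin n → α) → ℝ} {c : ℝ}
    (h : ∀ x j a, |F x - F (Function.update x j a)| ≤ c) : pvar F ≤ n * c ^ 2 / 2 := by
  refine (pvar_le_sum F).trans (div_le_div_of_nonneg_right ?_ zero_le_two)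
  calc _ ≤ ∑ j : Fin n, c ^ 2 := by
        refine Finset.sum_le_sum fun j _ => ?_
        refine Finset.expect_le Finset.univ_nonempty fun p _ => ?_
        have hp := abs_le.1 (h p.1 j (p.2 j))
        exact sq_le_sq' hp.1 hp.2
    _ = n * c ^ 2 := by simp

section Balance

variable {V : Type*} [Fintype V]

/-- The indicator of a gadget. -/
def gadgetInd (f : V → V) (w x u v t : V) : ℝ := if Gadget f w x u v t then 1 else 0

/-- The number of gadgets at `w` of the first kind minus that of the second kind. -/
def gadgetDiff (f : V → V) (w : V) : ℝ :=
  ∑ p : V × V × V, (gadgetInd f w p.1 p.2.1 p.2.2 w - gadgetInd f w p.1 p.2.1 p.2.2 p.2.1)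

theorem isLocal_gadgetDiff : IsLocal 3 (gadgetDiff : (V → V) → V → ℝ) := by
  intro f f' j w h hj hj'
  have key : ∀ x u v t, t = w ∨ t = u → (Gadget f w x u v t ↔ Gadget f' w x u v t) :=
    fun x u v t ht => ⟨fun hg => hg.of_eq_off ht h hj hj',
      fun hg => hg.of_eq_off ht (fun y hy => (h y hy).symm) hj' hj⟩
  refine Finset.sum_congr rfl fun p _ => ?_
  simp only [gadgetInd, key _ _ _ _ (Or.inl rfl), key _ _ _ _ (Or.inr rfl)]

theorem abs_gadgetDiff_le (f : V → V) (w : V) : |gadgetDiff f w| ≤ 54 := by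
  have key : ∀ t : V × V × V → V, (∀ p, t p = w ∨ t p = p.2.1) →
      0 ≤ ∑ p : V × V × V, gadgetInd f w p.1 p.2.1 p.2.2 (t p) ∧
      ∑ p : V × V × V, gadgetInd f w p.1 p.2.1 p.2.2 (t p) ≤ 27 := by
    intro t ht
    constructor
    · refine Finset.sum_nonneg fun p _ => ?_
      rw [gadgetInd]; split_ifs <;> norm_num
    · simp only [gadgetInd, Finset.sum_boole]
      exact_mod_cast Gadget.card_le f w t ht
  rw [gadgetDiff, Finset.sum_sub_distrib]
  have h1 := key (fun _ => w) fun _ => Or.inl rfl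
  have h2 := key (fun p => p.2.1) fun _ => Or.inr rfl
  rw [abs_le]
  constructor <;> linarith

theorem sum_expect_mul_gadgetInd [DecidableEq V] (B : (V → V) → ℝ) (w : V) (p : V × V × V) :
    𝔼 f : V → V, B f * gadgetInd f w p.1 p.2.1 p.2.2 p.2.1 =
      𝔼 f : V → V, B (Function.update f p.2.2 p.2.1) * gadgetInd f w p.1 p.2.1 p.2.2 w := by
  have hinv : Function.Involutive (Gadget.toggle w p.2.1 p.2.2) :=
    Gadget.toggle_toggle w p.2.1 p.2.2
  rw [← Fintype.expect_equiv hinv.toPerm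
    (fun f => B (Gadget.toggle w p.2.1 p.2.2 f) * gadgetInd f w p.1 p.2.1 p.2.2 w) _ ?_]
  · refine Finset.expect_congr rfl fun f _ => ?_
    rw [gadgetInd]
    split_ifs with h
    · rw [h.toggle_eq]
      congr!
    · simp
  · intro f
    simp only [gadgetInd, Function.Involutive.coe_toPerm, Gadget.toggle_iff]

theorem expect_sum_gadgetDiff_mul [DecidableEq V] (B : (V → V) → ℝ) :
    𝔼 f : V → V, B f * ∑ w, gadgetDiff f w =
      ∑ w, ∑ p : V × V × V, 𝔼 f : V → V,
        (B f - B (Function.update f p.2.2 p.2.1)) * gadgetInd f w p.1 p.2.1 p.2.2 w := by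
  simp only [gadgetDiff, Finset.mul_sum]
  rw [Finset.expect_sum_comm]
  refine Finset.sum_congr rfl fun w _ => ?_
  rw [Finset.expect_sum_comm]
  refine Finset.sum_congr rfl fun p _ => ?_
  simp only [mul_sub, sub_mul, Finset.expect_sub_distrib]
  rw [sum_expect_mul_gadgetInd]

end Balance

theorem expect_gadgetInd {n : ℕ} (hn : 4 ≤ n) {w x u v : Fin n} (h : [w, x, u, v].Nodup) :
    (1 / n : ℝ) ^ 3 * (1 - 4 / n) ^ n ≤ 𝔼 f : Fin n → Fin n, gadgetInd f w x u v w := by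
  have hn0 : (4 : ℝ) ≤ n := by exact_mod_cast hn
  have hnp : (0 : ℝ) < n := by linarith
  set H : Fin n → Fin n → ℝ := fun y b =>
    if y = x ∨ y = u ∨ y = v then (if b = w then 1 else 0)
    else if b ≠ w ∧ b ≠ x ∧ b ≠ u ∧ b ≠ v then 1 else 0 with hH
  have hprod : ∀ f : Fin n → Fin n, gadgetInd f w x u v w = ∏ y, H y (f y) := by
    intro f
    rw [gadgetInd]
    split_ifs with hg
    · rw [Finset.prod_eq_one]
      intro y _
      simp only [hH]
      split_ifs with h1 h2 h3
      · rfl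
      · rcases h1 with rfl | rfl | rfl
        exacts [absurd hg.hx h2, absurd hg.hu h2, absurd hg.hv h2]
      · rfl
      · push Not at h1
        exact absurd (hg.other y h1.1 h1.2.1 h1.2.2) h3
    · by_contra hne
      have hz : ∀ y, H y (f y) ≠ 0 := fun y hy =>
        hne (Finset.prod_eq_zero (Finset.mem_univ y) hy).symm
      apply hg
      have h1 : ∀ y, y = x ∨ y = u ∨ y = v → f y = w := by
        intro y hy
        by_contra hc
        exact hz y (by simp only [hH]; rw [if_pos hy, if_neg hc])
      refine ⟨h, h1 x (by tauto), h1 u (by tauto), h1 v (by tauto), fun y a b c => ?_⟩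
      by_contra hc
      exact hz y (by simp only [hH]; rw [if_neg (by tauto), if_neg hc])
  simp_rw [hprod]
  rw [expect_prod_pi]
  have e1 : ∀ y, y = x ∨ y = u ∨ y = v → 𝔼 b, H y b = 1 / n := by
    intro y hy
    simp only [hH, if_pos hy, Fintype.expect_eq_sum_div_card, Finset.sum_ite_eq', Finset.mem_univ,
      if_true, Fintype.card_fin]
  have e2 : ∀ y, ¬ (y = x ∨ y = u ∨ y = v) → 𝔼 b, H y b = 1 - 4 / n := by
    intro y hy
    simp only [hH, if_neg hy, Fintype.expect_eq_sum_div_card, Fintype.card_fin, Finset.sum_boole]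
    have : (Finset.univ.filter fun b => b ≠ w ∧ b ≠ x ∧ b ≠ u ∧ b ≠ v) =
        ([w, x, u, v].toFinset)ᶜ := by
      ext b; simp
    rw [this, Finset.card_compl, List.toFinset_card_of_nodup h, Fintype.card_fin]
    simp only [List.length_cons, List.length_nil]
    rw [Nat.cast_sub (by omega)]
    field_simp
    push_cast
    ring
  have hs3 : (Finset.univ.filter fun y => y = x ∨ y = u ∨ y = v).card = 3 := by
    have h3 : [x, u, v].Nodup := (List.nodup_cons.1 h).2
    rw [show (Finset.univ.filter fun y => y = x ∨ y = u ∨ y = v) = [x, u, v].toFinset by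
      ext b; simp, List.toFinset_card_of_nodup h3]
    rfl
  rw [← Finset.prod_filter_mul_prod_filter_not Finset.univ fun y => y = x ∨ y = u ∨ y = v]
  rw [Finset.prod_congr rfl fun y hy => e1 y (Finset.mem_filter.1 hy).2,
    Finset.prod_congr rfl fun y hy => e2 y (Finset.mem_filter.1 hy).2,
    Finset.prod_const, Finset.prod_const, hs3]
  have h4 : (4 : ℝ) / n ≤ 1 := (div_le_one hnp).2 hn0
  refine mul_le_mul_of_nonneg_left (pow_le_pow_of_le_one (by linarith) ?_ ?_) (by positivity)
  · have : (0 : ℝ) ≤ 4 / n := by positivity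
    linarith
  · exact (Finset.card_le_univ _).trans (by simp)

theorem le_card_filter_nodup {n : ℕ} (hn : 3 ≤ n) (w : Fin n) :
    ((n : ℝ) - 3) ^ 3 ≤ ((Finset.univ.filter fun p : Fin n × Fin n × Fin n =>
      [w, p.1, p.2.1, p.2.2].Nodup).card : ℝ) := by
  have key : ∀ s : Finset (Fin n), s.card ≤ 3 → n - 3 ≤ sᶜ.card := by
    intro s hs
    rw [Finset.card_compl, Fintype.card_fin]
    omega
  have hsub : ((({w} : Finset (Fin n))ᶜ.sigma fun x => ({w, x} : Finset (Fin n))ᶜ).sigma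
      fun q => ({w, q.1, q.2} : Finset (Fin n))ᶜ).card ≤
      (Finset.univ.filter fun p : Fin n × Fin n × Fin n => [w, p.1, p.2.1, p.2.2].Nodup).card := by
    refine Finset.card_le_card_of_injOn (fun q => (q.1.1, q.1.2, q.2)) ?_ ?_
    · intro q hq
      simp only [Finset.coe_sigma, Set.mem_sigma_iff, Finset.mem_coe, Finset.mem_insert,
        Finset.mem_singleton, Finset.coe_compl, Set.mem_compl_iff, not_or] at hq
      simp only [Finset.coe_filter, Finset.mem_univ, true_and, Set.mem_ofPred_eq, List.nodup_cons,
        List.mem_cons, not_or, List.not_mem_nil, not_false_eq_true, List.nodup_nil, and_true]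
      tauto
    · rintro ⟨⟨a, b⟩, c⟩ _ ⟨⟨a', b'⟩, c'⟩ _ e
      simp only [Prod.mk.injEq] at e
      obtain ⟨rfl, rfl, rfl⟩ := e
      rfl
  have h3 : (n - 3) ^ 3 ≤ ((({w} : Finset (Fin n))ᶜ.sigma fun x => ({w, x} : Finset (Fin n))ᶜ).sigma
      fun q => ({w, q.1, q.2} : Finset (Fin n))ᶜ).card := by
    rw [Finset.card_sigma]
    have a1 : (n - 3) * (n - 3) ≤
        (({w} : Finset (Fin n))ᶜ.sigma fun x => ({w, x} : Finset (Fin n))ᶜ).card := by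
      rw [Finset.card_sigma]
      calc (n - 3) * (n - 3) ≤ ({w} : Finset (Fin n))ᶜ.card * (n - 3) :=
            Nat.mul_le_mul_right _ (key _ (by simp))
        _ = ∑ x ∈ ({w} : Finset (Fin n))ᶜ, (n - 3) := by simp
        _ ≤ _ := Finset.sum_le_sum fun x _ => key _ (Finset.card_le_two.trans (by omega))
    calc (n - 3) ^ 3 = ((n - 3) * (n - 3)) * (n - 3) := by ring
      _ ≤ _ := Nat.mul_le_mul_right _ a1
      _ = ∑ x ∈ (({w} : Finset (Fin n))ᶜ.sigma fun x => ({w, x} : Finset (Fin n))ᶜ), (n - 3) := by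
        simp
      _ ≤ _ := Finset.sum_le_sum fun x _ => key _ Finset.card_le_three
  have := h3.trans hsub
  have h4 : (((n - 3) ^ 3 : ℕ) : ℝ) ≤ _ := Nat.cast_le.2 this
  rwa [Nat.cast_pow, Nat.cast_sub hn, Nat.cast_ofNat] at h4

theorem le_expect_validNum_mul {n : ℕ} (hn : 4 ≤ n) :
    (n : ℝ) * ((1 - 3 / n) ^ 3 * (1 - 4 / n) ^ n) ≤
      𝔼 f : Fin n → Fin n, (validNum f : ℝ) * ∑ w, gadgetDiff f w := by
  have hn0 : (4 : ℝ) ≤ n := by exact_mod_cast hn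
  have hnp : (0 : ℝ) < n := by linarith
  have h4 : (0 : ℝ) ≤ 1 - 4 / n := sub_nonneg.2 ((div_le_one hnp).2 hn0)
  rw [expect_sum_gadgetDiff_mul]
  set a : ℝ := (1 / n : ℝ) ^ 3 * (1 - 4 / n) ^ n with ha
  have ha0 : 0 ≤ a := by positivity
  have key : ∀ w : Fin n, (1 - 3 / n : ℝ) ^ 3 * (1 - 4 / n) ^ n ≤
      ∑ p : Fin n × Fin n × Fin n, 𝔼 f : Fin n → Fin n,
        ((validNum f : ℝ) - validNum (Function.update f p.2.2 p.2.1)) *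
          gadgetInd f w p.1 p.2.1 p.2.2 w := by
    intro w
    calc (1 - 3 / n : ℝ) ^ 3 * (1 - 4 / n) ^ n = ((n : ℝ) - 3) ^ 3 * a := by
          rw [ha]; field_simp
      _ ≤ ((Finset.univ.filter fun p : Fin n × Fin n × Fin n =>
          [w, p.1, p.2.1, p.2.2].Nodup).card : ℝ) * a :=
        mul_le_mul_of_nonneg_right (le_card_filter_nodup (by omega) w) ha0
      _ = ∑ p : Fin n × Fin n × Fin n, if [w, p.1, p.2.1, p.2.2].Nodup then a else 0 := by
        rw [← Finset.sum_filter, Finset.sum_const, nsmul_eq_mul]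
      _ ≤ _ := by
        refine Finset.sum_le_sum fun p _ => ?_
        have hpt : 𝔼 f : Fin n → Fin n, gadgetInd f w p.1 p.2.1 p.2.2 w ≤
            𝔼 f : Fin n → Fin n,
              ((validNum f : ℝ) - validNum (Function.update f p.2.2 p.2.1)) *
                gadgetInd f w p.1 p.2.1 p.2.2 w := by
          refine Finset.expect_le_expect fun f _ => ?_
          rw [gadgetInd]
          split_ifs with hg
          · have := hg.validNum_update_lt
            have h2 : ((validNum (Function.update f p.2.2 p.2.1) + 1 : ℕ) : ℝ) ≤ validNum f := by
              refine Nat.cast_le.2 ?_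
              convert this
            push_cast at h2
            linarith
          · simp
        refine le_trans ?_ hpt
        split_ifs with hnd
        · exact expect_gadgetInd hn hnd
        · refine Finset.expect_nonneg fun f _ => ?_
          rw [gadgetInd]; split_ifs <;> norm_num
  calc (n : ℝ) * ((1 - 3 / n) ^ 3 * (1 - 4 / n) ^ n)
      = ∑ w : Fin n, (1 - 3 / n : ℝ) ^ 3 * (1 - 4 / n) ^ n := by simp
    _ ≤ _ := Finset.sum_le_sum fun w _ => key w

theorem exists_le_pvar_validNum : ∃ c : ℝ, 0 < c ∧ ∀ᶠ n : ℕ in atTop,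
    c * n ≤ pvar fun f : Fin n → Fin n => (validNum f : ℝ) := by
  have hlim : Tendsto (fun n : ℕ => (1 - 3 / n : ℝ) ^ 3 * (1 - 4 / n) ^ n) atTop
      (𝓝 ((1 - 0) ^ 3 * Real.exp (-4))) := by
    refine (((tendsto_const_div_atTop_nhds_zero_nat (3 : ℝ)).const_sub 1).pow 3).mul ?_
    refine (Real.tendsto_one_add_div_pow_exp (-4)).congr fun n => ?_
    rw [neg_div, sub_eq_add_neg]
  set q : ℝ := Real.exp (-4) / 2 with hq
  have hq0 : 0 < q := by positivity
  have hqlt : q < (1 - 0) ^ 3 * Real.exp (-4) := by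
    rw [hq]; have := Real.exp_pos (-4); linarith
  set K : ℝ := (4 * 54 * (3 + 1)) ^ 2 / 2 with hK
  have hK0 : 0 < K := by rw [hK]; norm_num
  refine ⟨q ^ 2 / K, by positivity, ?_⟩
  filter_upwards [hlim.eventually (lt_mem_nhds hqlt), eventually_ge_atTop 4] with n hqn hn
  have hnp : (0 : ℝ) < n := by exact_mod_cast (by omega : 0 < n)
  have : NeZero n := ⟨by omega⟩
  set Z : (Fin n → Fin n) → ℝ := fun f => ∑ w, gadgetDiff f w with hZ
  set B : (Fin n → Fin n) → ℝ := fun f => (validNum f : ℝ) with hB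
  have hZ0 : 𝔼 f, Z f = 0 := by
    have := expect_sum_gadgetDiff_mul (V := Fin n) fun _ => 1
    simp only [one_mul, sub_self, zero_mul, Finset.expect_const_zero, Finset.sum_const_zero] at this
    exact this
  have hZvar : 𝔼 f, Z f ^ 2 ≤ n * K := by
    have h := pvar_le_of_abs_sub_le (F := Z) (c := 4 * 54 * ((3 : ℕ) + 1)) fun f j a =>
      isLocal_gadgetDiff.abs_sum_sub_le abs_gadgetDiff_le
        fun x hx => (Function.update_of_ne hx a f).symm
    rw [pvar] at h
    simp only [hZ0, sub_zero] at h
    refine h.trans (le_of_eq ?_)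
    rw [hK]; push_cast; ring
  have hBZ : n * q ≤ 𝔼 f, (B f - 𝔼 g, B g) * Z f := by
    have e : 𝔼 f, (B f - 𝔼 g, B g) * Z f = 𝔼 f, B f * Z f := by
      simp only [sub_mul, Finset.expect_sub_distrib, ← Finset.mul_expect, hZ0, mul_zero, sub_zero]
    rw [e]
    exact (mul_le_mul_of_nonneg_left hqn.le hnp.le).trans (le_expect_validNum_mul hn)
  have hcs := Finset.expect_mul_sq_le_sq_mul_sq Finset.univ (fun f => B f - 𝔼 g, B g) Z
  have h1 : (n * q) ^ 2 ≤ pvar B * (n * K) :=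
    calc (n * q) ^ 2 ≤ (𝔼 f, (B f - 𝔼 g, B g) * Z f) ^ 2 := by gcongr
      _ ≤ _ := hcs
      _ ≤ _ := mul_le_mul_of_nonneg_left hZvar (pvar_nonneg B)
  rw [div_mul_eq_mul_div, div_le_iff₀ hK0]
  have h2 : n * (q ^ 2 * n) ≤ n * (pvar B * K) := by nlinarith
  exact le_of_mul_le_mul_left h2 hnp

end

/-- The number `validNum f` as a random variable on the space of maps. -/
def validVar (n : ℕ) (f : Fin n → Fin n) : ℝ := validNum f

theorem abs_validVar_sub_le {n : ℕ} (f : Fin n → Fin n) (j a : Fin n) :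
    |validVar n f - validVar n (Function.update f j a)| ≤ 2 :=
  abs_validNum_sub_le fun _ hx => (Function.update_of_ne hx a f).symm

/-- The standard deviation of `validVar`. -/
def sdev (n : ℕ) : ℝ := √(pvar (validVar n))

theorem sdev_sq (n : ℕ) : sdev n ^ 2 = pvar (validVar n) := Real.sq_sqrt (pvar_nonneg _)

theorem sdev_nonneg (n : ℕ) : 0 ≤ sdev n := Real.sqrt_nonneg _

theorem exists_le_sdev_sq : ∃ c : ℝ, 0 < c ∧ ∀ᶠ n : ℕ in atTop, c * n ≤ sdev n ^ 2 := by
  simp only [sdev_sq]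
  exact exists_le_pvar_validNum

theorem tendsto_cchar_validVar (θ : ℝ) :
    Tendsto (fun n : ℕ => cchar (validVar n) (θ / sdev n)) atTop
      (𝓝 (Real.exp (-(θ ^ 2 / 2)) : ℝ)) := by
  obtain ⟨c, hc, hcn⟩ := exists_le_sdev_sq
  rw [Metric.tendsto_atTop']
  intro ε hε
  have hlarge : ∀ᶠ n : ℕ in atTop, |θ| ^ 3 * 4 / (c * √c) / (ε / 3) ≤ √n :=
    (Real.tendsto_sqrt_atTop.comp tendsto_natCast_atTop_atTop).eventually_ge_atTop _
  have hδ : 0 < ε / 3 * c / (θ ^ 2 + 1) := by positivity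
  have hev := (hcn.and ((eventually_expect_abs_incr_sub_pvar_le hδ).and
    (hlarge.and (eventually_ge_atTop 1))))
  obtain ⟨N, hN⟩ := eventually_atTop.1 hev
  refine ⟨N, fun n hn => ?_⟩
  obtain ⟨h1, h2, h3, h4⟩ := hN n hn.le
  have : NeZero n := ⟨by omega⟩
  have h2 := h2
  have hnp : (0 : ℝ) < n := by exact_mod_cast h4
  have hs : 0 < sdev n := by
    have h0 : 0 < sdev n ^ 2 := lt_of_lt_of_le (by positivity) h1
    exact lt_of_le_of_ne (sdev_nonneg n) fun e => by rw [← e] at h0; norm_num at h0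
  have hmain := norm_cchar_sub_le (F := validVar n) (c := 2) (by norm_num) abs_validVar_sub_le
    (θ / sdev n)
  have e1 : (θ / sdev n) ^ 2 * pvar (validVar n) / 2 = θ ^ 2 / 2 := by
    rw [← sdev_sq]; field_simp
  rw [e1] at hmain
  rw [dist_eq_norm]
  refine hmain.trans_lt ?_
  have hu : (θ / sdev n) ^ 2 ≤ θ ^ 2 / (c * n) := by
    rw [div_pow]; gcongr
  have hE0 : 0 ≤ 𝔼 p, |incr (validVar n) p - pvar (validVar n)| :=
    Finset.expect_nonneg fun _ _ => abs_nonneg _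
  have t1 : (θ / sdev n) ^ 2 * (𝔼 p, |incr (validVar n) p - pvar (validVar n)|) ≤ ε / 3 :=
    calc _ ≤ θ ^ 2 / (c * n) * (ε / 3 * c / (θ ^ 2 + 1) * n) :=
          mul_le_mul hu h2 hE0 (by positivity)
      _ = ε / 3 * (θ ^ 2 / (θ ^ 2 + 1)) := by field_simp
      _ ≤ ε / 3 * 1 := by
          gcongr
          rw [div_le_one (by positivity)]; linarith
      _ = ε / 3 := mul_one _
  have hsl : √c * √n ≤ sdev n := by
    rw [← Real.sqrt_mul hc.le]
    exact Real.sqrt_le_iff.2 ⟨hs.le, h1⟩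
  have t2 : |θ / sdev n| ^ 3 * n * 2 ^ 3 / 2 ≤ ε / 3 := by
    have hcs : 0 < √c := Real.sqrt_pos.2 hc
    have hns : 0 < √(n : ℝ) := Real.sqrt_pos.2 hnp
    have hnn : (n : ℝ) = √n * √n := (Real.mul_self_sqrt hnp.le).symm
    have hcc : c = √c * √c := (Real.mul_self_sqrt hc.le).symm
    rw [div_le_iff₀ (by positivity)] at h3
    calc |θ / sdev n| ^ 3 * n * 2 ^ 3 / 2 = |θ| ^ 3 / sdev n ^ 3 * n * 4 := by
          rw [abs_div, abs_of_pos hs, div_pow]; ring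
      _ ≤ |θ| ^ 3 / (√c * √n) ^ 3 * n * 4 := by gcongr
      _ = |θ| ^ 3 * 4 / (c * √c) / √n := by
          rw [hnn, hcc]
          simp only [Real.sqrt_mul_self hcs.le, Real.sqrt_mul_self hns.le]
          field_simp
      _ ≤ ε / 3 := by
          rw [div_le_iff₀ hns]
          linarith
  linarith

section

/-- The graph joining each point to its image. -/
def mapGraph {V : Type*} (p : V → V) : SimpleGraph V := SimpleGraph.fromRel fun x y => p x = y

/-- All cyclic points of `p` are fixed points. -/
def CycFree {V : Type*} (p : V → V) : Prop := ∀ c, Cyc p c → p c = c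

section MapGraph

variable {V : Type*} {p : V → V}

theorem mapGraph_adj {x y : V} : (mapGraph p).Adj x y ↔ x ≠ y ∧ (p x = y ∨ p y = x) :=
  SimpleGraph.fromRel_adj _ _ _

theorem not_cyc_ne {c : V} (hc : ¬ Cyc p c) : c ≠ p c := fun h => hc ⟨0, h.symm⟩

theorem edist_apply_add_one_le {c x y : V} (hx : ¬ Desc p c x) (w : (mapGraph p).Walk y x)
    (hy : Desc p c y) : (mapGraph p).edist (p c) x + 1 ≤ w.length := by
  induction w with
  | nil => exact absurd hy hx
  | @cons y z x h w ih =>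
    by_cases hz : Desc p c z
    · refine (ih hx hz).trans ?_
      rw [SimpleGraph.Walk.length_cons]
      exact_mod_cast Nat.le_succ _
    · obtain ⟨_, h | h⟩ := mapGraph_adj.1 h
      · have hyc : y = c := by
          by_contra hne
          exact hz (h ▸ hy.apply_of_ne hne)
        subst hyc
        subst h
        rw [SimpleGraph.Walk.length_cons]
        push_cast
        gcongr
        exact SimpleGraph.Walk.edist_le w
      · exact absurd (Desc.of_apply (h ▸ hy)) hz

theorem edist_eq_add_one {c x : V} (hc : ¬ Cyc p c) (hx : ¬ Desc p c x) :
    (mapGraph p).edist c x = (mapGraph p).edist (p c) x + 1 := by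
  apply le_antisymm
  · have hadj : (mapGraph p).Adj c (p c) := mapGraph_adj.2 ⟨not_cyc_ne hc, Or.inl rfl⟩
    calc (mapGraph p).edist c x ≤ (mapGraph p).edist c (p c) + (mapGraph p).edist (p c) x :=
          SimpleGraph.edist_triangle
      _ = (mapGraph p).edist (p c) x + 1 := by
          rw [SimpleGraph.edist_eq_one_iff_adj.2 hadj, add_comm]
  · by_cases h : (mapGraph p).Reachable c x
    · obtain ⟨w, hw⟩ := h.exists_walk_length_eq_edist
      rw [← hw]
      exact edist_apply_add_one_le hx w (Desc.refl p c)
    · rw [SimpleGraph.edist_eq_top_of_not_reachable h]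
      exact le_top

theorem edist_eq_add {x y : V} (a : ℕ) (hc : ¬ Cyc p (p^[a] x)) (hy : ¬ Desc p (p^[a] x) y) :
    (mapGraph p).edist x y = (mapGraph p).edist (p^[a + 1] x) y + (a + 1 : ℕ) := by
  induction a generalizing x with
  | zero => exact_mod_cast edist_eq_add_one hc hy
  | succ a ih =>
    have hd : Desc p (p^[a + 1] x) x := ⟨a + 1, rfl⟩
    rw [edist_eq_add_one (fun h => hc (h.of_desc hd)) fun h => hy (hd.trans h)]
    rw [Function.iterate_succ_apply] at hc hy
    rw [ih hc hy, ← Function.iterate_succ_apply]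
    push_cast
    rw [add_assoc]

theorem valid_of_resolves {R : Finset V} (h : Resolves (mapGraph p) R) : Valid p R := by
  intro c₁ c₂ hne h₁ h₂ he
  by_contra hcon
  push Not at hcon
  obtain ⟨w, hw, hw'⟩ := h c₁ c₂ hne
  obtain ⟨d₁, d₂⟩ := hcon w (by exact_mod_cast hw)
  exact hw' (by rw [edist_eq_add_one h₁ d₁, edist_eq_add_one h₂ d₂, he])

theorem reachable_iterate (x : V) (k : ℕ) : (mapGraph p).Reachable x (p^[k] x) := by
  induction k with
  | zero => exact SimpleGraph.Reachable.refl x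
  | succ k ih =>
    refine ih.trans ?_
    rw [Function.iterate_succ_apply']
    by_cases h : p^[k] x = p (p^[k] x)
    · rw [← h]
    · exact SimpleGraph.Adj.reachable (mapGraph_adj.2 ⟨h, Or.inl rfl⟩)

theorem edist_iterate_le (x : V) (k : ℕ) : (mapGraph p).edist x (p^[k] x) ≤ k := by
  induction k with
  | zero => simp
  | succ k ih =>
    refine SimpleGraph.edist_triangle.trans ((add_le_add ih (?_ :
      (mapGraph p).edist (p^[k] x) _ ≤ 1)).trans (by push_cast; rfl))
    rw [Function.iterate_succ_apply']
    by_cases h : p^[k] x = p (p^[k] x)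
    · rw [← h]; simp
    · exact (SimpleGraph.edist_eq_one_iff_adj.2 (mapGraph_adj.2 ⟨h, Or.inl rfl⟩)).le

theorem isAcyclic_mapGraph (hp : CycFree p) : (mapGraph p).IsAcyclic := by
  rw [SimpleGraph.isAcyclic_iff_forall_adj_isBridge]
  suffices key : ∀ x, x ≠ p x → (mapGraph p).IsBridge s(x, p x) by
    intro x y h
    obtain ⟨hne, rfl | rfl⟩ := mapGraph_adj.1 h
    · exact key x hne
    · rw [Sym2.eq_swap]; exact key y hne.symm
  intro x hx
  rw [SimpleGraph.isBridge_iff]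
  rintro ⟨w⟩
  suffices h : ∀ y z (_ : ((mapGraph p) \ SimpleGraph.fromEdgeSet {s(x, p x)}).Walk y z), Desc p x y →
      Desc p x z by
    exact hx (hp x (h _ _ w (Desc.refl p x))).symm
  intro y z w hy
  induction w with
  | nil => exact hy
  | @cons y y' z h w ih =>
    apply ih
    rw [SimpleGraph.sdiff_adj, SimpleGraph.fromEdgeSet_adj, mapGraph_adj] at h
    obtain ⟨⟨hne, h | h⟩, h'⟩ := h
    · subst h
      refine hy.apply_of_ne fun e => ?_
      subst e
      exact h' ⟨rfl, hne⟩
    · exact Desc.of_apply (h ▸ hy)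

theorem not_desc_of_fixed {c r : V} (hr : p r = r) (hc : c ≠ r) : ¬ Desc p c r := by
  rintro ⟨k, hk⟩
  rw [Function.iterate_fixed hr] at hk
  exact hc hk.symm

variable [Fintype V]

theorem CycFree.apply_iterate_card (hp : CycFree p) (x : V) :
    p (p^[Fintype.card V] x) = p^[Fintype.card V] x := by
  apply hp
  have hnot : ¬ Function.Injective fun i : Fin (Fintype.card V + 1) => p^[i] x := by
    intro h
    have := Fintype.card_le_of_injective _ h
    simp at this
  simp only [Function.Injective, not_forall] at hnot
  obtain ⟨i, j, e, hne⟩ := hnot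
  wlog hij : i < j generalizing i j
  · exact this j i e.symm (Ne.symm hne) (lt_of_le_of_ne (not_lt.1 hij) (Ne.symm hne))
  have hlt : (i : ℕ) < j := hij
  have hc : Cyc p (p^[i] x) := by
    refine ⟨j - i - 1, ?_⟩
    rw [← Function.iterate_add_apply]
    rw [show (j : ℕ) - i - 1 + 1 + i = j by omega]
    exact e.symm
  refine hc.of_desc ⟨Fintype.card V - i, ?_⟩
  rw [← Function.iterate_add_apply]
  congr 1
  omega

theorem CycFree.iterate_card_eq (hp : CycFree p) {x y : V} (h : (mapGraph p).Reachable x y) :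
    p^[Fintype.card V] x = p^[Fintype.card V] y := by
  obtain ⟨w⟩ := h
  induction w with
  | nil => rfl
  | @cons x y z h w ih =>
    rw [← ih]
    have key : ∀ x, p^[Fintype.card V] (p x) = p^[Fintype.card V] x := fun x => by
      rw [← Function.iterate_succ_apply, Function.iterate_succ_apply', hp.apply_iterate_card]
    obtain ⟨_, rfl | rfl⟩ := mapGraph_adj.1 h
    · exact (key x).symm
    · exact key y

/-- The set of fixed points. -/
def fixPts (p : V → V) : Finset V := Finset.univ.filter fun x => p x = x

theorem resolves_of_valid (hp : CycFree p) {R : Finset V} (h : Valid p R) :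
    Resolves (mapGraph p) ↑(R ∪ fixPts p) := by
  intro u v huv
  by_contra hcon
  push Not at hcon
  set N := Fintype.card V
  have hroot : ∀ x, p^[N] x ∈ (↑(R ∪ fixPts p) : Set V) := fun x =>
    Finset.mem_coe.2 (Finset.mem_union_right _ (Finset.mem_filter.2
      ⟨Finset.mem_univ _, hp.apply_iterate_card x⟩))
  set r := p^[N] u with hr
  have hrfix : p r = r := hp.apply_iterate_card u
  have hreach : (mapGraph p).Reachable v r := by
    have h1 : (mapGraph p).edist v r ≠ ⊤ := by
      rw [← hcon r (hroot u)]
      exact SimpleGraph.edist_ne_top_iff_reachable.2 (reachable_iterate u N)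
    exact SimpleGraph.edist_ne_top_iff_reachable.1 h1
  have hrv : p^[N] v = r := by
    rw [hp.iterate_card_eq hreach, Function.iterate_fixed hrfix]
  have depth : ∀ x (hx : ∃ k, p^[k] x = r), (mapGraph p).edist x r = (Nat.find hx : ℕ) ∧
      ∀ i < Nat.find hx, ¬ Cyc p (p^[i] x) := by
    intro x hx
    have hlt : ∀ i < Nat.find hx, ¬ Cyc p (p^[i] x) := by
      intro i hi hc
      have hfix := hp _ hc
      have e : p^[Nat.find hx] x = p^[i] x := by
        rw [show Nat.find hx = (Nat.find hx - i) + i by omega, Function.iterate_add_apply,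
          Function.iterate_fixed hfix]
      exact Nat.find_min hx hi (e ▸ Nat.find_spec hx)
    refine ⟨?_, hlt⟩
    cases hk : Nat.find hx with
    | zero =>
      have := Nat.find_spec hx
      rw [hk] at this
      simp only [Function.iterate_zero, id] at this
      rw [this]; simp
    | succ a =>
      have hspec := Nat.find_spec hx
      have hmin := Nat.find_min hx (show a < Nat.find hx by omega)
      rw [edist_eq_add a (hlt a (by omega)) (not_desc_of_fixed hrfix hmin), ← hk, hspec]
      simp
  obtain ⟨hu1, hu2⟩ := depth u ⟨N, rfl⟩
  obtain ⟨hv1, hv2⟩ := depth v ⟨N, hrv⟩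
  have hkl := (hu1.symm.trans (hcon r (hroot u))).trans hv1
  rw [Nat.cast_inj] at hkl
  have hmeet : ∃ m, p^[m] u = p^[m] v := ⟨N, hrv.symm ▸ rfl⟩
  obtain ⟨m, hm⟩ : ∃ m, Nat.find hmeet = m + 1 := by
    refine Nat.exists_eq_succ_of_ne_zero fun h0 => huv ?_
    have := Nat.find_spec hmeet
    rw [h0] at this
    exact this
  have hmlt : m + 1 ≤ Nat.find (⟨N, rfl⟩ : ∃ k, p^[k] u = r) := by
    rw [← hm]
    refine Nat.find_min' hmeet ?_
    rw [Nat.find_spec (⟨N, rfl⟩ : ∃ k, p^[k] u = r), hkl,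
      Nat.find_spec (⟨N, hrv⟩ : ∃ k, p^[k] v = r)]
  have hspec := Nat.find_spec hmeet
  rw [hm] at hspec
  have hne := Nat.find_min hmeet (show m < Nat.find hmeet by omega)
  have hcu := hu2 m (by omega)
  have hcv := hv2 m (by omega)
  have hpar : p (p^[m] u) = p (p^[m] v) := by
    rw [← Function.iterate_succ_apply' p, ← Function.iterate_succ_apply' p, hspec]
  have final : ∀ u v x, ¬ Cyc p (p^[m] u) → ¬ Cyc p (p^[m] v) → p (p^[m] u) = p (p^[m] v) →
      p^[m] u ≠ p^[m] v → Desc p (p^[m] u) x →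
      (mapGraph p).edist u x ≠ (mapGraph p).edist v x := by
    intro u v x hu hv hpar hne ⟨a, ha⟩
    have hxv : ¬ Desc p (p^[m] v) x := by
      intro hx
      rcases Desc.comparable hx ⟨a, ha⟩ with h | h
      · exact hv (hpar ▸ h.apply_of_ne hne : Desc p (p^[m] v) (p (p^[m] v)))
      · exact hu (hpar.symm ▸ h.apply_of_ne hne.symm : Desc p (p^[m] u) (p (p^[m] u)))
    have e1 := edist_eq_add m hv hxv
    have e2 := edist_eq_add (p := p) (x := x) (y := p (p^[m] u)) a (ha ▸ hu) (by rw [ha]; exact hu)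
    rw [Function.iterate_succ_apply', ha, SimpleGraph.edist_self, zero_add] at e2
    rw [Function.iterate_succ_apply', ← hpar,
      SimpleGraph.edist_comm (u := p (p^[m] u)), e2] at e1
    have e3 : (mapGraph p).edist u x ≤ (m + a : ℕ) := by
      refine SimpleGraph.edist_triangle.trans ((add_le_add (edist_iterate_le u m)
        (?_ : (mapGraph p).edist (p^[m] u) x ≤ a)).trans (by push_cast; rfl))
      rw [SimpleGraph.edist_comm, ← ha]
      exact edist_iterate_le x a
    rw [e1]
    refine (e3.trans_lt ?_).ne
    exact_mod_cast (by omega : m + a < a + 1 + (m + 1))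
  obtain ⟨x, hx, hd | hd⟩ := h _ _ hne hcu hcv hpar
  · exact final u v x hcu hcv hpar hne hd
      (hcon x (Finset.mem_coe.2 (Finset.mem_union_left _ hx)))
  · exact final v u x hcv hcu hpar.symm (Ne.symm hne) hd
      (hcon x (Finset.mem_coe.2 (Finset.mem_union_left _ hx))).symm

theorem validNum_le_metricDim (p : V → V) : validNum p ≤ metricDim (mapGraph p) := by
  rw [metricDim]
  split_ifs with h
  · rw [← h, Nat.card_eq_fintype_card]
    exact validNum_le_card p
  · have hne : {m : ℕ | ∃ R : Set V, R.ncard = m ∧ Resolves (mapGraph p) R}.Nonempty :=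
      ⟨_, Set.univ, rfl, fun u v huv => ⟨u, trivial, fun e => huv (by
        rw [SimpleGraph.edist_self, eq_comm, SimpleGraph.edist_eq_zero_iff] at e
        exact e.symm)⟩⟩
    obtain ⟨R, hR, hres⟩ := Nat.sInf_mem hne
    rw [← hR, Set.ncard_eq_toFinset_card']
    refine validNum_le (valid_of_resolves ?_)
    rwa [Set.coe_toFinset]

theorem metricDim_le_validNum_add (hp : CycFree p) :
    metricDim (mapGraph p) ≤ validNum p + (fixPts p).card := by
  rw [metricDim]
  split_ifs with h
  · have hpos : 0 < (fixPts p).card := by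
      rw [Nat.card_eq_fintype_card] at h
      obtain ⟨x⟩ : Nonempty V := Fintype.card_pos_iff.1 (by omega)
      exact Finset.card_pos.2 ⟨_, Finset.mem_filter.2
        ⟨Finset.mem_univ _, hp.apply_iterate_card x⟩⟩
    omega
  · obtain ⟨R, hR, hval⟩ := exists_valid_card_eq p
    have hmem : (↑(R ∪ fixPts p) : Set V).ncard ∈
        {m : ℕ | ∃ R : Set V, R.ncard = m ∧ Resolves (mapGraph p) R} :=
      ⟨_, rfl, resolves_of_valid hp hval⟩
    refine (Nat.sInf_le hmem).trans ?_
    rw [Set.ncard_coe_finset, ← hR]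
    exact Finset.card_union_le _ _

end MapGraph

end

section

variable {V : Type*}

/-- A forest is the graph of a map pointing towards prescribed roots of its components. -/
theorem exists_mapGraph_eq {F : SimpleGraph V} (hF : F.IsAcyclic) {ρ : V → V}
    (hρ : ∀ x, F.Reachable x (ρ x)) (hρ' : ∀ x y, F.Adj x y → ρ x = ρ y) :
    ∃ p : V → V, CycFree p ∧ mapGraph p = F ∧ ∀ x, p x = x ↔ x = ρ x := by
  have hstep : ∀ x, x ≠ ρ x → ∃ y, F.Adj x y ∧ F.dist y (ρ x) < F.dist x (ρ x) := by
    intro x hx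
    obtain ⟨w, hw⟩ := (hρ x).exists_walk_length_eq_dist
    generalize ρ x = r at *
    cases w with
    | nil => exact absurd rfl hx
    | @cons _ y _ h w =>
      refine ⟨y, h, ?_⟩
      rw [← hw, SimpleGraph.Walk.length_cons]
      exact Nat.lt_succ_of_le (SimpleGraph.dist_le w)
  choose! g hg hgd using hstep
  set p : V → V := fun x => if x = ρ x then x else g x with hp
  have hp1 : ∀ x, x = ρ x → p x = x := fun x h => if_pos h
  have hp2 : ∀ x, x ≠ ρ x → p x = g x := fun x h => if_neg h
  have hfix : ∀ x, p x = x ↔ x = ρ x := by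
    intro x
    refine ⟨fun h => ?_, hp1 x⟩
    by_contra hc
    rw [hp2 x hc] at h
    exact (hg x hc).ne h.symm
  set δ : V → ℕ := fun x => F.dist x (ρ x) with hδ
  have hdec : ∀ x, x ≠ ρ x → δ (p x) < δ x := by
    intro x hx
    simp only [hδ]
    rw [hp2 x hx, ← hρ' _ _ (hg x hx)]
    exact hgd x hx
  have hle : ∀ x, δ (p x) ≤ δ x := fun x => by
    by_cases hx : x = ρ x
    · rw [hp1 x hx]
    · exact (hdec x hx).le
  have hleit : ∀ k x, δ (p^[k] x) ≤ δ x := by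
    intro k
    induction k with
    | zero => exact fun x => le_rfl
    | succ k ih =>
      intro x
      rw [Function.iterate_succ_apply]
      exact (ih _).trans (hle x)
  have hmono : mapGraph p ≤ F := by
    have key : ∀ x, x ≠ p x → F.Adj x (p x) := by
      intro x hx
      have hx' : x ≠ ρ x := fun h => hx (hp1 x h).symm
      rw [hp2 x hx']
      exact hg x hx'
    intro x y h
    obtain ⟨hne, rfl | rfl⟩ := mapGraph_adj.1 h
    · exact key x hne
    · exact (key y hne.symm).symm
  have hreach : ∀ d x, δ x ≤ d → (mapGraph p).Reachable x (ρ x) := by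
    intro d
    induction d with
    | zero =>
      intro x hx
      by_cases h : x = ρ x
      · rw [← h]
      · exact absurd (hdec x h) (by omega)
    | succ d ih =>
      intro x hx
      by_cases h : x = ρ x
      · rw [← h]
      · have h1 := ih (p x) (by have := hdec x h; omega)
        have h2 : ρ (p x) = ρ x := by rw [hp2 x h]; exact (hρ' _ _ (hg x h)).symm
        rw [h2] at h1
        exact (reachable_iterate x 1).trans h1
  refine ⟨p, ?_, le_antisymm hmono ?_, hfix⟩
  · rintro c ⟨k, hk⟩
    rw [hfix]
    by_contra hc
    have h1 := hleit k (p c)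
    rw [← Function.iterate_succ_apply, hk] at h1
    exact absurd (hdec c hc) (by omega)
  · intro x y hxy
    by_contra hnot
    have hb := (SimpleGraph.isAcyclic_iff_forall_adj_isBridge.1 hF) hxy
    rw [SimpleGraph.isBridge_iff] at hb
    have hr : (mapGraph p).Reachable x y := by
      have h1 := hreach _ x le_rfl
      rw [hρ' x y hxy] at h1
      exact h1.trans (hreach _ y le_rfl).symm
    refine hb (hr.mono fun a b hab => ?_)
    rw [SimpleGraph.deleteEdges_adj]
    refine ⟨hmono hab, fun h1 => hnot ?_⟩
    rw [Set.mem_singleton_iff, Sym2.eq_iff] at h1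
    rcases h1 with ⟨rfl, rfl⟩ | ⟨rfl, rfl⟩
    exacts [hab, hab.symm]

/-- Every forest is the graph of a map. -/
theorem exists_mapGraph {F : SimpleGraph V} (hF : F.IsAcyclic) :
    ∃ p : V → V, CycFree p ∧ mapGraph p = F := by
  obtain ⟨p, h1, h2, -⟩ := exists_mapGraph_eq hF
    (ρ := fun x => Quot.out (F.connectedComponentMk x))
    (fun x => SimpleGraph.ConnectedComponent.exact (Quot.out_eq (F.connectedComponentMk x)).symm)
    fun x y h => congrArg Quot.out (SimpleGraph.ConnectedComponent.connectedComponentMk_eq_of_adj h)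
  exact ⟨p, h1, h2⟩

/-- `p` has the unique cyclic point `b`, which is fixed. -/
def RootedAt (p : V → V) (b : V) : Prop := CycFree p ∧ ∀ x, p x = x ↔ x = b

theorem exists_rootedAt {T : SimpleGraph V} (hT : IsTree T) (b : V) :
    ∃ p : V → V, RootedAt p b ∧ mapGraph p = T := by
  obtain ⟨p, h1, h2, h3⟩ := exists_mapGraph_eq hT.2 (ρ := fun _ => b)
    (fun x => hT.1.preconnected x b) fun _ _ _ => rfl
  exact ⟨p, ⟨h1, h3⟩, h2⟩

variable [Fintype V]

theorem eq_of_mapGraph_eq {p p' : V → V} (hp : CycFree p)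
    (hp' : CycFree p') (h : mapGraph p = mapGraph p') (hfix : ∀ x, p x = x ↔ p' x = x) : p = p' := by
  funext x
  by_cases hx : p x = x
  · rw [hx, (hfix x).1 hx]
  have hadj : (mapGraph p).Adj x (p x) := mapGraph_adj.2 ⟨Ne.symm hx, Or.inl rfl⟩
  rw [h] at hadj
  obtain ⟨hne, e | e⟩ := mapGraph_adj.1 hadj
  · exact e.symm
  exfalso
  set r := p^[Fintype.card V] x with hr
  have hrp : p r = r := hp.apply_iterate_card x
  have hrp' := (hfix r).1 hrp
  have hcyc : ¬ Cyc p x := fun hc => hx (hp x hc)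
  have h1 := edist_eq_add_one (p := p) (x := r) hcyc
    (not_desc_of_fixed hrp fun e => hx (e ▸ hrp))
  have hyr : p x ≠ r := fun e' => hne (e.symm.trans (by rw [e', hrp']))
  have hcyc' : ¬ Cyc p' (p x) := fun hc => hne (e.symm.trans (hp' _ hc))
  have h2 := edist_eq_add_one (p := p') (x := r) hcyc' (not_desc_of_fixed hrp' hyr)
  have htop : (mapGraph p).edist (p x) r ≠ ⊤ :=
    SimpleGraph.edist_ne_top_iff_reachable.2
      ((reachable_iterate x 1).symm.trans (reachable_iterate x _))
  rw [e, ← h, h1] at h2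
  obtain ⟨m, hm⟩ := ENat.ne_top_iff_exists.1 htop
  rw [← hm] at h2
  have h3 : m = m + 1 + 1 := by exact_mod_cast h2
  omega

theorem RootedAt.iterate_card {p : V → V} {b : V} (h : RootedAt p b) (x : V) :
    p^[Fintype.card V] x = b := (h.2 _).1 (h.1.apply_iterate_card x)

theorem RootedAt.isTree {p : V → V} {b : V} (h : RootedAt p b) : IsTree (mapGraph p) := by
  refine ⟨(SimpleGraph.connected_iff _).2 ⟨fun x y => ?_, ⟨b⟩⟩, isAcyclic_mapGraph h.1⟩
  have h1 := reachable_iterate (p := p) x (Fintype.card V)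
  have h2 := reachable_iterate (p := p) y (Fintype.card V)
  rw [h.iterate_card] at h1 h2
  exact h1.trans h2.symm

theorem RootedAt.eq {p p' : V → V} {b : V} (h : RootedAt p b) (h' : RootedAt p' b)
    (he : mapGraph p = mapGraph p') : p = p' :=
  eq_of_mapGraph_eq h.1 h'.1 he fun x => by rw [h.2, h'.2]

/-- Each tree corresponds to exactly `|V|` rooted maps. -/
theorem sum_rootedAt (h : SimpleGraph V → ℝ) :
    ∑ q : (V → V) × V with RootedAt q.1 q.2, h (mapGraph q.1) =
      Fintype.card V * ∑ T : SimpleGraph V with IsTree T, h T := by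
  have e : ∑ q : (V → V) × V with RootedAt q.1 q.2, h (mapGraph q.1) =
      ∑ q ∈ (Finset.univ.filter fun T : SimpleGraph V => IsTree T) ×ˢ (Finset.univ : Finset V),
        h q.1 := by
    refine Finset.sum_bij (fun q _ => (mapGraph q.1, q.2)) ?_ ?_ ?_ ?_
    · intro q hq
      exact Finset.mem_product.2 ⟨Finset.mem_filter.2
        ⟨Finset.mem_univ _, (Finset.mem_filter.1 hq).2.isTree⟩, Finset.mem_univ _⟩
    · rintro ⟨p, b⟩ hp ⟨p', b'⟩ hp' e
      simp only [Prod.mk.injEq] at e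
      obtain ⟨e, rfl⟩ := e
      exact congrArg (·, b) ((Finset.mem_filter.1 hp).2.eq (Finset.mem_filter.1 hp').2 e)
    · rintro ⟨T, b⟩ hT
      obtain ⟨p, hp, rfl⟩ := exists_rootedAt
        (Finset.mem_filter.1 (Finset.mem_product.1 hT).1).2 b
      exact ⟨(p, b), Finset.mem_filter.2 ⟨Finset.mem_univ _, hp⟩, rfl⟩
    · intro q _; rfl
  rw [e, Finset.sum_product, Finset.mul_sum]
  simp

end

section

variable {V : Type*}

theorem Desc.of_eqOn_compl {f g : V → V} {C : Set V} (hC : ∀ x ∈ C, f x ∈ C)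
    (h : ∀ x, x ∉ C → f x = g x) {c x : V} (hc : c ∉ C) (hx : Desc f c x) : Desc g c x := by
  obtain ⟨k, hk⟩ := hx
  induction k generalizing x with
  | zero => exact ⟨0, hk⟩
  | succ k ih =>
    have hxC : x ∉ C := by
      intro hxC
      have key : ∀ m, f^[m] x ∈ C := fun m => by
        induction m with
        | zero => exact hxC
        | succ m ih => rw [Function.iterate_succ_apply']; exact hC _ ih
      exact hc (hk ▸ key _)
    have h1 := ih hk
    rw [h x hxC] at h1
    exact h1.of_apply

theorem Cyc.injective {f : V → V} {x y : V} (hx : Cyc f x) (hy : Cyc f y) (h : f x = f y) :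
    x = y := by
  have key : ∀ z, Cyc f z → z ∈ Function.periodicPts f := fun z ⟨k, hk⟩ =>
    Function.mk_mem_periodicPts (Nat.succ_pos k) hk
  exact (Function.bijOn_periodicPts f).injOn (key x hx) (key y hy) h

variable [Fintype V]

/-- The cyclic points of a map. -/
def cycPts (f : V → V) : Finset V := Finset.univ.filter (Cyc f)

theorem mem_cycPts {f : V → V} {x : V} : x ∈ cycPts f ↔ Cyc f x := by simp [cycPts]

/-- The forward orbit of a point. -/
def fwd (p : V → V) (a : V) : Finset V := Finset.univ.filter fun c => Desc p c a

theorem mem_fwd {p : V → V} {a x : V} : x ∈ fwd p a ↔ Desc p x a := by simp [fwd]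

/-- The correspondence between maps and doubly rooted trees. -/
structure Joyal (f p : V → V) (a : V) : Prop where
  cycPts_eq : cycPts f = fwd p a
  apply_enum : ∀ i : Fin (cycPts f).card, f ((cycPts f).equivFin.symm i) = p^[i] a
  apply_eq : ∀ x, x ∉ cycPts f → f x = p x

theorem Joyal.left_unique {f f' p : V → V} {a : V} (h : Joyal f p a) (h' : Joyal f' p a) :
    f = f' := by
  have hC : cycPts f = cycPts f' := h.cycPts_eq.trans h'.cycPts_eq.symm
  have h1 := h.apply_enum
  have h2 := h'.apply_enum
  have h3 := h'.apply_eq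
  rw [← hC] at h2 h3
  funext x
  by_cases hx : x ∈ cycPts f
  · have e : x = (cycPts f).equivFin.symm ((cycPts f).equivFin ⟨x, hx⟩) := by simp
    rw [e, h1, h2]
  · rw [h.apply_eq x hx, h3 x hx]

/-- The forward orbit of a point in a rooted map is a path ending at the root. -/
theorem RootedAt.fwd_enum {p : V → V} {b : V} (h : RootedAt p b) (a : V) :
    (∀ i < (fwd p a).card, ∀ j < (fwd p a).card, p^[i] a = p^[j] a → i = j) ∧
    (∀ x ∈ fwd p a, ∃ i < (fwd p a).card, p^[i] a = x) ∧
    ∀ i, i + 1 = (fwd p a).card → p^[i] a = b := by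
  have hex : ∃ d, p^[d] a = b := ⟨_, h.iterate_card a⟩
  set d := Nat.find hex with hd
  have hdb : p^[d] a = b := Nat.find_spec hex
  have hpb : p b = b := (h.2 b).2 rfl
  have hinj' : ∀ i j, i < j → j ≤ d → p^[i] a ≠ p^[j] a := by
    intro i j hij hj he
    obtain ⟨m, rfl⟩ := Nat.exists_eq_add_of_lt hij
    have hcyc : Cyc p (p^[i] a) := ⟨m, by
      rw [← Function.iterate_add_apply, he]; congr 1; omega⟩
    have : p^[i] a = b := (h.2 _).1 (h.1 _ hcyc)
    exact Nat.find_min hex (m := i) (by omega) this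
  have hinj : ∀ i < d + 1, ∀ j < d + 1, p^[i] a = p^[j] a → i = j := by
    intro i hi j hj he
    rcases lt_trichotomy i j with h1 | h1 | h1
    · exact absurd he (hinj' i j h1 (by omega))
    · exact h1
    · exact absurd he.symm (hinj' j i h1 (by omega))
  have hsurj : ∀ x ∈ fwd p a, ∃ i < d + 1, p^[i] a = x := by
    intro x hx
    obtain ⟨k, rfl⟩ := mem_fwd.1 hx
    by_cases hk : k < d + 1
    · exact ⟨k, hk, rfl⟩
    · refine ⟨d, by omega, ?_⟩
      obtain ⟨m, rfl⟩ := Nat.exists_eq_add_of_le (show d ≤ k by omega)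
      rw [add_comm, Function.iterate_add_apply, hdb, Function.iterate_fixed hpb]
  have hcard : (fwd p a).card = d + 1 := by
    have : fwd p a = (Finset.range (d + 1)).image fun i => p^[i] a := by
      ext x
      simp only [Finset.mem_image, Finset.mem_range]
      exact ⟨hsurj x, fun ⟨i, _, hi⟩ => mem_fwd.2 ⟨i, hi⟩⟩
    rw [this, Finset.card_image_of_injOn, Finset.card_range]
    intro i hi j hj
    exact hinj i (by simpa using hi) j (by simpa using hj)
  rw [hcard]
  refine ⟨hinj, hsurj, fun i hi => ?_⟩
  rw [show i = d by omega, hdb]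

theorem Joyal.right_unique {f p p' : V → V} {a b a' b' : V} (h : Joyal f p a)
    (h' : Joyal f p' a') (hr : RootedAt p b) (hr' : RootedAt p' b') : p = p' ∧ a = a' := by
  have hit : ∀ i < (cycPts f).card, p^[i] a = p'^[i] a' := fun i hi =>
    (h.apply_enum ⟨i, hi⟩).symm.trans (h'.apply_enum ⟨i, hi⟩)
  have hpos : 0 < (cycPts f).card := by
    rw [h.cycPts_eq]
    exact Finset.card_pos.2 ⟨a, mem_fwd.2 (Desc.refl p a)⟩
  refine ⟨funext fun x => ?_, hit 0 hpos⟩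
  by_cases hx : x ∈ cycPts f
  · obtain ⟨-, h2, h3⟩ := hr.fwd_enum a
    obtain ⟨-, -, h3'⟩ := hr'.fwd_enum a'
    rw [h.cycPts_eq] at hx
    obtain ⟨i, hi, rfl⟩ := h2 x hx
    rw [← h.cycPts_eq] at hi h3
    rw [← h'.cycPts_eq] at h3'
    by_cases hi' : i + 1 < (cycPts f).card
    · rw [← Function.iterate_succ_apply' p, hit _ hi', hit i hi,
        ← Function.iterate_succ_apply' p']
    · have e1 := h3 i (by omega)
      have e2 := h3' i (by omega)
      have e3 := hit i hi
      rw [e1, (hr.2 b).2 rfl, ← e1, e3, e2, (hr'.2 b').2 rfl]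
  · rw [← h.apply_eq x hx, h'.apply_eq x hx]

theorem RootedAt.exists_joyal {p : V → V} {b : V} (h : RootedAt p b) (a : V) :
    ∃ f, Joyal f p a := by
  obtain ⟨h1, h2, h3⟩ := h.fwd_enum a
  set C := fwd p a with hC
  set e := C.equivFin with he
  have hpC : ∀ i, p^[i] a ∈ C := fun i => mem_fwd.2 ⟨i, rfl⟩
  set f : V → V := fun x => if hx : x ∈ C then p^[e ⟨x, hx⟩] a else p x with hf
  have hf1 : ∀ x (hx : x ∈ C), f x = p^[e ⟨x, hx⟩] a := fun x hx => dif_pos hx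
  have hf2 : ∀ x, x ∉ C → f x = p x := fun x hx => dif_neg hx
  have hfC : ∀ x ∈ C, f x ∈ C := fun x hx => by rw [hf1 x hx]; exact hpC _
  have hbC : b ∈ C := mem_fwd.2 ⟨_, h.iterate_card a⟩
  have hcyc : cycPts f = C := by
    ext x
    rw [mem_cycPts]
    constructor
    · intro hx
      by_contra hxC
      have h4 := (cyc_iff_desc.1 hx).of_eqOn_compl (C := (C : Set V)) (g := p) hfC hf2
        (by simpa using hxC)
      rw [hf2 x hxC] at h4
      have h5 := (h.2 x).1 (h.1 x h4)
      exact hxC (h5 ▸ hbC)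
    · intro hx
      have hinj : Set.InjOn f (C : Set V) := by
        intro x hx y hy hxy
        have hx' : x ∈ C := hx
        have hy' : y ∈ C := hy
        rw [hf1 x hx', hf1 y hy'] at hxy
        have := h1 _ (Fin.is_lt _) _ (Fin.is_lt _) hxy
        have := e.injective (Fin.ext this)
        simpa using this
      -- an injective self-map of a finite set has only cyclic points
      set g : C → C := fun x => ⟨f x, hfC x x.2⟩ with hg
      have hgi : Function.Injective g := fun x y hxy =>
        Subtype.ext (hinj x.2 y.2 (congrArg Subtype.val hxy))
      have hper : (⟨x, hx⟩ : C) ∈ Function.periodicPts g :=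
        hgi.mem_periodicPts _
      obtain ⟨n, hn, hn'⟩ := hper
      have hsemi : Function.Semiconj (Subtype.val : C → V) g f := fun _ => rfl
      refine ⟨n - 1, ?_⟩
      rw [Nat.sub_add_cancel hn]
      have := hsemi.iterate_right n ⟨x, hx⟩
      rw [hn'.eq] at this
      exact this.symm
  refine ⟨f, ⟨hcyc, ?_, ?_⟩⟩
  · rw [hcyc]
    intro i
    rw [hf1 _ (Subtype.mem _)]
    simp [he]
  · rw [hcyc]
    exact hf2

theorem exists_cyc_iterate (f : V → V) (x : V) : ∃ k, Cyc f (f^[k] x) := by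
  obtain ⟨i, j, hij, h⟩ := Finite.exists_ne_map_eq_of_infinite fun k : ℕ => f^[k] x
  wlog hlt : i < j generalizing i j
  · exact this j i hij.symm h.symm (by omega)
  obtain ⟨m, rfl⟩ := Nat.exists_eq_add_of_lt hlt
  refine ⟨i, m, ?_⟩
  rw [← Function.iterate_add_apply, show m + 1 + i = i + m + 1 by omega]
  exact h.symm

theorem exists_joyal_rootedAt [Nonempty V] (f : V → V) :
    ∃ p b a, RootedAt p b ∧ Joyal f p a := by
  set C := cycPts f with hC
  set e := C.equivFin with he
  have hne : 0 < C.card := by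
    obtain ⟨k, hk⟩ := exists_cyc_iterate f (Classical.arbitrary V)
    exact Finset.card_pos.2 ⟨_, mem_cycPts.2 hk⟩
  have hmem : ∀ i, f (e.symm i) ∈ C := fun i =>
    mem_cycPts.2 (mem_cycPts.1 (e.symm i).2).apply
  set q0 : Fin C.card → C := fun i => ⟨f (e.symm i), hmem i⟩ with hq0
  have hinj : Function.Injective q0 := by
    intro i j hij
    have h1 : f (e.symm i) = f (e.symm j) := congrArg Subtype.val hij
    have := (mem_cycPts.1 (e.symm i).2).injective (mem_cycPts.1 (e.symm j).2) h1
    exact e.symm.injective (Subtype.ext this)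
  have hbij : Function.Bijective q0 :=
    (Fintype.bijective_iff_injective_and_card q0).2 ⟨hinj, by simp⟩
  set q := Equiv.ofBijective q0 hbij with hq
  set nxt : Fin C.card → Fin C.card := fun i => ⟨min (i + 1) (C.card - 1), by omega⟩ with hnxt
  set p : V → V := fun x => if hx : x ∈ C then q (nxt (q.symm ⟨x, hx⟩)) else f x with hp
  have hp1 : ∀ i, p (q i) = q (nxt i) := by
    intro i
    simp only [hp]
    rw [dif_pos (q i).2]
    simp
  have hp2 : ∀ x, x ∉ C → p x = f x := fun x hx => dif_neg hx
  obtain ⟨a, ha⟩ : ∃ a : V, a = (q ⟨0, hne⟩).1 := ⟨_, rfl⟩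
  obtain ⟨b, hb⟩ : ∃ b : V, b = (q ⟨C.card - 1, by omega⟩).1 := ⟨_, rfl⟩
  have hit : ∀ i (hi : i < C.card), p^[i] a = q ⟨i, hi⟩ := by
    intro i
    induction i with
    | zero => exact fun _ => ha
    | succ i ih =>
      intro hi
      rw [Function.iterate_succ_apply', ih (by omega), hp1]
      congr 2
      apply Fin.ext
      simp only [hnxt]
      omega
  have hiter : ∀ m (i : Fin C.card), p^[m] (q i) = q ⟨min (i + m) (C.card - 1), by omega⟩ := by
    intro m
    induction m with
    | zero =>
      intro i
      rw [Function.iterate_zero, id]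
      congr 2
      apply Fin.ext
      have := i.2
      simp only
      omega
    | succ m ih =>
      intro i
      rw [Function.iterate_succ_apply', ih, hp1]
      congr 2
      apply Fin.ext
      simp only [hnxt]
      omega
  have hpC : ∀ x ∈ C, p x ∈ C := fun x hx => by
    simp only [hp]
    rw [dif_pos hx]
    exact Subtype.mem _
  have hroot : ∀ x, Cyc p x → x = b := by
    intro x hx
    by_cases hxC : x ∈ C
    · obtain ⟨i, hi⟩ := q.surjective ⟨x, hxC⟩
      have hxi : x = q i := by rw [hi]
      obtain ⟨m, hm⟩ := hx
      rw [hxi, hiter] at hm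
      have := congrArg Fin.val (q.injective (Subtype.ext hm))
      simp only at this
      rw [hxi, hb]
      congr 2
      apply Fin.ext
      have := i.2
      simp only
      omega
    · have h4 := (cyc_iff_desc.1 hx).of_eqOn_compl (C := (C : Set V)) (g := f) hpC hp2
        (by simpa using hxC)
      rw [hp2 x hxC] at h4
      exact absurd (mem_cycPts.2 (cyc_iff_desc.2 h4)) hxC
  have hpb : p b = b := by
    rw [hb, hp1]
    congr 2
    apply Fin.ext
    simp only [hnxt]
    omega
  have hrooted : RootedAt p b := by
    refine ⟨fun c hc => ?_, fun x => ⟨fun h => hroot x ⟨0, h⟩, fun h => h ▸ hpb⟩⟩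
    rw [hroot c hc, hpb]
  refine ⟨p, b, a, hrooted, ⟨?_, ?_, fun x hx => (hp2 x hx).symm⟩⟩
  · ext x
    rw [mem_fwd]
    constructor
    · intro hx
      obtain ⟨i, hi⟩ := q.surjective ⟨x, hx⟩
      exact ⟨i, by rw [hit i i.2, Fin.eta, hi]⟩
    · rintro ⟨m, rfl⟩
      rw [ha, hiter]
      exact Subtype.mem _
  · intro i
    rw [hit i i.2]
    rfl

theorem Joyal.validNum_le {f p : V → V} {a b : V} (h : Joyal f p a) (hr : RootedAt p b) :
    validNum f ≤ validNum p ∧ validNum p ≤ validNum f + 1 := by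
  have hpC : ∀ x ∈ (cycPts f : Set V), p x ∈ (cycPts f : Set V) := by
    intro x hx
    rw [h.cycPts_eq, Finset.mem_coe, mem_fwd] at hx ⊢
    exact (Desc.apply p x).trans hx
  have hfC : ∀ x ∈ (cycPts f : Set V), f x ∈ (cycPts f : Set V) := by
    intro x hx
    rw [Finset.mem_coe, mem_cycPts] at hx ⊢
    exact hx.apply
  have hb : b ∈ cycPts f := by
    rw [h.cycPts_eq]
    exact mem_fwd.2 ⟨_, hr.iterate_card a⟩
  have hcyc : ∀ x, Cyc p x → x ∈ cycPts f := fun x hx => by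
    rw [(hr.2 x).1 (hr.1 x hx)]
    exact hb
  constructor
  · obtain ⟨R, hR, hv⟩ := exists_valid_card_eq p
    rw [← hR]
    refine MetricDimPaper.validNum_le fun c₁ c₂ hne h₁ h₂ he => ?_
    rw [← mem_cycPts] at h₁ h₂
    rw [h.apply_eq _ h₁, h.apply_eq _ h₂] at he
    obtain ⟨x, hx, hd⟩ := hv c₁ c₂ hne (fun hc => h₁ (hcyc _ hc)) (fun hc => h₂ (hcyc _ hc)) he
    exact ⟨x, hx, hd.imp
      (fun d => d.of_eqOn_compl hpC (fun y hy => (h.apply_eq y hy).symm) h₁)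
      (fun d => d.of_eqOn_compl hpC (fun y hy => (h.apply_eq y hy).symm) h₂)⟩
  · obtain ⟨R, hR, hv⟩ := exists_valid_card_eq f
    rw [← hR]
    refine le_trans (MetricDimPaper.validNum_le (R := insert a R) ?_) (Finset.card_insert_le _ _)
    intro c₁ c₂ hne h₁ h₂ he
    by_cases hc₁ : c₁ ∈ cycPts f
    · rw [h.cycPts_eq, mem_fwd] at hc₁
      exact ⟨a, Finset.mem_insert_self _ _, Or.inl hc₁⟩
    by_cases hc₂ : c₂ ∈ cycPts f
    · rw [h.cycPts_eq, mem_fwd] at hc₂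
      exact ⟨a, Finset.mem_insert_self _ _, Or.inr hc₂⟩
    rw [← h.apply_eq _ hc₁, ← h.apply_eq _ hc₂] at he
    obtain ⟨x, hx, hd⟩ := hv c₁ c₂ hne (fun hc => hc₁ (mem_cycPts.2 hc))
      (fun hc => hc₂ (mem_cycPts.2 hc)) he
    exact ⟨x, Finset.mem_insert_of_mem hx, hd.imp
      (fun d => d.of_eqOn_compl hfC h.apply_eq hc₁)
      (fun d => d.of_eqOn_compl hfC h.apply_eq hc₂)⟩

/-- Maps of a nonempty finite set correspond to doubly rooted trees, up to a bounded change
of `validNum`. -/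
theorem exists_joyal_map (V : Type*) [Fintype V] [Nonempty V] :
    ∃ J : (V → V) → (V → V), (∀ f, CycFree (J f) ∧ IsTree (mapGraph (J f)) ∧
      validNum f ≤ validNum (J f) ∧ validNum (J f) ≤ validNum f + 1) ∧
      ∀ h : SimpleGraph V → ℝ, ∑ f, h (mapGraph (J f)) =
        (Fintype.card V : ℝ) ^ 2 * ∑ T with IsTree T, h T := by
  choose P b a hr hJ using exists_joyal_rootedAt (V := V)
  refine ⟨P, fun f => ⟨(hr f).1, (hr f).isTree, (hJ f).validNum_le (hr f)⟩, fun h => ?_⟩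
  have key : ∑ f, h (mapGraph (P f)) =
      ∑ t ∈ (Finset.univ.filter fun q : (V → V) × V => RootedAt q.1 q.2) ×ˢ
        (Finset.univ : Finset V), h (mapGraph t.1.1) := by
    refine Finset.sum_bij (fun f _ => ((P f, b f), a f)) (fun f _ => ?_) ?_ ?_ fun f _ => rfl
    · simpa using hr f
    · intro f _ f' _ he
      simp only [Prod.mk.injEq] at he
      have h1 := hJ f
      rw [he.1.1, he.2] at h1
      exact h1.left_unique (hJ f')
    · rintro ⟨⟨p, b'⟩, a'⟩ ht
      have ht' : RootedAt p b' := by simpa using ht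
      obtain ⟨f, hf⟩ := ht'.exists_joyal a'
      obtain ⟨rfl, rfl⟩ := (hJ f).right_unique hf (hr f) ht'
      refine ⟨f, Finset.mem_univ _, ?_⟩
      have : b f = b' := (ht'.2 _).1 (((hr f).2 _).2 rfl)
      rw [this]
  rw [key, Finset.sum_product]
  simp only [Finset.sum_const, Finset.card_univ, nsmul_eq_mul]
  rw [← Finset.mul_sum, sum_rootedAt h, sq, mul_assoc]

end

section

variable {V : Type*}

/-- The union of a graph on `S` and a graph on the whole vertex set. -/
def glue (S : Finset V) (T : SimpleGraph S) (G : SimpleGraph V) : SimpleGraph V where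
  Adj x y := (∃ (hx : x ∈ S) (hy : y ∈ S), T.Adj ⟨x, hx⟩ ⟨y, hy⟩) ∨ G.Adj x y
  symm := ⟨fun _ _ h => h.imp (fun ⟨hx, hy, h⟩ => ⟨hy, hx, h.symm⟩) fun h => h.symm⟩
  loopless := ⟨fun _ h => h.elim (fun ⟨_, _, h⟩ => T.loopless.irrefl _ h) (G.loopless.irrefl _)⟩

/-- `G` is a forest with no edges touching `S`. -/
def IsRest (S : Finset V) (G : SimpleGraph V) : Prop :=
  G.IsAcyclic ∧ ∀ x y, G.Adj x y → x ∉ S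

/-- The map acting as `f` on `S` and as `p` off `S`. -/
def glueFun (S : Finset V) (f : S → S) (p : V → V) (x : V) : V :=
  if hx : x ∈ S then f ⟨x, hx⟩ else p x

section glueFun

variable {S : Finset V} {f : S → S} {p : V → V}

theorem glueFun_coe (x : S) : glueFun S f p x = f x := dif_pos x.2

theorem glueFun_of_notMem {x : V} (hx : x ∉ S) : glueFun S f p x = p x := dif_neg hx

theorem glueFun_iterate (k : ℕ) (x : S) : (glueFun S f p)^[k] x = f^[k] x :=
  ((show Function.Semiconj (Subtype.val : S → V) f (glueFun S f p) from
    fun x => (glueFun_coe x).symm).iterate_right k x).symm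

theorem desc_glueFun_coe {c x : S} : Desc (glueFun S f p) c x ↔ Desc f c x := by
  refine exists_congr fun k => ?_
  rw [glueFun_iterate]
  exact Subtype.coe_injective.eq_iff

theorem cyc_glueFun_coe {c : S} : Cyc (glueFun S f p) c ↔ Cyc f c := by
  rw [cyc_iff_desc, cyc_iff_desc, glueFun_coe, desc_glueFun_coe]

theorem mapGraph_glueFun (hp : IsRest S (mapGraph p)) :
    mapGraph (glueFun S f p) = glue S (mapGraph f) (mapGraph p) := by
  have key : ∀ x y, x ≠ y → glueFun S f p x = y → (glue S (mapGraph f) (mapGraph p)).Adj x y := by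
    intro x y hne h
    by_cases hx : x ∈ S
    · have h1 : glueFun S f p x = f ⟨x, hx⟩ := glueFun_coe (⟨x, hx⟩ : S)
      rw [h1] at h
      subst h
      refine Or.inl ⟨hx, Subtype.mem _, mapGraph_adj.2 ⟨?_, Or.inl rfl⟩⟩
      exact fun e => hne (congrArg Subtype.val e)
    · rw [glueFun_of_notMem hx] at h
      exact Or.inr (mapGraph_adj.2 ⟨hne, Or.inl h⟩)
  have key2 : ∀ x y : V, ∀ (hx : x ∈ S) (hy : y ∈ S), f ⟨x, hx⟩ = ⟨y, hy⟩ →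
      glueFun S f p x = y := by
    intro x y hx hy h
    have h1 : glueFun S f p x = f ⟨x, hx⟩ := glueFun_coe (⟨x, hx⟩ : S)
    rw [h1, h]
  ext x y
  rw [mapGraph_adj]
  constructor
  · rintro ⟨hne, h | h⟩
    · exact key x y hne h
    · exact (key y x hne.symm h).symm
  · rintro (⟨hx, hy, h⟩ | h)
    · obtain ⟨hne, h⟩ := mapGraph_adj.1 h
      exact ⟨fun e => hne (Subtype.ext e), h.imp (key2 _ _ _ _) (key2 _ _ _ _)⟩
    · have hx := hp.2 _ _ h
      have hy := hp.2 _ _ h.symm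
      rw [glueFun_of_notMem hx, glueFun_of_notMem hy]
      exact mapGraph_adj.1 h

theorem cycFree_glueFun (hf : CycFree f) (hp : CycFree p) :
    CycFree (glueFun S f p) := by
  intro c hc
  by_cases hcS : c ∈ S
  · have h1 := hf ⟨c, hcS⟩ (cyc_glueFun_coe.1 hc)
    have h2 : glueFun S f p c = f ⟨c, hcS⟩ := glueFun_coe (⟨c, hcS⟩ : S)
    rw [h2, h1]
  · have h1 := (cyc_iff_desc.1 hc).of_eqOn_compl (C := (S : Set V)) (g := p)
      (fun x hx => by
        have h2 : glueFun S f p x = f ⟨x, hx⟩ := glueFun_coe (⟨x, hx⟩ : S)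
        rw [h2]
        exact Subtype.mem _)
      (fun x hx => glueFun_of_notMem hx) hcS
    rw [glueFun_of_notMem hcS] at h1 ⊢
    exact hp c (cyc_iff_desc.2 h1)

theorem validNum_glueFun_id [Fintype V] : validNum (glueFun S f id) = validNum f := by
  apply le_antisymm
  · obtain ⟨R, hR, hv⟩ := exists_valid_card_eq f
    rw [← hR, ← Finset.card_map (Function.Embedding.subtype _)]
    refine validNum_le fun c₁ c₂ hne h₁ h₂ he => ?_
    have hmem : ∀ c, ¬ Cyc (glueFun S f id) c → c ∈ S := by
      intro c hc
      by_contra hcS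
      exact hc ⟨0, glueFun_of_notMem hcS⟩
    obtain ⟨d₁, rfl⟩ : ∃ d : S, d.1 = c₁ := ⟨⟨c₁, hmem _ h₁⟩, rfl⟩
    obtain ⟨d₂, rfl⟩ : ∃ d : S, d.1 = c₂ := ⟨⟨c₂, hmem _ h₂⟩, rfl⟩
    rw [cyc_glueFun_coe] at h₁ h₂
    rw [glueFun_coe, glueFun_coe] at he
    obtain ⟨x, hx, hd⟩ := hv d₁ d₂ (fun e => hne (congrArg _ e)) h₁ h₂ (Subtype.ext he)
    exact ⟨x, Finset.mem_map_of_mem _ hx, hd.imp desc_glueFun_coe.2 desc_glueFun_coe.2⟩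
  · obtain ⟨R, hR, hv⟩ := exists_valid_card_eq (glueFun S f id)
    have hle : (R.subtype (· ∈ S)).card ≤ R.card := by
      rw [Finset.card_subtype]
      exact Finset.card_filter_le _ _
    rw [← hR]
    refine le_trans (validNum_le fun c₁ c₂ hne h₁ h₂ he => ?_) hle
    obtain ⟨x, hx, hd⟩ := hv c₁ c₂ (fun e => hne (Subtype.ext e))
      (fun h => h₁ (cyc_glueFun_coe.1 h)) (fun h => h₂ (cyc_glueFun_coe.1 h))
      (by rw [glueFun_coe, glueFun_coe, he])
    have hxS : x ∈ S := by
      by_contra hxS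
      have hfix : glueFun S f id x = x := glueFun_of_notMem hxS
      rcases hd with ⟨k, hk⟩ | ⟨k, hk⟩
      · rw [Function.iterate_fixed hfix] at hk
        exact hxS (hk ▸ c₁.2)
      · rw [Function.iterate_fixed hfix] at hk
        exact hxS (hk ▸ c₂.2)
    refine ⟨⟨x, hxS⟩, Finset.mem_subtype.2 hx, hd.imp (fun d => ?_) fun d => ?_⟩
    · exact desc_glueFun_coe.1 d
    · exact desc_glueFun_coe.1 d

end glueFun

theorem reachable_glue_of_mem {S : Finset V} {T : SimpleGraph S} {G : SimpleGraph V}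
    (hG : IsRest S G) {x y : V} (hx : x ∈ S) (h : (glue S T G).Reachable x y) : y ∈ S := by
  obtain ⟨w⟩ := h
  induction w with
  | nil => exact hx
  | cons h w ih =>
    refine ih ?_
    rcases h with ⟨-, hy, -⟩ | h
    · exact hy
    · exact absurd hx (hG.2 _ _ h)

theorem isAcyclic_glue [Fintype V] {S : Finset V} {T : SimpleGraph S} {G : SimpleGraph V}
    (hT : IsTree T) (hG : IsRest S G) : (glue S T G).IsAcyclic := by
  obtain ⟨f, hf, rfl⟩ := exists_mapGraph hT.2
  obtain ⟨p, hp, rfl⟩ := exists_mapGraph hG.1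
  rw [← mapGraph_glueFun hG]
  exact isAcyclic_mapGraph (cycFree_glueFun hf hp)

/-- The vertex set of the component of `v`. -/
def compOf [Fintype V] (F : SimpleGraph V) (v : V) : Finset V := Finset.univ.filter (F.Reachable v)

theorem mem_compOf [Fintype V] {F : SimpleGraph V} {v x : V} : x ∈ compOf F v ↔ F.Reachable v x := by
  simp [compOf]

theorem compOf_glue [Fintype V] {S : Finset V} {T : SimpleGraph S} {G : SimpleGraph V}
    (hT : IsTree T) (hG : IsRest S G) {v : V} (hv : v ∈ S) : compOf (glue S T G) v = S := by
  ext x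
  rw [mem_compOf]
  refine ⟨reachable_glue_of_mem hG hv, fun hx => ?_⟩
  let φ : T →g glue S T G := ⟨Subtype.val, fun {a b} h => Or.inl ⟨a.2, b.2, h⟩⟩
  exact (hT.1.preconnected ⟨v, hv⟩ ⟨x, hx⟩).map φ

theorem glue_injective {S : Finset V} {T T' : SimpleGraph S} {G G' : SimpleGraph V}
    (hG : IsRest S G) (hG' : IsRest S G') (h : glue S T G = glue S T' G') : G = G' ∧ T = T' := by
  have key : ∀ {T T' : SimpleGraph S} {G G' : SimpleGraph V}, IsRest S G → IsRest S G' →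
      glue S T G = glue S T' G' → G ≤ G' ∧ T ≤ T' := by
    intro T T' G G' hG hG' h
    refine ⟨fun x y hxy => ?_, fun x y hxy => ?_⟩
    · have h1 : (glue S T' G').Adj x y := h ▸ Or.inr hxy
      rcases h1 with ⟨hx, -, -⟩ | h1
      · exact absurd hx (hG.2 _ _ hxy)
      · exact h1
    · have h1 : (glue S T' G').Adj x y := h ▸ Or.inl ⟨x.2, y.2, hxy⟩
      rcases h1 with ⟨_, _, h1⟩ | h1
      · exact h1
      · exact absurd x.2 (hG'.2 _ _ h1)
  obtain ⟨h1, h2⟩ := key hG hG' h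
  obtain ⟨h3, h4⟩ := key hG' hG h.symm
  exact ⟨le_antisymm h1 h3, le_antisymm h2 h4⟩

theorem exists_glue_eq [Fintype V] {F : SimpleGraph V} (hF : F.IsAcyclic) (v : V) :
    ∃ G T, IsRest (compOf F v) G ∧ IsTree T ∧ glue (compOf F v) T G = F := by
  set S := compOf F v with hS
  have hcl : ∀ x y, F.Adj x y → x ∈ S → y ∈ S := fun x y h hx => by
    rw [hS, mem_compOf] at hx ⊢
    exact hx.trans h.reachable
  let G : SimpleGraph V :=
    { Adj := fun x y => F.Adj x y ∧ x ∉ S ∧ y ∉ S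
      symm := ⟨fun _ _ h => ⟨h.1.symm, h.2.2, h.2.1⟩⟩
      loopless := ⟨fun _ h => F.loopless.irrefl _ h.1⟩ }
  let T : SimpleGraph S := F.comap Subtype.val
  have hglue : glue S T G = F := by
    ext x y
    constructor
    · rintro (⟨_, _, h⟩ | h)
      · exact h
      · exact h.1
    · intro h
      by_cases hx : x ∈ S
      · exact Or.inl ⟨hx, hcl _ _ h hx, h⟩
      · exact Or.inr ⟨h, hx, fun hy => hx (hcl _ _ h.symm hy)⟩
  refine ⟨G, T, ⟨hF.anti fun x y h => h.1, fun x y h => h.2.1⟩, ⟨?_, ?_⟩, hglue⟩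
  · have hv : v ∈ S := mem_compOf.2 (SimpleGraph.Reachable.refl v)
    have key : ∀ x y (w : F.Walk x y) (hx : x ∈ S) (hy : y ∈ S),
        T.Reachable ⟨x, hx⟩ ⟨y, hy⟩ := by
      intro x y w
      induction w with
      | nil => exact fun _ _ => SimpleGraph.Reachable.refl _
      | @cons x y z h w ih =>
        intro hx hz
        have hy := hcl _ _ h hx
        have h1 : T.Adj ⟨x, hx⟩ ⟨y, hy⟩ := h
        exact h1.reachable.trans (ih hy hz)
    have : Nonempty S := ⟨⟨v, hv⟩⟩
    refine ⟨fun x y => ?_⟩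
    obtain ⟨w⟩ := (mem_compOf.1 x.2).symm.trans (mem_compOf.1 y.2)
    exact key _ _ w x.2 y.2
  · exact hF.comap (G := T) ⟨Subtype.val, fun {a b} h => h⟩ Subtype.val_injective

/-- A sum over forests, decomposed according to the component of a vertex. -/
theorem sum_isAcyclic_eq [Fintype V] (v : V) (H : Finset V → SimpleGraph V → ℝ) :
    ∑ F : SimpleGraph V with F.IsAcyclic, H (compOf F v) F =
      ∑ S : Finset V with v ∈ S, ∑ G with IsRest S G, ∑ T with IsTree T, H S (glue S T G) := by
  rw [← Finset.sum_fiberwise_of_maps_to (t := Finset.univ.filter fun S : Finset V => v ∈ S)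
    (g := fun F : SimpleGraph V => compOf F v)
    (fun F _ => by simpa using mem_compOf.2 (SimpleGraph.Reachable.refl v))]
  refine Finset.sum_congr rfl fun S hS => ?_
  have hv : v ∈ S := by simpa using hS
  rw [← Finset.sum_product']
  symm
  refine Finset.sum_bij (fun x _ => glue S x.2 x.1) ?_ ?_ ?_ ?_
  · rintro ⟨G, T⟩ h
    simp only [Finset.mem_product, Finset.mem_filter, Finset.mem_univ, true_and] at h ⊢
    exact ⟨isAcyclic_glue h.2 h.1, compOf_glue h.2 h.1 hv⟩
  · rintro ⟨G, T⟩ h ⟨G', T'⟩ h' he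
    simp only [Finset.mem_product, Finset.mem_filter, Finset.mem_univ, true_and] at h h'
    obtain ⟨rfl, rfl⟩ := glue_injective h.1 h'.1 he
    rfl
  · intro F hF
    simp only [Finset.mem_filter, Finset.mem_univ, true_and] at hF
    obtain ⟨hF, rfl⟩ := hF
    obtain ⟨G, T, hG, hT, h⟩ := exists_glue_eq hF v
    exact ⟨(G, T), by simp [hG, hT], h⟩
  · rintro ⟨G, T⟩ h
    simp only [Finset.mem_product, Finset.mem_filter, Finset.mem_univ, true_and] at h
    simp only
    rw [compOf_glue h.2 h.1 hv]

/-- In a uniform random forest, the expected number of ordered pairs of vertices in different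
components is less than twice the number of vertices. -/
theorem sum_sum_compOf_compl_le (V : Type*) [Fintype V] :
    ∑ F : SimpleGraph V with F.IsAcyclic, ∑ v, (compOf F v)ᶜ.card ≤
      (Finset.univ.filter fun F : SimpleGraph V => F.IsAcyclic).card * (2 * Fintype.card V) := by
  have h1 : ∀ F : SimpleGraph V, ∑ v, (compOf F v)ᶜ.card =
      (Finset.univ.filter fun x : V × V => ¬ F.Reachable x.1 x.2).card := by
    intro F
    rw [Finset.card_filter, Fintype.sum_prod_type]
    refine Finset.sum_congr rfl fun v _ => ?_
    rw [← Finset.card_filter]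
    congr 1
    ext x
    simp [mem_compOf]
  have h2 : ∀ F : SimpleGraph V, F.IsAcyclic →
      (Finset.univ.filter fun x : V × V => F.Adj x.1 x.2).card ≤ 2 * Fintype.card V := by
    intro F hF
    obtain ⟨p, -, rfl⟩ := exists_mapGraph hF
    have hsub : (Finset.univ.filter fun x : V × V => (mapGraph p).Adj x.1 x.2) ⊆
        (Finset.univ.image fun x => (x, p x)) ∪ Finset.univ.image fun x => (p x, x) := by
      rintro ⟨x, y⟩ h
      simp only [Finset.mem_filter, Finset.mem_univ, true_and, mapGraph_adj] at h
      simp only [Finset.mem_union, Finset.mem_image, Finset.mem_univ, true_and, Prod.mk.injEq]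
      rcases h.2 with h | h
      · exact Or.inl ⟨x, rfl, h⟩
      · exact Or.inr ⟨y, h, rfl⟩
    refine (Finset.card_le_card hsub).trans ((Finset.card_union_le _ _).trans ?_)
    rw [two_mul]
    exact add_le_add Finset.card_image_le Finset.card_image_le
  simp only [h1]
  rw [← Finset.card_sigma]
  calc _ ≤ ((Finset.univ.filter fun F : SimpleGraph V => F.IsAcyclic).sigma
        fun F => Finset.univ.filter fun x : V × V => F.Adj x.1 x.2).card := by
        refine Finset.card_le_card_of_injOn
          (fun a => ⟨a.1 ⊔ SimpleGraph.edge a.2.1 a.2.2, a.2⟩) ?_ ?_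
        · rintro ⟨F, x, y⟩ h
          simp only [Finset.coe_sigma, Set.mem_sigma_iff, Finset.mem_coe, Finset.mem_filter,
            Finset.mem_univ, true_and] at h ⊢
          refine ⟨(SimpleGraph.isAcyclic_add_edge_iff_of_not_reachable x y h.2).2 h.1, ?_⟩
          rw [SimpleGraph.sup_adj, SimpleGraph.edge_adj]
          refine Or.inr ⟨Or.inl ⟨rfl, rfl⟩, ?_⟩
          rintro rfl
          exact h.2 (SimpleGraph.Reachable.refl _)
        · rintro ⟨F, x, y⟩ h ⟨F', x', y'⟩ h' he
          simp only [Finset.coe_sigma, Set.mem_sigma_iff, Finset.mem_coe, Finset.mem_filter,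
            Finset.mem_univ, true_and] at h h'
          simp only [Sigma.mk.injEq, heq_eq_eq, Prod.mk.injEq] at he
          obtain ⟨he, rfl, rfl⟩ := he
          have hn : ∀ {F : SimpleGraph V}, ¬ F.Reachable x y → ∀ a b,
              (F ⊔ SimpleGraph.edge x y).Adj a b → s(a, b) ≠ s(x, y) → F.Adj a b := by
            intro F hF a b hab hne
            rw [SimpleGraph.sup_adj, SimpleGraph.edge_adj] at hab
            rcases hab with hab | ⟨hab, -⟩
            · exact hab
            · exact absurd (Sym2.eq_iff.2 hab) hne
          have hne : ∀ {F : SimpleGraph V}, ¬ F.Reachable x y → ∀ a b,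
              F.Adj a b → s(a, b) ≠ s(x, y) := by
            intro F hF a b hab he
            rcases Sym2.eq_iff.1 he with ⟨rfl, rfl⟩ | ⟨rfl, rfl⟩
            · exact hF hab.reachable
            · exact hF hab.symm.reachable
          have : F = F' := by
            ext a b
            constructor
            · intro hab
              refine hn h'.2 a b (he ▸ Or.inl hab) (hne h.2 a b hab)
            · intro hab
              refine hn h.2 a b (he ▸ Or.inl hab) (hne h'.2 a b hab)
          rw [this]
    _ ≤ _ := by
        rw [Finset.card_sigma, ← smul_eq_mul]
        refine Finset.sum_le_card_nsmul _ _ _ fun F hF => h2 F ?_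
        simpa using hF

end

section

theorem abs_validNum_sub_le_of_eqOn {V : Type*} [Fintype V] (D : Finset V) {f g : V → V}
    (h : ∀ x, x ∉ D → f x = g x) : |(validNum f : ℝ) - validNum g| ≤ 2 * D.card := by
  induction D using Finset.induction_on generalizing f with
  | empty =>
    obtain rfl : f = g := funext fun x => h x (Finset.notMem_empty x)
    simp
  | insert j D hj ih =>
    have h1 := abs_validNum_sub_le (f := f) (f' := Function.update f j (g j)) (j := j)
      fun x hx => (Function.update_of_ne hx _ _).symm
    have h2 := ih (f := Function.update f j (g j)) fun x hx => by
      by_cases hxj : x = j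
      · subst hxj
        rw [Function.update_self]
      · rw [Function.update_of_ne hxj]
        exact h x (by simp [hxj, hx])
    have h1' : |(validNum f : ℝ) - validNum (Function.update f j (g j))| ≤ 2 := by
      exact_mod_cast h1
    have h3 := abs_sub_le (validNum f : ℝ) (validNum (Function.update f j (g j))) (validNum g)
    rw [Finset.card_insert_of_notMem hj]
    push_cast
    linarith

section Sampling

variable {n : ℕ} {S : Finset (Fin n)}

/-- A map of `S` read off from a map of the ambient set, resampling the values outside `S`. -/
def resample (u : Fin n → Fin n × S) (i : S) : S :=
  if h : (u i).1 ∈ S then ⟨(u i).1, h⟩ else (u i).2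

theorem expect_resample_eq (hS : S.Nonempty) (s : S) :
    (𝔼 b : Fin n × S, if (if h : b.1 ∈ S then ⟨b.1, h⟩ else b.2) = s then (1 : ℝ) else 0) =
      (S.card : ℝ)⁻¹ := by
  have hm : (S.card : ℝ) ≠ 0 := by exact_mod_cast hS.card_pos.ne'
  have hn : (n : ℝ) ≠ 0 := by
    have := s.1.pos
    exact_mod_cast this.ne'
  have h1 : ∀ a : Fin n, ∑ z : S,
      (if (if h : a ∈ S then (⟨a, h⟩ : S) else z) = s then (1 : ℝ) else 0) =
      (if a = s then (S.card : ℝ) - 1 else 0) + (if a ∈ S then 0 else 1) +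
        (if a = s then 1 else 0) := by
    intro a
    by_cases ha : a ∈ S
    · simp only [ha, dif_pos, Subtype.ext_iff, if_true, add_zero]
      by_cases h : a = s
      · simp [h]
      · simp [h]
    · have h' : a ≠ s := fun h => ha (h ▸ s.2)
      simp [ha, h']
  rw [Fintype.expect_eq_sum_div_card, Fintype.sum_prod_type]
  simp only [h1]
  rw [Finset.sum_add_distrib, Finset.sum_add_distrib, Finset.sum_ite_eq', Finset.sum_ite_eq']
  simp only [Finset.mem_univ, if_true]
  have h2 : ∑ a : Fin n, (if a ∈ S then (0 : ℝ) else 1) = n - S.card := by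
    have : ∀ a, (if a ∈ S then (0 : ℝ) else 1) = 1 - if a ∈ S then 1 else 0 := by
      intro a; split_ifs <;> norm_num
    simp only [this, Finset.sum_sub_distrib]
    simp
  rw [h2, Fintype.card_prod, Fintype.card_fin, Fintype.card_coe]
  push_cast
  field_simp
  ring

theorem expect_resample (hS : S.Nonempty) (g : (S → S) → ℝ) :
    𝔼 u : Fin n → Fin n × S, g (resample u) = 𝔼 f, g f := by
  have hm : (S.card : ℝ) ≠ 0 := by exact_mod_cast hS.card_pos.ne'
  have key : ∀ f : S → S, (𝔼 u : Fin n → Fin n × S, if resample u = f then (1 : ℝ) else 0) =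
      ((S.card : ℝ)⁻¹) ^ S.card := by
    intro f
    set h : Fin n → Fin n × S → ℝ := fun i b => if hi : i ∈ S then
      (if (if h : b.1 ∈ S then ⟨b.1, h⟩ else b.2) = f ⟨i, hi⟩ then (1 : ℝ) else 0) else 1 with hh
    have h1 : ∀ u : Fin n → Fin n × S,
        (if resample u = f then (1 : ℝ) else 0) = ∏ i, h i (u i) := by
      intro u
      by_cases hu : resample u = f
      · rw [if_pos hu]
        refine (Finset.prod_eq_one fun i _ => ?_).symm
        simp only [hh]
        by_cases hi : i ∈ S
        · rw [dif_pos hi, if_pos]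
          exact congrFun hu ⟨i, hi⟩
        · rw [dif_neg hi]
      · rw [if_neg hu]
        obtain ⟨i, hi⟩ := Function.ne_iff.1 hu
        refine (Finset.prod_eq_zero (Finset.mem_univ i.1) ?_).symm
        simp only [hh]
        rw [dif_pos i.2, if_neg]
        exact hi
    simp only [h1]
    rw [expect_prod_pi]
    have h2 : ∀ i, 𝔼 b, h i b = if i ∈ S then (S.card : ℝ)⁻¹ else 1 := by
      intro i
      have hne : Nonempty (Fin n × S) := ⟨(i, ⟨_, hS.choose_spec⟩)⟩
      by_cases hi : i ∈ S
      · simp only [hh, dif_pos hi, if_pos hi]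
        exact expect_resample_eq hS _
      · simp only [hh, dif_neg hi, if_neg hi]
        exact Fintype.expect_const _
    simp only [h2]
    rw [Finset.prod_ite]
    simp
  have h1 : ∀ u : Fin n → Fin n × S,
      g (resample u) = ∑ f, g f * if resample u = f then (1 : ℝ) else 0 := by
    intro u
    simp
  simp only [h1]
  rw [Finset.expect_sum_comm]
  simp only [← Finset.mul_expect, key]
  rw [Fintype.expect_eq_sum_div_card, ← Finset.sum_mul, div_eq_mul_inv]
  simp

theorem expect_fst (hS : S.Nonempty) (g : (Fin n → Fin n) → ℝ) :
    𝔼 u : Fin n → Fin n × S, g (fun i => (u i).1) = 𝔼 y, g y := by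
  have : Nonempty S := hS.to_subtype
  rw [← expect_prod_fst (Y := Fin n → S) g]
  exact Fintype.expect_equiv (Equiv.arrowProdEquivProdArrow (Fin n) (fun _ => Fin n) (fun _ => S))
    _ _ fun u => rfl

/-- The number of resampled values. -/
def missNum (S : Finset (Fin n)) (u : Fin n → Fin n × S) : ℝ :=
  ∑ i, if (u i).1 ∈ S then 0 else 1

theorem missNum_nonneg (u : Fin n → Fin n × S) : 0 ≤ missNum S u :=
  Finset.sum_nonneg fun i _ => by split_ifs <;> norm_num

theorem expect_miss (hS : S.Nonempty) (i : Fin n) :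
    (𝔼 u : Fin n → Fin n × S, if (u i).1 ∈ S then (0 : ℝ) else 1) = Sᶜ.card / n := by
  have : Nonempty S := hS.to_subtype
  have hne : Nonempty (Fin n) := ⟨i⟩
  rw [expect_marginal i fun b : Fin n × S => if b.1 ∈ S then (0 : ℝ) else 1,
    expect_prod_fst (Y := S) fun a : Fin n => if a ∈ S then (0 : ℝ) else 1,
    Fintype.expect_eq_sum_div_card, Fintype.card_fin]
  congr 1
  rw [Finset.card_eq_sum_ones, ← Finset.sum_filter_add_sum_filter_not Finset.univ (· ∈ S)]
  rw [Finset.sum_congr rfl fun a ha => if_pos (Finset.mem_filter.1 ha).2,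
    Finset.sum_congr rfl fun a ha => if_neg (Finset.mem_filter.1 ha).2, Finset.sum_const_zero,
    zero_add]
  simp [Finset.filter_not, Finset.compl_eq_univ_sdiff]

theorem expect_missNum (hS : S.Nonempty) : 𝔼 u, missNum S u = Sᶜ.card := by
  have hn : (n : ℝ) ≠ 0 := by
    have := hS.choose.pos
    exact_mod_cast this.ne'
  simp only [missNum]
  rw [Finset.expect_sum_comm]
  simp only [expect_miss hS]
  rw [Finset.sum_const, Finset.card_univ, Fintype.card_fin, nsmul_eq_mul]
  field_simp

theorem pvar_missNum_le (hS : S.Nonempty) : pvar (missNum S) ≤ Sᶜ.card := by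
  have : Nonempty S := hS.to_subtype
  have hne : Nonempty (Fin n) := ⟨hS.choose⟩
  have hn : (n : ℝ) ≠ 0 := by
    have := hS.choose.pos
    exact_mod_cast this.ne'
  refine (pvar_le_sum (missNum S)).trans ?_
  have key : ∀ j : Fin n, 𝔼 p : (Fin n → Fin n × S) × (Fin n → Fin n × S),
      (missNum S p.1 - missNum S (Function.update p.1 j (p.2 j))) ^ 2 ≤
      2 * ((Sᶜ.card : ℝ) / n) := by
    intro j
    calc _ ≤ 𝔼 p : (Fin n → Fin n × S) × (Fin n → Fin n × S),
          ((if (p.1 j).1 ∈ S then (0 : ℝ) else 1) + if (p.2 j).1 ∈ S then (0 : ℝ) else 1) := by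
          refine Finset.expect_le_expect fun p _ => ?_
          have h1 : missNum S p.1 - missNum S (Function.update p.1 j (p.2 j)) =
              (if (p.1 j).1 ∈ S then (0 : ℝ) else 1) - if (p.2 j).1 ∈ S then (0 : ℝ) else 1 := by
            rw [missNum, missNum, ← Finset.sum_sub_distrib, Finset.sum_eq_single j]
            · rw [Function.update_self]
            · intro i _ hij
              rw [Function.update_of_ne hij, sub_self]
            · exact fun h => absurd (Finset.mem_univ j) h
          rw [h1]
          split_ifs <;> norm_num
      _ = 2 * ((Sᶜ.card : ℝ) / n) := by
          rw [Finset.expect_add_distrib,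
            expect_prod_fst fun u : Fin n → Fin n × S => if (u j).1 ∈ S then (0 : ℝ) else 1,
            expect_prod_snd fun u : Fin n → Fin n × S => if (u j).1 ∈ S then (0 : ℝ) else 1,
            expect_miss hS, two_mul]
  have h2 := Finset.sum_le_sum fun j (_ : j ∈ Finset.univ) => key j
  rw [Finset.sum_const, Finset.card_univ, Fintype.card_fin, nsmul_eq_mul] at h2
  have h3 : (n : ℝ) * (2 * ((Sᶜ.card : ℝ) / n)) = 2 * Sᶜ.card := by field_simp
  linarith

theorem expect_missNum_sq_le (hS : S.Nonempty) :
    𝔼 u, missNum S u ^ 2 ≤ 2 * Sᶜ.card + 2 * (Sᶜ.card : ℝ) ^ 2 := by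
  have : Nonempty S := hS.to_subtype
  have hne : Nonempty (Fin n) := ⟨hS.choose⟩
  calc _ ≤ 𝔼 u, (2 * (missNum S u - 𝔼 w, missNum S w) ^ 2 + 2 * (𝔼 w, missNum S w) ^ 2) :=
        Finset.expect_le_expect fun u _ => by
          nlinarith [sq_nonneg (missNum S u - 2 * 𝔼 w, missNum S w)]
    _ = 2 * pvar (missNum S) + 2 * (Sᶜ.card : ℝ) ^ 2 := by
        rw [Finset.expect_add_distrib, ← Finset.mul_expect, Fintype.expect_const,
          expect_missNum hS]
        simp only [pvar, expect_missNum hS]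
    _ ≤ _ := by linarith [pvar_missNum_le hS]

end Sampling

section Coupling

variable {n : ℕ} {S : Finset (Fin n)}

theorem card_fixPts_glueFun_le {V : Type*} [Fintype V] {S : Finset V} {f : S → S} {p : V → V}
    (hf : CycFree f) (hT : IsTree (mapGraph f)) :
    (fixPts (glueFun S f p)).card ≤ 1 + Sᶜ.card := by
  have h1 : ((fixPts (glueFun S f p)).filter (· ∈ S)).card ≤ 1 := by
    rw [Finset.card_le_one]
    have key : ∀ a (ha : a ∈ S), glueFun S f p a = a → f ⟨a, ha⟩ = ⟨a, ha⟩ := by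
      intro a ha h
      have h2 : glueFun S f p a = f ⟨a, ha⟩ := glueFun_coe (⟨a, ha⟩ : S)
      exact Subtype.ext (h2.symm.trans h)
    intro a ha b hb
    simp only [fixPts, Finset.mem_filter, Finset.mem_univ, true_and] at ha hb
    have h3 := hf.iterate_card_eq (hT.1.preconnected ⟨a, ha.2⟩ ⟨b, hb.2⟩)
    rw [Function.iterate_fixed (key a ha.2 ha.1), Function.iterate_fixed (key b hb.2 hb.1)] at h3
    exact congrArg Subtype.val h3
  rw [← Finset.card_filter_add_card_filter_not (s := fixPts (glueFun S f p)) (· ∈ S)]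
  refine add_le_add h1 (Finset.card_le_card fun x hx => ?_)
  simpa using (Finset.mem_filter.1 hx).2

theorem exists_coupling (hS : S.Nonempty) {G : SimpleGraph (Fin n)} (hG : IsRest S G) :
    ∃ Θ : (Fin n → Fin n × S) → SimpleGraph (Fin n),
      (∀ h : SimpleGraph (Fin n) → ℝ,
        𝔼 T : {T : SimpleGraph S // IsTree T}, h (glue S T G) = 𝔼 u, h (Θ u)) ∧
      ∀ u, |betaR (Θ u) - validVar n fun i => (u i).1| ≤
        5 * Sᶜ.card + 2 + 2 * missNum S u := by
  have hSne : Nonempty S := hS.to_subtype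
  obtain ⟨J, hJ, hsum'⟩ := exists_joyal_map S
  have hsum : ∀ h : SimpleGraph S → ℝ, ∑ f, h (mapGraph (J f)) =
      (Fintype.card S : ℝ) ^ 2 * ∑ T with IsTree T, h T := fun h => by
    convert hsum' h
  obtain ⟨p, hp, rfl⟩ := exists_mapGraph hG.1
  refine ⟨fun u => glue S (mapGraph (J (resample u))) (mapGraph p), fun h => ?_, fun u => ?_⟩
  · rw [expect_resample hS fun f => h (glue S (mapGraph (J f)) (mapGraph p)),
      Fintype.expect_eq_sum_div_card, Fintype.expect_eq_sum_div_card]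
    have h1 := hsum fun _ => 1
    have h2 := hsum fun T => h (glue S T (mapGraph p))
    have hm : (Fintype.card S : ℝ) ^ 2 ≠ 0 := pow_ne_zero _ (by
      exact_mod_cast Fintype.card_ne_zero)
    rw [h2, Finset.sum_subtype (Finset.univ.filter fun T : SimpleGraph S => IsTree T)
      (p := IsTree) (by simp)]
    have h3 : (Fintype.card (S → S) : ℝ) = (Fintype.card S : ℝ) ^ 2 *
        Fintype.card {T : SimpleGraph S // IsTree T} := by
      rw [Finset.sum_subtype (Finset.univ.filter fun T : SimpleGraph S => IsTree T)
        (p := IsTree) (by simp)] at h1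
      simpa using h1
    rw [h3, mul_div_mul_left _ _ hm]
  · set f := resample u with hf
    obtain ⟨hJ1, hJ2, hJ3, hJ4⟩ := hJ f
    set q := glueFun S (J f) p with hq
    have hqg : mapGraph q = glue S (mapGraph (J f)) (mapGraph p) := mapGraph_glueFun hG
    have hqc : CycFree q := cycFree_glueFun hJ1 hp
    have b1 := validNum_le_metricDim q
    have b2 := metricDim_le_validNum_add hqc
    have b3 : (fixPts q).card ≤ 1 + Sᶜ.card := by
      convert card_fixPts_glueFun_le hJ1 hJ2
    have b4 := abs_validNum_sub_le_of_eqOn Sᶜ (f := q) (g := glueFun S (J f) id) (by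
      intro x hx
      have hx : x ∈ S := by simpa using hx
      rw [hq, glueFun, glueFun, dif_pos hx, dif_pos hx])
    rw [validNum_glueFun_id] at b4
    set D := Sᶜ ∪ Finset.univ.filter fun i => (u i).1 ∉ S with hD
    have hDc : (D.card : ℝ) ≤ Sᶜ.card + missNum S u := by
      have h1 : (D.card : ℝ) ≤ Sᶜ.card + (Finset.univ.filter fun i => (u i).1 ∉ S).card := by
        exact_mod_cast Finset.card_union_le _ _
      refine h1.trans (le_of_eq ?_)
      rw [missNum, Finset.card_filter]
      push_cast
      congr 1
      exact Finset.sum_congr rfl fun i _ => by split_ifs <;> simp_all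
    have b5 := abs_validNum_sub_le_of_eqOn D (f := glueFun S f id) (g := fun i => (u i).1) (by
      intro x hx
      simp only [hD, Finset.mem_union, Finset.mem_compl, Finset.mem_filter, Finset.mem_univ,
        true_and, not_or, not_not] at hx
      rw [glueFun, dif_pos hx.1, hf, resample, dif_pos hx.2])
    rw [validNum_glueFun_id] at b5
    simp only
    rw [← hf, ← hqg, betaR, validVar]
    have b1' : (validNum q : ℝ) ≤ metricDim (mapGraph q) := by exact_mod_cast b1
    have b2' : (metricDim (mapGraph q) : ℝ) ≤ validNum q + (1 + Sᶜ.card) := by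
      exact_mod_cast b2.trans (by omega)
    have b6 : (validNum f : ℝ) ≤ validNum (J f) := by exact_mod_cast hJ3
    have b7 : (validNum (J f) : ℝ) ≤ validNum f + 1 := by exact_mod_cast hJ4
    rw [abs_le] at b4 b5 ⊢
    have := missNum_nonneg u
    constructor <;> linarith [b4.1, b4.2, b5.1, b5.2]

/-- Lipschitz statistics of the metric dimension of a forest with a given restriction outside one
of its components. -/
theorem abs_expect_lipschitz_sub_le (hS : S.Nonempty) {G : SimpleGraph (Fin n)} (hG : IsRest S G)
    {φ : ℝ → ℝ} {L : ℝ} (hφ : ∀ a b, |φ a - φ b| ≤ L * |a - b|) (hL : 0 ≤ L) :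
    |𝔼 T : {T : SimpleGraph S // IsTree T}, φ (betaR (glue S T G)) -
      𝔼 y, φ (validVar n y)| ≤ L * (7 * Sᶜ.card + 2) := by
  have : Nonempty S := hS.to_subtype
  have hne : Nonempty (Fin n) := ⟨hS.choose⟩
  obtain ⟨Θ, h1, h2⟩ := exists_coupling hS hG
  rw [h1 fun F => φ (betaR F), ← expect_fst hS fun y => φ (validVar n y),
    ← Finset.expect_sub_distrib]
  refine (Finset.abs_expect_le _ _).trans ?_
  calc _ ≤ 𝔼 u, L * (5 * Sᶜ.card + 2 + 2 * missNum S u) :=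
        Finset.expect_le_expect fun u _ =>
          (hφ _ _).trans (mul_le_mul_of_nonneg_left (h2 u) hL)
    _ = _ := by
        rw [← Finset.mul_expect, Finset.expect_add_distrib, Fintype.expect_const,
          ← Finset.mul_expect, expect_missNum hS]
        ring

/-- The second moment of the metric dimension of a forest with a given restriction outside one
of its components. -/
theorem abs_expect_sq_sub_le (hS : S.Nonempty) {G : SimpleGraph (Fin n)} (hG : IsRest S G)
    {m : ℝ} {ε : ℝ} (hε : 0 < ε) :
    |𝔼 T : {T : SimpleGraph S // IsTree T}, (betaR (glue S T G) - m) ^ 2 -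
      𝔼 y, (validVar n y - m) ^ 2| ≤
      ε * 𝔼 y, (validVar n y - m) ^ 2 + (1 + ε⁻¹) * (100 * (Sᶜ.card + 1) ^ 2) := by
  have : Nonempty S := hS.to_subtype
  have hne : Nonempty (Fin n) := ⟨hS.choose⟩
  obtain ⟨Θ, h1, h2⟩ := exists_coupling hS hG
  rw [h1 fun F => (betaR F - m) ^ 2, ← expect_fst hS fun y => (validVar n y - m) ^ 2,
    ← Finset.expect_sub_distrib]
  refine (Finset.abs_expect_le _ _).trans ?_
  have hk : (0 : ℝ) ≤ Sᶜ.card := Nat.cast_nonneg _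
  have hεi : 0 < ε⁻¹ := inv_pos.2 hε
  calc _ ≤ 𝔼 u, (ε * (validVar n (fun i => (u i).1) - m) ^ 2 +
        (1 + ε⁻¹) * (2 * (5 * Sᶜ.card + 2) ^ 2 + 8 * missNum S u ^ 2)) := by
        refine Finset.expect_le_expect fun u _ => ?_
        set Z := validVar n (fun i => (u i).1) - m with hZ
        obtain ⟨d, hd⟩ : ∃ d, d = betaR (Θ u) - validVar n (fun i => (u i).1) := ⟨_, rfl⟩
        have hY : betaR (Θ u) - m = Z + d := by rw [hd, hZ]; ring
        have hd2 : d ^ 2 ≤ 2 * (5 * Sᶜ.card + 2) ^ 2 + 8 * missNum S u ^ 2 := by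
          have h3 := h2 u
          rw [← hd] at h3
          have h4 : d ^ 2 ≤ (5 * Sᶜ.card + 2 + 2 * missNum S u) ^ 2 := by
            rw [← sq_abs d]
            exact pow_le_pow_left₀ (abs_nonneg d) h3 2
          nlinarith [sq_nonneg (5 * (Sᶜ.card : ℝ) + 2 - 2 * missNum S u)]
        have hzd : |2 * Z * d| ≤ ε * Z ^ 2 + ε⁻¹ * d ^ 2 := by
          have e1 : ε * Z ^ 2 + ε⁻¹ * d ^ 2 - 2 * Z * d = ε⁻¹ * (ε * Z - d) ^ 2 := by
            field_simp
            ring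
          have e2 : ε * Z ^ 2 + ε⁻¹ * d ^ 2 + 2 * Z * d = ε⁻¹ * (ε * Z + d) ^ 2 := by
            field_simp
            ring
          rw [abs_le]
          constructor
          · have := mul_nonneg hεi.le (sq_nonneg (ε * Z + d))
            linarith
          · have := mul_nonneg hεi.le (sq_nonneg (ε * Z - d))
            linarith
        rw [hY, show (Z + d) ^ 2 - Z ^ 2 = 2 * Z * d + d ^ 2 by ring]
        refine (abs_add_le _ _).trans ?_
        rw [abs_of_nonneg (sq_nonneg d)]
        have := mul_le_mul_of_nonneg_left hd2 (show (0 : ℝ) ≤ 1 + ε⁻¹ by linarith)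
        nlinarith
    _ = ε * 𝔼 u : Fin n → Fin n × S, (validVar n (fun i => (u i).1) - m) ^ 2 +
        (1 + ε⁻¹) * (2 * (5 * Sᶜ.card + 2) ^ 2 + 8 * 𝔼 u, missNum S u ^ 2) := by
        rw [Finset.expect_add_distrib, ← Finset.mul_expect, ← Finset.mul_expect,
          Finset.expect_add_distrib, Fintype.expect_const, ← Finset.mul_expect]
    _ ≤ _ := by
        have h3 := expect_missNum_sq_le hS
        have h4 : 2 * (5 * (Sᶜ.card : ℝ) + 2) ^ 2 + 8 * 𝔼 u, missNum S u ^ 2 ≤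
            100 * (Sᶜ.card + 1) ^ 2 := by nlinarith
        have := mul_le_mul_of_nonneg_left h4 (show (0 : ℝ) ≤ 1 + ε⁻¹ by linarith)
        linarith

end Coupling

end

section

/-- The forests on `Fin n`. -/
def forests (n : ℕ) : Finset (SimpleGraph (Fin n)) := Finset.univ.filter fun F => F.IsAcyclic

theorem mem_forests {n : ℕ} {F : SimpleGraph (Fin n)} : F ∈ forests n ↔ F.IsAcyclic := by
  simp [forests]

theorem forests_nonempty (n : ℕ) : (forests n).Nonempty :=
  ⟨⊥, mem_forests.2 SimpleGraph.isAcyclic_bot⟩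

/-- A vertex, the vertex set of its component, and a forest outside this component. -/
abbrev RestData (n : ℕ) : Type :=
  {x : Fin n × Finset (Fin n) × SimpleGraph (Fin n) // x.1 ∈ x.2.1 ∧ IsRest x.2.1 x.2.2}

namespace RestData

variable {n : ℕ}

/-- The trees on the vertex set of the distinguished component. -/
abbrev Trees (x : RestData n) : Type := {T : SimpleGraph x.1.2.1 // IsTree T}

/-- The forest with the given distinguished component. -/
def toForest (x : RestData n) (T : x.Trees) : SimpleGraph (Fin n) := glue x.1.2.1 T.1 x.1.2.2

/-- The number of vertices outside the distinguished component. -/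
def out (x : RestData n) : ℝ := x.1.2.1ᶜ.card

/-- The probability of given data, for a uniform random forest and a uniform random vertex. -/
def weight (x : RestData n) : ℝ := Fintype.card x.Trees / (n * (forests n).card)

theorem set_nonempty (x : RestData n) : x.1.2.1.Nonempty := ⟨_, x.2.1⟩

instance (x : RestData n) : Nonempty x.Trees := by
  have : Nonempty x.1.2.1 := x.set_nonempty.to_subtype
  obtain ⟨J, hJ, -⟩ := exists_joyal_map x.1.2.1
  exact ⟨⟨_, (hJ id).2.1⟩⟩

theorem weight_nonneg (x : RestData n) : 0 ≤ x.weight := by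
  unfold weight
  positivity

theorem out_nonneg (x : RestData n) : 0 ≤ x.out := Nat.cast_nonneg _

theorem sum_weight_mul (H : Finset (Fin n) → SimpleGraph (Fin n) → ℝ) :
    ∑ x : RestData n, x.weight * 𝔼 T, H x.1.2.1 (x.toForest T) =
      (∑ v, ∑ F ∈ forests n, H (compOf F v) F) / (n * (forests n).card) := by
  have h1 : ∀ x : RestData n, x.weight * 𝔼 T, H x.1.2.1 (x.toForest T) =
      (∑ T with IsTree T, H x.1.2.1 (glue x.1.2.1 T x.1.2.2)) / (n * (forests n).card) := by
    intro x
    have hc : (Fintype.card x.Trees : ℝ) ≠ 0 := by exact_mod_cast Fintype.card_ne_zero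
    rw [Fintype.expect_eq_sum_div_card, weight,
      Finset.sum_subtype (Finset.univ.filter fun T : SimpleGraph x.1.2.1 => IsTree T)
        (p := IsTree) (by simp)]
    simp only [toForest]
    rw [div_mul_div_comm, mul_comm, mul_div_mul_right _ _ hc]
  simp only [h1]
  rw [← Finset.sum_div]
  congr 1
  have h2 : ∀ v : Fin n, ∑ F ∈ forests n, H (compOf F v) F =
      ∑ S : Finset (Fin n) with v ∈ S, ∑ G with IsRest S G, ∑ T with IsTree T,
        H S (glue S T G) := fun v => by
    convert sum_isAcyclic_eq v H
    ext F
    simp [forests]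
  simp only [h2]
  rw [← Finset.sum_subtype (Finset.univ.filter
    fun x : Fin n × Finset (Fin n) × SimpleGraph (Fin n) => x.1 ∈ x.2.1 ∧ IsRest x.2.1 x.2.2)
    (p := fun x => x.1 ∈ x.2.1 ∧ IsRest x.2.1 x.2.2) (by simp)
    (fun x => ∑ T with IsTree T, H x.2.1 (glue x.2.1 T x.2.2)), Finset.sum_filter,
    Fintype.sum_prod_type]
  refine Finset.sum_congr rfl fun v _ => ?_
  rw [Fintype.sum_prod_type, Finset.sum_filter]
  refine Finset.sum_congr rfl fun S _ => ?_
  by_cases hv : v ∈ S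
  · simp only [hv, true_and, if_true]
    rw [Finset.sum_filter]
  · simp [hv]

theorem expect_forests [NeZero n] (h : SimpleGraph (Fin n) → ℝ) :
    𝔼 F ∈ forests n, h F = ∑ x : RestData n, x.weight * 𝔼 T, h (x.toForest T) := by
  have hn : (n : ℝ) ≠ 0 := NeZero.ne _
  rw [sum_weight_mul fun _ => h, Finset.expect_eq_sum_div_card, Finset.sum_const,
    Finset.card_univ, Fintype.card_fin, nsmul_eq_mul, mul_div_mul_left _ _ hn]

theorem sum_weight (n : ℕ) [NeZero n] : ∑ x : RestData n, x.weight = 1 := by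
  have h := expect_forests (n := n) fun _ => 1
  rw [Finset.expect_const (forests_nonempty n)] at h
  simpa using h.symm

theorem sum_weight_mul_out_le (n : ℕ) [NeZero n] : ∑ x : RestData n, x.weight * x.out ≤ 2 := by
  have hn : (0 : ℝ) < n := by exact_mod_cast NeZero.pos n
  have hf : (0 : ℝ) < (forests n).card := by exact_mod_cast (forests_nonempty n).card_pos
  have h := sum_weight_mul (n := n) fun S _ => (Sᶜ.card : ℝ)
  simp only [Fintype.expect_const] at h
  change ∑ x : RestData n, x.weight * (x.1.2.1ᶜ.card : ℝ) ≤ 2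
  rw [h, div_le_iff₀ (by positivity), Finset.sum_comm]
  have h1 : ∑ F ∈ forests n, ∑ v, (compOf F v)ᶜ.card ≤ (forests n).card * (2 * n) := by
    have := sum_sum_compOf_compl_le (Fin n)
    rw [Fintype.card_fin] at this
    convert this <;>
    · ext F
      simp [forests]
  have h2 : ∑ F ∈ forests n, ∑ v, ((compOf F v)ᶜ.card : ℝ) ≤ (forests n).card * (2 * n) := by
    exact_mod_cast h1
  linarith

theorem abs_expect_lipschitz_sub_le (x : RestData n) {φ : ℝ → ℝ} {L : ℝ}
    (hφ : ∀ a b, |φ a - φ b| ≤ L * |a - b|) (hL : 0 ≤ L) :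
    |𝔼 T, φ (betaR (x.toForest T)) - 𝔼 y, φ (validVar n y)| ≤ L * (7 * x.out + 2) :=
  MetricDimPaper.abs_expect_lipschitz_sub_le x.set_nonempty x.2.2 hφ hL

theorem abs_expect_sq_sub_le (x : RestData n) {m ε : ℝ} (hε : 0 < ε) :
    |𝔼 T, (betaR (x.toForest T) - m) ^ 2 - 𝔼 y, (validVar n y - m) ^ 2| ≤
      ε * 𝔼 y, (validVar n y - m) ^ 2 + (1 + ε⁻¹) * (100 * (x.out + 1) ^ 2) :=
  MetricDimPaper.abs_expect_sq_sub_le x.set_nonempty x.2.2 hε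

end RestData

variable {n : ℕ}

/-- Lipschitz statistics of the metric dimension of a random forest. -/
theorem abs_expect_forests_lipschitz_sub_le [NeZero n] {φ : ℝ → ℝ} {L : ℝ}
    (hφ : ∀ a b, |φ a - φ b| ≤ L * |a - b|) (hL : 0 ≤ L) :
    |𝔼 F ∈ forests n, φ (betaR F) - 𝔼 y, φ (validVar n y)| ≤ 16 * L := by
  have h1 : 𝔼 y, φ (validVar n y) = ∑ x : RestData n, x.weight * 𝔼 y, φ (validVar n y) := by
    rw [← Finset.sum_mul, RestData.sum_weight, one_mul]
  rw [h1, RestData.expect_forests fun F => φ (betaR F), ← Finset.sum_sub_distrib]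
  calc _ ≤ ∑ x : RestData n, |x.weight * 𝔼 T, φ (betaR (x.toForest T)) -
        x.weight * 𝔼 y, φ (validVar n y)| := Finset.abs_sum_le_sum_abs _ _
    _ ≤ ∑ x : RestData n, (7 * L * (x.weight * x.out) + 2 * L * x.weight) := by
        refine Finset.sum_le_sum fun x _ => ?_
        rw [← mul_sub, abs_mul, abs_of_nonneg x.weight_nonneg]
        refine (mul_le_mul_of_nonneg_left (x.abs_expect_lipschitz_sub_le hφ hL)
          x.weight_nonneg).trans (le_of_eq ?_)
        ring
    _ ≤ _ := by
        rw [Finset.sum_add_distrib, ← Finset.mul_sum, ← Finset.mul_sum, RestData.sum_weight]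
        nlinarith [RestData.sum_weight_mul_out_le n]

theorem metricDim_le_card {V : Type*} [Fintype V] [Nonempty V] (G : SimpleGraph V) :
    metricDim G ≤ Fintype.card V := by
  unfold metricDim
  split_ifs with h
  · exact Fintype.card_pos
  · refine Nat.sInf_le ⟨Set.univ, by simp [Set.ncard_univ], fun u v huv => ⟨u, trivial, ?_⟩⟩
    rw [SimpleGraph.edist_self]
    exact fun h => huv (SimpleGraph.edist_eq_zero_iff.1 h.symm).symm

theorem expect_validVar_mem [NeZero n] :
    0 ≤ 𝔼 y, validVar n y ∧ 𝔼 y, validVar n y ≤ n := by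
  refine ⟨Finset.expect_nonneg fun y _ => Nat.cast_nonneg _, ?_⟩
  refine Finset.expect_le Finset.univ_nonempty fun y _ => ?_
  have := validNum_le_card y
  rw [Fintype.card_fin] at this
  rw [validVar]
  exact_mod_cast this

theorem sq_betaR_sub_le [NeZero n] {m t : ℝ} (hm0 : 0 ≤ m) (hm1 : m ≤ n)
    (F : SimpleGraph (Fin n)) :
    (betaR F - m) ^ 2 ≤ t ^ 2 + n ^ 2 * if t < |betaR F - m| then (1 : ℝ) else 0 := by
  have h1 : betaR F ≤ n := by
    have := metricDim_le_card F
    rw [Fintype.card_fin] at this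
    rw [betaR]
    exact_mod_cast this
  have h2 : 0 ≤ betaR F := Nat.cast_nonneg _
  split_ifs with h
  · have h3 : |betaR F - m| ≤ n := abs_le.2 ⟨by linarith, by linarith⟩
    have h4 := pow_le_pow_left₀ (abs_nonneg _) h3 2
    rw [sq_abs] at h4
    linarith [sq_nonneg t]
  · have h4 := pow_le_pow_left₀ (abs_nonneg _) (not_lt.1 h) 2
    rw [sq_abs] at h4
    linarith

theorem RestData.abs_expect_sq_sub_le_tail [NeZero n] (x : RestData n) {m s ε K t : ℝ}
    (hm : m = 𝔼 y, validVar n y) (hs : s = pvar (validVar n)) (hε : 0 < ε) (hK : 0 < K) :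
    |𝔼 T, (betaR (x.toForest T) - m) ^ 2 - s| ≤
      ε * s + (1 + ε⁻¹) * (100 * ((K + 1) * (x.out + 1))) + x.out / K * (s + t ^ 2) +
        n ^ 2 * 𝔼 T, if t < |betaR (x.toForest T) - m| then 1 else 0 := by
  have hm0 := expect_validVar_mem (n := n)
  rw [← hm] at hm0
  have hs0 : 0 ≤ s := hs ▸ pvar_nonneg _
  have hs' : s = 𝔼 y, (validVar n y - m) ^ 2 := by rw [hs, hm, pvar]
  have hεi : 0 < ε⁻¹ := inv_pos.2 hε
  have ho := x.out_nonneg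
  have hA : 0 ≤ ε * s := by positivity
  have hB : 0 ≤ (1 + ε⁻¹) * (100 * ((K + 1) * (x.out + 1))) := by positivity
  have hC : 0 ≤ x.out / K * (s + t ^ 2) := by positivity
  have hE : 0 ≤ (n : ℝ) ^ 2 * 𝔼 T, if t < |betaR (x.toForest T) - m| then (1 : ℝ) else 0 :=
    mul_nonneg (by positivity) (Finset.expect_nonneg fun T _ => by split_ifs <;> norm_num)
  by_cases h : x.out ≤ K
  · have h1 := x.abs_expect_sq_sub_le (m := m) hε
    rw [← hs'] at h1
    have h2 : (x.out + 1) ^ 2 ≤ (K + 1) * (x.out + 1) := by nlinarith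
    have h3 : (1 + ε⁻¹) * (100 * (x.out + 1) ^ 2) ≤
        (1 + ε⁻¹) * (100 * ((K + 1) * (x.out + 1))) := by gcongr
    linarith
  · have h1 : 𝔼 T, (betaR (x.toForest T) - m) ^ 2 ≤ t ^ 2 + n ^ 2 *
        𝔼 T, if t < |betaR (x.toForest T) - m| then (1 : ℝ) else 0 := by
      refine (Finset.expect_le_expect fun T _ =>
        sq_betaR_sub_le (t := t) hm0.1 hm0.2 (x.toForest T)).trans (le_of_eq ?_)
      rw [Finset.expect_add_distrib, Fintype.expect_const, ← Finset.mul_expect]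
    have h2 : 0 ≤ 𝔼 T, (betaR (x.toForest T) - m) ^ 2 :=
      Finset.expect_nonneg fun T _ => sq_nonneg _
    have h3 : 1 ≤ x.out / K := (one_le_div hK).2 (not_le.1 h).le
    have h4 : s + t ^ 2 ≤ x.out / K * (s + t ^ 2) := le_mul_of_one_le_left (by positivity) h3
    have h5 := sq_nonneg t
    revert hE h1 h2
    generalize 𝔼 T, (betaR (x.toForest T) - m) ^ 2 = e
    generalize (n : ℝ) ^ 2 * 𝔼 T, (if t < |betaR (x.toForest T) - m| then (1 : ℝ) else 0) = E
    intro hE h1 h2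
    rw [abs_le]
    constructor <;> linarith

/-- The second moment of the metric dimension of a random forest, up to a tail probability. -/
theorem abs_expect_forests_sq_sub_le [NeZero n] {m s ε K t : ℝ} (hm : m = 𝔼 y, validVar n y)
    (hs : s = pvar (validVar n)) (hε : 0 < ε) (hK : 0 < K) :
    |𝔼 F ∈ forests n, (betaR F - m) ^ 2 - s| ≤
      ε * s + (1 + ε⁻¹) * (300 * (K + 1)) + 2 / K * (s + t ^ 2) +
        n ^ 2 * 𝔼 F ∈ forests n, if t < |betaR F - m| then 1 else 0 := by
  have hs0 : 0 ≤ s := hs ▸ pvar_nonneg _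
  have hεi : 0 < ε⁻¹ := inv_pos.2 hε
  have h1 : s = ∑ x : RestData n, x.weight * s := by
    rw [← Finset.sum_mul, RestData.sum_weight, one_mul]
  have h2 : 𝔼 F ∈ forests n, (betaR F - m) ^ 2 - s = ∑ x : RestData n,
      x.weight * (𝔼 T, (betaR (x.toForest T) - m) ^ 2 - s) := by
    rw [RestData.expect_forests fun F => (betaR F - m) ^ 2]
    simp only [mul_sub, Finset.sum_sub_distrib]
    rw [← h1]
  rw [h2, RestData.expect_forests fun F => if t < |betaR F - m| then (1 : ℝ) else 0]
  calc _ ≤ ∑ x : RestData n, |x.weight * (𝔼 T, (betaR (x.toForest T) - m) ^ 2 - s)| :=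
        Finset.abs_sum_le_sum_abs _ _
    _ ≤ ∑ x : RestData n, ((ε * s + (1 + ε⁻¹) * (100 * (K + 1))) * x.weight +
          ((1 + ε⁻¹) * (100 * (K + 1)) + (s + t ^ 2) / K) * (x.weight * x.out) +
          n ^ 2 * (x.weight * 𝔼 T, if t < |betaR (x.toForest T) - m| then 1 else 0)) := by
        refine Finset.sum_le_sum fun x _ => ?_
        rw [abs_mul, abs_of_nonneg x.weight_nonneg]
        refine (mul_le_mul_of_nonneg_left (x.abs_expect_sq_sub_le_tail (t := t) hm hs hε hK)
          x.weight_nonneg).trans (le_of_eq ?_)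
        ring
    _ ≤ _ := by
        rw [Finset.sum_add_distrib, Finset.sum_add_distrib, ← Finset.mul_sum, ← Finset.mul_sum,
          ← Finset.mul_sum, RestData.sum_weight]
        have h3 : 0 ≤ (1 + ε⁻¹) * (100 * (K + 1)) + (s + t ^ 2) / K := by positivity
        have h4 := mul_le_mul_of_nonneg_left (RestData.sum_weight_mul_out_le n) h3
        have h5 : 2 / K * (s + t ^ 2) = (s + t ^ 2) / K * 2 := by ring
        rw [h5]
        refine add_le_add_left ?_ _
        rw [mul_one]
        linarith

/-- Cayley's formula. -/
theorem card_pow_card_eq (V : Type*) [Fintype V] [Nonempty V] :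
    (Fintype.card V : ℝ) ^ Fintype.card V =
      Fintype.card V ^ 2 * Nat.card {T : SimpleGraph V // IsTree T} := by
  obtain ⟨_, _, h⟩ := exists_joyal_map V
  have h1 := h fun _ => 1
  rw [Finset.sum_const, Finset.sum_const, nsmul_one, nsmul_one, Finset.card_univ,
    Fintype.card_fun, Nat.cast_pow] at h1
  rw [h1, Nat.card_eq_fintype_card, Fintype.card_subtype]

/-- There are at least `n ^ (n - 2)` forests. -/
theorem card_fun_le_card_forests [NeZero n] : (n : ℝ) ^ n ≤ n ^ 2 * (forests n).card := by
  have h1 := card_pow_card_eq (Fin n)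
  rw [Fintype.card_fin] at h1
  rw [h1]
  refine mul_le_mul_of_nonneg_left (Nat.cast_le.2 ?_) (by positivity)
  rw [← Nat.card_eq_finsetCard]
  exact Nat.card_le_card_of_injective
    (fun T : {T : SimpleGraph (Fin n) // IsTree T} => (⟨T.1, mem_forests.2 T.2.2⟩ : forests n))
    fun T T' h => Subtype.ext (congrArg (fun F : forests n => F.1) h)

/-- Probabilities for a random forest, compared to a random map. -/
theorem expect_forests_le_upr [NeZero n] {P : SimpleGraph (Fin n) → Prop}
    {Q : (Fin n → Fin n) → Prop}
    (h : ∀ p : Fin n → Fin n, CycFree p → P (mapGraph p) → Q p) :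
    (𝔼 F ∈ forests n, if P F then (1 : ℝ) else 0) ≤ n ^ 2 * upr Q := by
  choose! p hp hpF using fun (F : SimpleGraph (Fin n)) (hF : F.IsAcyclic) => exists_mapGraph hF
  have hf : (0 : ℝ) < (forests n).card := by exact_mod_cast (forests_nonempty n).card_pos
  have hnn : (0 : ℝ) < (n : ℝ) ^ n := by
    have : (0 : ℝ) < n := by exact_mod_cast NeZero.pos n
    positivity
  have hcard : ((forests n).filter P).card ≤ (Finset.univ.filter Q).card := by
    refine Finset.card_le_card_of_injOn p (fun F hF => ?_) fun F hF F' hF' he => ?_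
    · obtain ⟨h1, h2⟩ := Finset.mem_filter.1 hF
      rw [mem_forests] at h1
      simp only [Finset.coe_filter, Finset.mem_univ, true_and, Set.mem_ofPred_eq]
      exact h _ (hp F h1) ((hpF F h1).symm ▸ h2)
    · have h1 := mem_forests.1 (Finset.mem_filter.1 hF).1
      have h2 := mem_forests.1 (Finset.mem_filter.1 hF').1
      rw [← hpF F h1, ← hpF F' h2, he]
  have hcard' : (((forests n).filter P).card : ℝ) ≤ (Finset.univ.filter Q).card := by
    exact_mod_cast hcard
  have e1 : upr Q = (Finset.univ.filter Q).card / (n : ℝ) ^ n := by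
    rw [upr, Fintype.expect_eq_sum_div_card, Finset.sum_boole]
    congr 1
    simp
  rw [Finset.expect_eq_sum_div_card, Finset.sum_boole, div_le_iff₀ hf, e1]
  have h3 := card_fun_le_card_forests (n := n)
  have hq : (0 : ℝ) ≤ (Finset.univ.filter Q).card := Nat.cast_nonneg _
  calc _ ≤ ((Finset.univ.filter Q).card : ℝ) := hcard'
    _ = (Finset.univ.filter Q).card / (n : ℝ) ^ n * (n : ℝ) ^ n := by field_simp
    _ ≤ (Finset.univ.filter Q).card / (n : ℝ) ^ n * (n ^ 2 * (forests n).card) := by gcongr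
    _ = _ := by ring

/-- The number of fixed points, as a random variable. -/
def fixVar (n : ℕ) (y : Fin n → Fin n) : ℝ := (fixPts y).card

theorem fixVar_eq_sum (y : Fin n → Fin n) : fixVar n y = ∑ i, if y i = i then (1 : ℝ) else 0 := by
  rw [fixVar, fixPts, Finset.card_filter]
  push_cast
  exact Finset.sum_congr rfl fun i _ => by split_ifs <;> simp_all

theorem expect_fixVar [NeZero n] : 𝔼 y, fixVar n y = 1 := by
  have hn : (n : ℝ) ≠ 0 := NeZero.ne _
  simp only [fixVar_eq_sum]
  rw [Finset.expect_sum_comm]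
  have : ∀ i : Fin n, (𝔼 y : Fin n → Fin n, if y i = i then (1 : ℝ) else 0) = 1 / n := by
    intro i
    rw [expect_marginal i fun b => if b = i then (1 : ℝ) else 0, Fintype.expect_eq_sum_div_card,
      Finset.sum_ite_eq', if_pos (Finset.mem_univ i), Fintype.card_fin]
  simp only [this]
  rw [Finset.sum_const, Finset.card_univ, Fintype.card_fin, nsmul_eq_mul]
  field_simp

theorem abs_fixVar_sub_le (y : Fin n → Fin n) (j b : Fin n) :
    |fixVar n y - fixVar n (Function.update y j b)| ≤ 1 := by
  rw [fixVar_eq_sum, fixVar_eq_sum, ← Finset.sum_sub_distrib, Finset.sum_eq_single j]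
  · split_ifs <;> norm_num
  · intro i _ hij
    rw [Function.update_of_ne hij, sub_self]
  · exact fun h => absurd (Finset.mem_univ j) h

/-- Tail bounds for the metric dimension of a random forest. -/
theorem tail_forests_le [NeZero n] {m t : ℝ} (hm : m = 𝔼 y, validVar n y) (ht : 0 ≤ t) :
    (𝔼 F ∈ forests n, if 2 * t + 1 < |betaR F - m| then (1 : ℝ) else 0) ≤
      n ^ 2 * (4 * Real.exp (-(t ^ 2 / (8 * n)))) := by
  have hn : 0 < n := NeZero.pos n
  have hn' : (0 : ℝ) < n := by exact_mod_cast hn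
  refine (expect_forests_le_upr (Q := fun y => t ≤ |validVar n y - 𝔼 y, validVar n y| ∨
    t ≤ |fixVar n y - 𝔼 y, fixVar n y|) fun p hp h => ?_).trans ?_
  · by_contra hc
    rw [not_or, not_le, not_le, ← hm, expect_fixVar] at hc
    have b1 : validVar n p ≤ betaR (mapGraph p) := by
      have := validNum_le_metricDim p
      rw [validVar, betaR]
      exact_mod_cast this
    have b2 : betaR (mapGraph p) ≤ validVar n p + fixVar n p := by
      have := metricDim_le_validNum_add hp
      rw [validVar, betaR, fixVar]
      exact_mod_cast this
    obtain ⟨h1, h2⟩ := hc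
    rw [abs_lt] at h1 h2
    rw [lt_abs] at h
    rcases h with h | h <;> linarith [h1.1, h1.2, h2.1, h2.2]
  · refine mul_le_mul_of_nonneg_left ?_ (by positivity)
    have t1 := upr_lt_abs_le (F := validVar n) two_pos hn abs_validVar_sub_le ht
    have t2 := upr_lt_abs_le (F := fixVar n) one_pos hn abs_fixVar_sub_le ht
    have t3 : Real.exp (-(t ^ 2 / (2 * n * 1 ^ 2))) ≤ Real.exp (-(t ^ 2 / (2 * n * 2 ^ 2))) := by
      rw [Real.exp_le_exp, neg_le_neg_iff]
      gcongr
      norm_num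
    have hor : upr (fun y => t ≤ |validVar n y - 𝔼 y, validVar n y| ∨
        t ≤ |fixVar n y - 𝔼 y, fixVar n y|) ≤
        upr (fun y => t ≤ |validVar n y - 𝔼 y, validVar n y|) +
          upr (fun y => t ≤ |fixVar n y - 𝔼 y, fixVar n y|) := by
      rw [upr, upr, upr, ← Finset.expect_add_distrib]
      refine Finset.expect_le_expect fun y _ => ?_
      split_ifs <;> simp_all
    rw [show (2 * n * 2 ^ 2 : ℝ) = 8 * n by ring] at t1 t3
    linarith

end

theorem expect_cexp {ι : Type*} (s : Finset ι) (r : ι → ℝ) :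
    𝔼 i ∈ s, Complex.exp (Complex.I * (r i : ℝ)) =
      ((𝔼 i ∈ s, Real.cos (r i) : ℝ) : ℂ) + Complex.I * ((𝔼 i ∈ s, Real.sin (r i) : ℝ) : ℂ) := by
  simp only [Finset.expect_eq_sum_div_card]
  push_cast
  rw [← mul_div_assoc, ← add_div, Finset.mul_sum, ← Finset.sum_add_distrib]
  congr 1
  refine Finset.sum_congr rfl fun i _ => ?_
  rw [mul_comm, Complex.exp_mul_I, mul_comm Complex.I]

theorem norm_expect_forests_cexp_sub_le {n : ℕ} [NeZero n] (a b : ℝ) :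
    ‖(𝔼 F ∈ forests n, Complex.exp (Complex.I * (a * (betaR F - b) : ℝ))) -
      𝔼 y, Complex.exp (Complex.I * (a * (validVar n y - b) : ℝ))‖ ≤ 32 * |a| := by
  have e : ∀ x y : ℝ, |a * (x - b) - a * (y - b)| = |a| * |x - y| := fun x y => by
    rw [← abs_mul]; congr 1; ring
  have h1 := abs_expect_forests_lipschitz_sub_le (n := n) (φ := fun x => Real.cos (a * (x - b)))
    (fun x y => (Real.abs_cos_sub_cos_le _ _).trans (e x y).le) (abs_nonneg a)
  have h2 := abs_expect_forests_lipschitz_sub_le (n := n) (φ := fun x => Real.sin (a * (x - b)))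
    (fun x y => (Real.abs_sin_sub_sin_le _ _).trans (e x y).le) (abs_nonneg a)
  rw [expect_cexp, expect_cexp, add_sub_add_comm, ← mul_sub, ← Complex.ofReal_sub,
    ← Complex.ofReal_sub]
  refine (norm_add_le _ _).trans ?_
  rw [norm_mul, Complex.norm_I, one_mul, Complex.norm_real, Complex.norm_real, Real.norm_eq_abs,
    Real.norm_eq_abs]
  linarith

theorem unifExp_forestSet {n : ℕ} (h : SimpleGraph (Fin n) → ℝ) :
    unifExp (forestSet n) h = 𝔼 F ∈ forests n, h F := by
  have h1 : forestSet n = (forests n : Set (SimpleGraph (Fin n))) := by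
    ext F
    simp [forestSet, mem_forests]
  rw [unifExp, h1, finsum_mem_coe_finset, Finset.expect_eq_sum_div_card]
  simp

theorem unifPr_forestSet {n : ℕ} (P : SimpleGraph (Fin n) → Prop) :
    unifPr (forestSet n) {G | P G} = 𝔼 F ∈ forests n, if P F then (1 : ℝ) else 0 := by
  have h1 : forestSet n = (forests n : Set (SimpleGraph (Fin n))) := by
    ext F
    simp [forestSet, mem_forests]
  have h2 : (forests n : Set (SimpleGraph (Fin n))) ∩ {G | P G} = ((forests n).filter P :) := by
    ext F
    simp
  rw [unifPr, h1, h2, Finset.expect_eq_sum_div_card, Finset.sum_boole]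
  simp only [Nat.card_eq_fintype_card, Fintype.card_coe, SetLike.coe_sort_coe]

/-- The second moment of the metric dimension of a random forest, centred at the mean of
`validVar`. -/
def secMom (n : ℕ) : ℝ := 𝔼 F ∈ forests n, (betaR F - 𝔼 y, validVar n y) ^ 2

theorem abs_mean_sub_le {n : ℕ} [NeZero n] :
    |unifExp (forestSet n) betaR - 𝔼 y, validVar n y| ≤ 16 := by
  rw [unifExp_forestSet]
  simpa using abs_expect_forests_lipschitz_sub_le (n := n) (φ := id) (L := 1) (by simp) zero_le_one

theorem expect_sub_sq {ι : Type*} {s : Finset ι} (hs : s.Nonempty) (f : ι → ℝ) (c : ℝ) :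
    𝔼 i ∈ s, (f i - 𝔼 j ∈ s, f j) ^ 2 = 𝔼 i ∈ s, (f i - c) ^ 2 - (𝔼 j ∈ s, f j - c) ^ 2 := by
  obtain ⟨e, he⟩ : ∃ e, e = 𝔼 j ∈ s, f j := ⟨_, rfl⟩
  rw [← he]
  have h : ∀ i, (f i - e) ^ 2 = (f i - c) ^ 2 - (2 * (e - c) * f i - (e - c) * (e + c)) :=
    fun i => by ring
  simp only [h]
  rw [Finset.expect_sub_distrib, Finset.expect_sub_distrib, ← Finset.mul_expect, ← he,
    Finset.expect_const hs]
  ring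

theorem unifVar_forestSet (n : ℕ) : unifVar (forestSet n) betaR =
    secMom n - (unifExp (forestSet n) betaR - 𝔼 y, validVar n y) ^ 2 := by
  rw [unifVar]
  simp only [unifExp_forestSet]
  exact expect_sub_sq (forests_nonempty n) _ _

/-- An error bound for the second moment. -/
def momErr (c x : ℝ) : ℝ :=
  x⁻¹ + 1200 / c * x⁻¹ ^ 3 + (2 * x⁻¹ ^ 4 + 18 / c * x⁻¹ ^ 2) +
    4 / c * (8 ^ 12 * ((x ^ 2 / 8) ^ 12 * Real.exp (-(x ^ 2 / 8))))

theorem tendsto_momErr (c : ℝ) : Tendsto (momErr c) atTop (𝓝 0) := by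
  have h1 : Tendsto (fun x : ℝ => x⁻¹) atTop (𝓝 0) := tendsto_inv_atTop_zero
  have h2 : Tendsto (fun x : ℝ => x ^ 2 / 8) atTop atTop :=
    (tendsto_pow_atTop two_ne_zero).atTop_div_const (by norm_num)
  have h3 := (Real.tendsto_pow_mul_exp_neg_atTop_nhds_zero 12).comp h2
  have := ((h1.add ((h1.pow 3).const_mul (1200 / c))).add (((h1.pow 4).const_mul 2).add
    ((h1.pow 2).const_mul (18 / c)))).add ((h3.const_mul (8 ^ 12)).const_mul (4 / c))
  unfold momErr
  simpa [Function.comp_def] using this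

theorem abs_secMom_sub_le {n : ℕ} [NeZero n] {c x : ℝ} (hc : 0 < c) (hx : 1 ≤ x)
    (hxn : x ^ 8 = n) (hcn : c * n ≤ sdev n ^ 2) :
    |secMom n / sdev n ^ 2 - 1| ≤ momErr c x := by
  have hx0 : 0 < x := by linarith
  have hn : (0 : ℝ) < n := by exact_mod_cast NeZero.pos n
  obtain ⟨s, hs⟩ : ∃ s, s = sdev n ^ 2 := ⟨_, rfl⟩
  rw [← hs] at hcn ⊢
  have hs0 : 0 < s := lt_of_lt_of_le (by positivity) hcn
  have h1 := abs_expect_forests_sq_sub_le (n := n) (t := 2 * x ^ 5 + 1) rfl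
    (hs.trans (sdev_sq n)) (inv_pos.2 hx0) (pow_pos hx0 4)
  have h2 := tail_forests_le (n := n) (t := x ^ 5) rfl (by positivity)
  have h3 : (n : ℝ) ^ 2 * (𝔼 F ∈ forests n,
      if 2 * x ^ 5 + 1 < |betaR F - 𝔼 y, validVar n y| then (1 : ℝ) else 0) ≤
      n ^ 2 * (n ^ 2 * (4 * Real.exp (-((x ^ 5) ^ 2 / (8 * n))))) := by gcongr
  rw [← hxn] at h3 h1 hcn
  rw [show (x ^ 5) ^ 2 / (8 * x ^ 8) = x ^ 2 / 8 by field_simp] at h3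
  have h4 : secMom n / s - 1 = (secMom n - s) / s := by field_simp
  rw [h4, abs_div, abs_of_pos hs0, div_le_iff₀ hs0]
  refine (h1.trans (add_le_add_right h3 _)).trans ?_
  have e0 : 0 ≤ Real.exp (-(x ^ 2 / 8)) := (Real.exp_pos _).le
  obtain ⟨E, hE⟩ : ∃ E, E = Real.exp (-(x ^ 2 / 8)) := ⟨_, rfl⟩
  rw [← hE] at e0
  have b1 : (1 + x⁻¹⁻¹) * (300 * (x ^ 4 + 1)) ≤ 1200 / c * x⁻¹ ^ 3 * s := by
    calc _ ≤ (x + x) * (300 * (x ^ 4 + x ^ 4)) := by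
          rw [inv_inv]
          gcongr
          exact one_le_pow₀ hx
      _ = 1200 / c * x⁻¹ ^ 3 * (c * x ^ 8) := by field_simp; ring
      _ ≤ _ := by gcongr
  have b2 : 2 / x ^ 4 * (s + (2 * x ^ 5 + 1) ^ 2) ≤ (2 * x⁻¹ ^ 4 + 18 / c * x⁻¹ ^ 2) * s := by
    calc _ ≤ 2 / x ^ 4 * (s + (2 * x ^ 5 + x ^ 5) ^ 2) := by
          gcongr
          exact one_le_pow₀ hx
      _ = 2 * x⁻¹ ^ 4 * s + 18 / c * x⁻¹ ^ 2 * (c * x ^ 8) := by field_simp; ring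
      _ ≤ 2 * x⁻¹ ^ 4 * s + 18 / c * x⁻¹ ^ 2 * s := by gcongr
      _ = _ := by ring
  have b3 : (x ^ 8) ^ 2 * ((x ^ 8) ^ 2 * (4 * E)) ≤
      4 / c * (8 ^ 12 * ((x ^ 2 / 8) ^ 12 * E)) * s := by
    calc _ = 4 / c * (8 ^ 12 * ((x ^ 2 / 8) ^ 12 * E)) * (c * x ^ 8) := by field_simp
      _ ≤ _ := by gcongr
  rw [momErr, ← hE]
  linarith

theorem tendsto_secMom_div : Tendsto (fun n => secMom n / sdev n ^ 2) atTop (𝓝 1) := by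
  obtain ⟨c, hc, hcn⟩ := exists_le_sdev_sq
  have hx : Tendsto (fun n : ℕ => √√√(n : ℝ)) atTop atTop :=
    Real.tendsto_sqrt_atTop.comp (Real.tendsto_sqrt_atTop.comp
      (Real.tendsto_sqrt_atTop.comp tendsto_natCast_atTop_atTop))
  rw [tendsto_iff_norm_sub_tendsto_zero]
  refine squeeze_zero' (Eventually.of_forall fun n => norm_nonneg _) ?_
    ((tendsto_momErr c).comp hx)
  filter_upwards [hcn, eventually_ge_atTop 1] with n hn h1
  have : NeZero n := ⟨by omega⟩
  have h1' : (1 : ℝ) ≤ n := by exact_mod_cast h1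
  refine abs_secMom_sub_le hc ?_ ?_ hn
  · simpa using h1
  · rw [show (8 : ℕ) = 2 * (2 * 2) by rfl, pow_mul, pow_mul, Real.sq_sqrt (by positivity),
      Real.sq_sqrt (by positivity), Real.sq_sqrt (by positivity)]

theorem tendsto_sdev : Tendsto sdev atTop atTop := by
  obtain ⟨c, hc, hcn⟩ := exists_le_sdev_sq
  have h1 : Tendsto (fun n : ℕ => √(c * n)) atTop atTop :=
    Real.tendsto_sqrt_atTop.comp (tendsto_natCast_atTop_atTop.const_mul_atTop hc)
  refine tendsto_atTop_mono' _ ?_ h1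
  filter_upwards [hcn] with n hn
  exact Real.sqrt_le_iff.2 ⟨sdev_nonneg n, hn⟩

/-- The standard deviation of the metric dimension of a random forest. -/
def forestSdev (n : ℕ) : ℝ := √(unifVar (forestSet n) betaR)

theorem tendsto_forestSdev_div : Tendsto (fun n => forestSdev n / sdev n) atTop (𝓝 1) := by
  have h1 : Tendsto (fun n => (unifExp (forestSet n) betaR - 𝔼 y, validVar n y) ^ 2 / sdev n ^ 2)
      atTop (𝓝 0) := by
    have h2 : Tendsto (fun n => 16 ^ 2 / sdev n ^ 2) atTop (𝓝 0) :=
      ((tendsto_pow_atTop two_ne_zero).comp tendsto_sdev).const_div_atTop _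
    refine squeeze_zero' (Eventually.of_forall fun n => by positivity) ?_ h2
    filter_upwards [eventually_ge_atTop 1] with n hn
    have : NeZero n := ⟨by omega⟩
    refine div_le_div_of_nonneg_right ?_ (sq_nonneg _)
    rw [sq_le_sq, abs_of_nonneg (show (0 : ℝ) ≤ 16 by norm_num)]
    exact abs_mean_sub_le
  have h2 : Tendsto (fun n => unifVar (forestSet n) betaR / sdev n ^ 2) atTop (𝓝 1) := by
    have := tendsto_secMom_div.sub h1
    rw [sub_zero] at this
    refine this.congr fun n => ?_
    rw [unifVar_forestSet, sub_div]
  have h3 := h2.sqrt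
  rw [Real.sqrt_one] at h3
  refine h3.congr fun n => ?_
  rw [Real.sqrt_div' _ (sq_nonneg _), Real.sqrt_sq (sdev_nonneg n), forestSdev]

theorem expect_abs_validVar_sub_le {n : ℕ} [NeZero n] (hs : 0 < sdev n) :
    𝔼 y, |validVar n y - 𝔼 z, validVar n z| ≤ sdev n := by
  obtain ⟨m, hm⟩ : ∃ m, m = 𝔼 z, validVar n z := ⟨_, rfl⟩
  have h1 : ∀ y, |validVar n y - m| ≤ (validVar n y - m) ^ 2 / (2 * sdev n) + sdev n / 2 := by
    intro y
    rw [← sq_abs, div_add_div _ _ (by positivity) two_ne_zero, le_div_iff₀ (by positivity)]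
    nlinarith [sq_nonneg (|validVar n y - m| - sdev n)]
  rw [← hm]
  refine (Finset.expect_le_expect fun y _ => h1 y).trans (le_of_eq ?_)
  rw [Finset.expect_add_distrib, ← Finset.expect_div, Fintype.expect_const, hm]
  have h2 := sdev_sq n
  rw [pvar] at h2
  rw [← h2]
  field_simp
  ring

theorem norm_expect_forests_cexp_sub_cchar_le {n : ℕ} [NeZero n] (hs : 0 < sdev n) (a b : ℝ) :
    ‖(𝔼 F ∈ forests n, Complex.exp
      (Complex.I * (a * (betaR F - unifExp (forestSet n) betaR) : ℝ))) - cchar (validVar n) b‖ ≤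
      48 * |a| + |a - b| * sdev n := by
  have h1 := norm_expect_forests_cexp_sub_le (n := n) a (unifExp (forestSet n) betaR)
  obtain ⟨e, he⟩ : ∃ e, e = unifExp (forestSet n) betaR := ⟨_, rfl⟩
  obtain ⟨m, hm⟩ : ∃ m, m = 𝔼 z, validVar n z := ⟨_, rfl⟩
  have h2 := abs_mean_sub_le (n := n)
  have h4 := expect_abs_validVar_sub_le hs
  rw [← he] at h1 h2 ⊢
  rw [← hm] at h2 h4
  have h3 : ‖(𝔼 y, Complex.exp (Complex.I * (a * (validVar n y - e) : ℝ))) -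
      cchar (validVar n) b‖ ≤ 16 * |a| + |a - b| * sdev n := by
    rw [cchar, ← hm, ← Finset.expect_sub_distrib]
    calc _ ≤ 𝔼 y, (|a - b| * |validVar n y - m| + |a| * 16) := by
          refine (norm_expect_le _).trans (Finset.expect_le_expect fun y _ => ?_)
          refine (norm_exp_sub_exp_le _ _).trans ?_
          rw [show a * (validVar n y - e) - b * (validVar n y - m) =
            (a - b) * (validVar n y - m) - a * (e - m) by ring]
          refine (abs_sub _ _).trans ?_
          rw [abs_mul, abs_mul]
          gcongr
      _ = |a - b| * (𝔼 y, |validVar n y - m|) + |a| * 16 := by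
          rw [Finset.expect_add_distrib, Fintype.expect_const, ← Finset.mul_expect]
      _ ≤ _ := by nlinarith [abs_nonneg (a - b)]
  refine (norm_sub_le_norm_sub_add_norm_sub _ _ _).trans ((add_le_add h1 h3).trans ?_)
  linarith

theorem tendsto_expect_cexp_normβ (θ : ℝ) :
    Tendsto (fun n => 𝔼 F ∈ forests n, Complex.exp
      (Complex.I * (θ * normβ (forestSet n) F : ℝ))) atTop
      (𝓝 (Real.exp (-(θ ^ 2 / 2)) : ℝ)) := by
  have h0 := tendsto_cchar_validVar θ
  have hr := tendsto_forestSdev_div.inv₀ one_ne_zero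
  rw [inv_one] at hr
  have hσ : Tendsto (fun n => θ / forestSdev n) atTop (𝓝 0) := by
    have := hr.mul (tendsto_sdev.const_div_atTop θ)
    rw [mul_zero] at this
    refine this.congr' ?_
    filter_upwards [tendsto_sdev.eventually_gt_atTop 0] with n hn
    rw [inv_div]
    field_simp
  have hd : Tendsto (fun n => |θ / forestSdev n - θ / sdev n| * sdev n) atTop (𝓝 0) := by
    have h1 := ((hr.sub_const 1).const_mul θ).abs
    rw [sub_self, mul_zero, abs_zero] at h1
    refine h1.congr' ?_
    filter_upwards [tendsto_sdev.eventually_gt_atTop 0] with n hn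
    rw [inv_div, ← abs_of_pos hn, ← abs_mul, abs_of_pos hn]
    congr 1
    field_simp
  have hb := (hσ.abs.const_mul 48).add hd
  rw [abs_zero, mul_zero, add_zero] at hb
  have h1 : Tendsto (fun n => (𝔼 F ∈ forests n, Complex.exp
      (Complex.I * (θ * normβ (forestSet n) F : ℝ))) - cchar (validVar n) (θ / sdev n))
      atTop (𝓝 0) := by
    refine squeeze_zero_norm' ?_ hb
    filter_upwards [tendsto_sdev.eventually_gt_atTop 0, eventually_ge_atTop 1] with n hn h1
    have : NeZero n := ⟨by omega⟩
    have h2 := norm_expect_forests_cexp_sub_cchar_le hn (θ / forestSdev n) (θ / sdev n)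
    have e : ∀ F : SimpleGraph (Fin n), θ * normβ (forestSet n) F =
        θ / forestSdev n * (betaR F - unifExp (forestSet n) betaR) := fun F => by
      rw [normβ, forestSdev]
      ring
    simp only [e]
    exact h2
  simpa using h1.add h0

open MeasureTheory ProbabilityTheory in
/-- The law of a statistic of a uniform random forest. -/
def forestLaw (n : ℕ) (X : SimpleGraph (Fin n) → ℝ) : Measure ℝ :=
  ((forests n).card : ENNReal)⁻¹ • ∑ F ∈ forests n, Measure.dirac (X F)

open MeasureTheory in
theorem forestLaw_apply {n : ℕ} (X : SimpleGraph (Fin n) → ℝ) {A : Set ℝ}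
    (hA : MeasurableSet A) :
    forestLaw n X A = ((forests n).card : ENNReal)⁻¹ * ((forests n).filter (X · ∈ A)).card := by
  rw [forestLaw, Measure.smul_apply, Measure.finsetSum_apply, smul_eq_mul, Finset.card_filter]
  push_cast
  congr 1
  refine Finset.sum_congr rfl fun F _ => ?_
  rw [Measure.dirac_apply' _ hA, Set.indicator_apply]
  rfl

open MeasureTheory in
theorem isProbabilityMeasure_forestLaw {n : ℕ} (X : SimpleGraph (Fin n) → ℝ) :
    IsProbabilityMeasure (forestLaw n X) := by
  refine ⟨?_⟩
  have h : (forests n).card ≠ 0 := (forests_nonempty n).card_pos.ne'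
  rw [forestLaw_apply X MeasurableSet.univ]
  simp only [Set.mem_univ, Finset.filter_true]
  exact ENNReal.inv_mul_cancel (by exact_mod_cast h) (ENNReal.natCast_ne_top _)

theorem charFun_forestLaw {n : ℕ} (X : SimpleGraph (Fin n) → ℝ) (θ : ℝ) :
    MeasureTheory.charFun (forestLaw n X) θ =
      𝔼 F ∈ forests n, Complex.exp (Complex.I * (θ * X F : ℝ)) := by
  rw [MeasureTheory.charFun_apply_real, forestLaw, MeasureTheory.integral_smul_measure,
    MeasureTheory.integral_finsetSum_measure, Finset.expect_eq_sum_div_card]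
  · simp only [MeasureTheory.integral_dirac]
    rw [ENNReal.toReal_inv, ENNReal.toReal_natCast, Complex.real_smul, div_eq_inv_mul]
    push_cast
    congr 1
    refine Finset.sum_congr rfl fun F _ => ?_
    congr 1
    ring
  · intro F _
    exact MeasureTheory.integrable_dirac (by simp)

theorem toReal_forestLaw_Iic {n : ℕ} (X : SimpleGraph (Fin n) → ℝ) (x : ℝ) :
    (forestLaw n X (Set.Iic x)).toReal = unifPr (forestSet n) {G | X G ≤ x} := by
  rw [forestLaw_apply X measurableSet_Iic, unifPr_forestSet, Finset.expect_eq_sum_div_card,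
    Finset.sum_boole, ENNReal.toReal_mul, ENNReal.toReal_inv, ENNReal.toReal_natCast,
    ENNReal.toReal_natCast, div_eq_inv_mul]
  rfl

theorem toReal_gaussianReal_Iic (x : ℝ) :
    (ProbabilityTheory.gaussianReal 0 1 (Set.Iic x)).toReal = stdGaussianCDF x := by
  rw [ProbabilityTheory.gaussianReal_apply_eq_integral _ one_ne_zero, ENNReal.toReal_ofReal
    (MeasureTheory.integral_nonneg fun y => ProbabilityTheory.gaussianPDFReal_nonneg _ _ _),
    stdGaussianCDF, ← MeasureTheory.integral_const_mul]
  simp [ProbabilityTheory.gaussianPDFReal]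

open MeasureTheory ProbabilityTheory in
theorem tendsto_unifPr_normβ :
    ∀ x : ℝ, Tendsto (fun n : ℕ => unifPr (forestSet n) {G | normβ (forestSet n) G ≤ x}) atTop
      (𝓝 (stdGaussianCDF x)) := by
  intro x
  have hlim : Tendsto (β := ProbabilityMeasure ℝ) (fun n : ℕ =>
      ⟨forestLaw n (normβ (forestSet n)), isProbabilityMeasure_forestLaw _⟩) atTop
      (𝓝 ⟨gaussianReal 0 1, inferInstance⟩) := by
    refine ProbabilityMeasure.tendsto_of_tendsto_charFun fun θ => ?_
    simp only [ProbabilityMeasure.coe_mk, charFun_forestLaw, charFun_gaussianReal]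
    convert tendsto_expect_cexp_normβ θ using 2
    push_cast
    congr 1
    simp
  have h2 := ProbabilityMeasure.tendsto_measure_of_null_frontier_of_tendsto' hlim
    (E := Set.Iic x) (by
      have : NullSingletonClass (gaussianReal 0 1) := nullSingletonClass_gaussianReal one_ne_zero
      rw [frontier_Iic]
      exact measure_singleton (μ := gaussianReal 0 1) x)
  have h3 := (ENNReal.tendsto_toReal (measure_ne_top (gaussianReal 0 1) _)).comp h2
  simp only [ProbabilityMeasure.coe_mk, Function.comp_def, toReal_forestLaw_Iic,
    toReal_gaussianReal_Iic] at h3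
  exact h3

/-- For a uniformly random labelled forest on `{1,…,n}`, the normalized metric
dimension `(β(F_n) − E β(F_n))/sqrt(Var β(F_n))` converges in distribution to a standard
normal random variable (pointwise convergence of CDFs; the normal CDF is continuous). -/
theorem forest_metricDim_clt :
    ∀ x : ℝ,
      Tendsto (fun n : ℕ => unifPr (forestSet n) {G | normβ (forestSet n) G ≤ x})
        atTop (𝓝 (stdGaussianCDF x)) := tendsto_unifPr_normβ

end MetricDimPaper
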